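/- arXiv:1012.2181 — 2 statements merged into one kernel-verified Lean document; each statement's English description precedes it below -/
import Mathlib

section
/- Let m ≥ 1, p = 3, p1 = 17, p2 = 19, N = 17^m·19, and q = 3^{144·17^{m−1}}. Then for every k with 0 ≤ k ≤ 322, the Cayley graph Cay(F_q, D_k) is a strongly regular graph of degree (q−1)/323, where D_k = ∪_{i=0}^{17^{m−1}−1} C_{19i + k·17^{m−1}}. -/
open scoped Classical

noncomputable section

/-- The powers of `3 ^ 144` are distinct modulo `17 ^ (n + 1)` below the exponent `17 ^ n`. -/
lemma three_pow_144_injOn {n s t : ℕ} (hs : s < 17 ^ n) (ht : t < 17 ^ n)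
    (h : (3 ^ 144) ^ s ≡ (3 ^ 144) ^ t [MOD 17 ^ (n + 1)]) : s = t := by
  wlog hst : s ≤ t generalizing s t
  · exact (this ht hs h.symm (le_of_not_ge hst)).symm
  by_contra hne
  obtain ⟨d, rfl⟩ := Nat.exists_eq_add_of_le hst
  have hd : d ≠ 0 := by rintro rfl; exact hne rfl
  have h17 : Nat.Coprime (17 ^ (n + 1)) ((3 ^ 144) ^ s) := by
    refine Nat.Coprime.pow _ _ ?_
    norm_num
  have h1 : 1 ≡ (3 ^ 144) ^ d [MOD 17 ^ (n + 1)] := by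
    refine Nat.ModEq.cancel_left_of_coprime (c := (3 ^ 144) ^ s) h17 ?_
    rw [← pow_add, mul_one]; exact h
  have hdvd : 17 ^ (n + 1) ∣ (3 ^ 144) ^ d - 1 ^ d := by
    rw [one_pow]; exact (Nat.modEq_iff_dvd' (Nat.one_le_pow _ _ (by norm_num))).1 h1
  have hp : Fact (Nat.Prime 17) := ⟨by norm_num⟩
  have hv := padicValNat.pow_sub_pow (p := 17) (by decide) (x := 3 ^ 144) (y := 1)
    (by norm_num) (by norm_num) (by norm_num) hd
  have hne0 : (3 ^ 144) ^ d - 1 ^ d ≠ 0 := by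
    rw [one_pow]
    have : 1 < (3 ^ 144) ^ d := Nat.one_lt_pow hd (by norm_num)
    omega
  have h2 := (padicValNat_dvd_iff_le (p := 17) hne0).1 hdvd
  have h3 : padicValNat 17 (3 ^ 144 - 1) = 1 := by
    refine le_antisymm ?_ ?_
    · by_contra hlt
      have := (padicValNat_dvd_iff_le (p := 17) (a := 3 ^ 144 - 1) (n := 2) (by norm_num)).2
        (by omega)
      norm_num at this
    · exact (padicValNat_dvd_iff_le (p := 17) (a := 3 ^ 144 - 1) (n := 1) (by norm_num)).1
        (by norm_num)
  have h4 : 17 ^ n ∣ d := (padicValNat_dvd_iff_le (p := 17) hd).2 (by omega)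
  have := Nat.le_of_dvd (Nat.pos_of_ne_zero hd) h4
  omega

/-- The residues modulo `323 * 17 ^ n` of the multiples of `b` by powers of `3 ^ 144` are exactly
the lifts of `b` modulo `323`. -/
lemma sum_three_pow_144_mul_mod (n b : ℕ) (hb : ¬ 17 ∣ b) :
    ∑ s ∈ Finset.range (17 ^ n), ((3 ^ 144) ^ s * b) % (323 * 17 ^ n) =
      ∑ t ∈ Finset.range (17 ^ n), (b % 323 + 323 * t) := by
  have h0 : 0 < 17 ^ n := by positivity
  have hbc : Nat.Coprime (17 ^ (n + 1)) b :=
    Nat.Coprime.pow_left _ ((Nat.Prime.coprime_iff_not_dvd (by norm_num)).2 hb)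
  have hmod : ∀ s, ((3 ^ 144) ^ s * b) % (323 * 17 ^ n) % 323 = b % 323 := by
    intro s
    rw [Nat.mod_mul_right_mod]
    have : (3 ^ 144) ^ s * b ≡ 1 ^ s * b [MOD 323] :=
      Nat.ModEq.mul_right _ (Nat.ModEq.pow _ (by decide))
    simpa [Nat.ModEq] using this
  rw [← Finset.sum_image (f := fun x => x)
      (g := fun s => ((3 ^ 144) ^ s * b) % (323 * 17 ^ n)),
    ← Finset.sum_image (f := fun x => x) (g := fun t => b % 323 + 323 * t)]
  · refine Finset.sum_congr (Finset.eq_of_subset_of_card_le ?_ ?_) fun _ _ => rfl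
    · intro x hx
      obtain ⟨s, -, rfl⟩ := Finset.mem_image.1 hx
      refine Finset.mem_image.2 ⟨((3 ^ 144) ^ s * b) % (323 * 17 ^ n) / 323, ?_, ?_⟩
      · rw [Finset.mem_range]
        exact Nat.div_lt_of_lt_mul (Nat.mod_lt _ (by positivity))
      · rw [← hmod s]; exact Nat.mod_add_div _ _
    · refine Finset.card_image_le.trans_eq (Eq.symm ?_)
      refine Finset.card_image_of_injOn ?_
      intro s hs t ht hst
      rw [Finset.mem_coe, Finset.mem_range] at hs ht
      refine three_pow_144_injOn hs ht ?_
      refine Nat.ModEq.cancel_right_of_coprime (c := b) hbc ?_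
      exact Nat.ModEq.of_dvd ⟨19, by rw [pow_succ]; ring⟩ hst
  · intro s _ t _ hst
    simpa using hst
  · intro s hs t ht hst
    rw [Finset.mem_coe, Finset.mem_range] at hs ht
    refine three_pow_144_injOn hs ht ?_
    refine Nat.ModEq.cancel_right_of_coprime (c := b) hbc ?_
    exact Nat.ModEq.of_dvd ⟨19, by rw [pow_succ]; ring⟩ hst

lemma sum_three_pow_mul_mod_323_le (c : ℕ) (hc : ¬ 17 ∣ c) :
    ∑ i ∈ Finset.range 144, (3 ^ i * c) % 323 ≤ 74 * 323 := by
  have key : ∀ c < 323, ¬ 17 ∣ c → ∑ i ∈ Finset.range 144, (3 ^ i * c) % 323 ≤ 74 * 323 := by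
    decide +kernel
  have := key (c % 323) (Nat.mod_lt _ (by norm_num)) (by omega)
  simpa only [Nat.mul_mod_mod] using this

/-- The digit sum estimate: the average of the residues `3 ^ i * c` modulo `N = 323 * 17 ^ n` barely
exceeds `N / 2`. -/
lemma two_mul_sum_three_pow_mul_mod_le (n c : ℕ) (hc : ¬ 17 ∣ c) :
    2 * ∑ i ∈ Finset.range (144 * 17 ^ n), (3 ^ i * c) % (323 * 17 ^ n) ≤
      (323 * 17 ^ n) * (144 * 17 ^ n + 4) := by
  have h1 : ∑ i ∈ Finset.range (144 * 17 ^ n), (3 ^ i * c) % (323 * 17 ^ n) =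
      ∑ i ∈ Finset.range 144, ∑ s ∈ Finset.range (17 ^ n),
        ((3 ^ 144) ^ s * (3 ^ i * c)) % (323 * 17 ^ n) := by
    rw [mul_comm 144 (17 ^ n), Finset.sum_range, ← finProdFinEquiv.sum_comp, Fintype.sum_prod_type,
      Finset.sum_comm, Finset.sum_range]
    refine Finset.sum_congr rfl fun i _ => ?_
    rw [Finset.sum_range]
    refine Finset.sum_congr rfl fun s _ => ?_
    simp only [finProdFinEquiv_apply_val]
    rw [pow_add, pow_mul]; ring_nf
  rw [h1]
  have h2 : ∀ i, ∑ s ∈ Finset.range (17 ^ n), ((3 ^ 144) ^ s * (3 ^ i * c)) % (323 * 17 ^ n) =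
      17 ^ n * ((3 ^ i * c) % 323) + 323 * ∑ t ∈ Finset.range (17 ^ n), t := by
    intro i
    rw [sum_three_pow_144_mul_mod, Finset.sum_add_distrib, Finset.mul_sum]
    · simp
    · intro h
      rcases (Nat.Prime.dvd_mul (by norm_num)).1 h with h | h
      · have := Nat.Prime.dvd_of_dvd_pow (by norm_num) h
        norm_num at this
      · exact hc h
  simp only [h2]
  rw [Finset.sum_add_distrib, ← Finset.mul_sum, Finset.sum_const, Finset.card_range, smul_eq_mul]
  have h3 := sum_three_pow_mul_mod_323_le c hc
  have h4 := Finset.sum_range_id_mul_two (17 ^ n)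
  have h5 : 1 ≤ 17 ^ n := Nat.one_le_pow _ _ (by norm_num)
  generalize 17 ^ n = e at *
  obtain ⟨e, rfl⟩ := Nat.exists_eq_add_of_le' h5
  simp only [Nat.add_sub_cancel] at h4
  nlinarith

section GaussSums

variable {F : Type*} [Field F] [Fintype F] {L : Type*} [Field L] (O : Subring L)

lemma gaussSum_mul_gaussSum_inv {χ : MulChar F L} (hχ : χ ≠ 1) {ψ : AddChar F L}
    (hψ : ψ.IsPrimitive) :
    gaussSum χ ψ * gaussSum χ⁻¹ ψ = χ⁻¹ (-1) * Fintype.card F := by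
  rw [← gaussSum_mul_gaussSum_eq_card hχ hψ, ← mul_gaussSum_inv_eq_gaussSum χ⁻¹ ψ]
  ring

/-- The Gauss sum of a product divides the product of the Gauss sums. -/
lemma exists_gaussSum_mul_gaussSum_eq (hO : ∀ (χ : MulChar F L) (x : F), χ x ∈ O)
    (χ φ : MulChar F L) {ψ : AddChar F L} (hψ : ψ.IsPrimitive) :
    ∃ J ∈ O, gaussSum χ ψ * gaussSum φ ψ = J * gaussSum (χ * φ) ψ := by
  have hψ1 : ψ ≠ 1 := by
    rintro rfl
    exact hψ one_ne_zero (by ext; simp)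
  by_cases h : χ * φ = 1
  · obtain rfl : φ = χ⁻¹ := (inv_eq_of_mul_eq_one_right h).symm
    rw [h, gaussSum_one_left hψ1]
    by_cases h1 : χ = 1
    · subst h1
      refine ⟨-1, neg_mem (one_mem _), ?_⟩
      rw [inv_one, gaussSum_one_left hψ1]
    · refine ⟨-(χ⁻¹ (-1) * Fintype.card F), neg_mem (mul_mem (hO _ _) (natCast_mem _ _)), ?_⟩
      rw [gaussSum_mul_gaussSum_inv h1 hψ]; ring
  · refine ⟨jacobiSum χ φ, ?_, ?_⟩
    · exact sum_mem fun x _ => mul_mem (hO _ _) (hO _ _)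
    · rw [← jacobiSum_mul_nontrivial h ψ, mul_comm]

lemma gaussSum_pow_three [CharP F 3] (χ : MulChar F L) {ψ : AddChar F L}
    (hψ : ∀ x, ψ (x ^ 3) = ψ x) : gaussSum (χ ^ 3) ψ = gaussSum χ ψ := by
  have : Fact (Nat.Prime 3) := ⟨by norm_num⟩
  have hb : Function.Bijective (frobenius F 3) :=
    (Finite.injective_iff_bijective).1 (frobenius_inj F 3)
  unfold gaussSum
  rw [← hb.sum_comp (fun x => χ x * ψ x)]
  refine Finset.sum_congr rfl fun x _ => ?_
  rw [frobenius_def, hψ, MulChar.pow_apply' _ (by norm_num), map_pow]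

/-- A power of `gaussSum τ ψ`, with exponent the base 3 digit sum of `3 ^ n * c / N`, is divisible
by the Gauss sum of `τ ^ (3 ^ n * c / N)`. -/
lemma exists_gaussSum_pow_eq [CharP F 3] (hO : ∀ (χ : MulChar F L) (x : F), χ x ∈ O)
    (τ : MulChar F L) {ψ : AddChar F L} (hψ : ψ.IsPrimitive) (hψ3 : ∀ x, ψ (x ^ 3) = ψ x)
    {N c : ℕ} (hc : c < N) (n : ℕ) :
    ∃ s, N * s + ∑ i ∈ Finset.range n, (3 ^ (i + 1) * c) % N =
        3 * ∑ i ∈ Finset.range n, (3 ^ i * c) % N ∧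
      ∃ J ∈ O, gaussSum τ ψ ^ s = J * gaussSum (τ ^ (3 ^ n * c / N)) ψ := by
  have hψ1 : ψ ≠ 1 := by
    rintro rfl
    exact hψ one_ne_zero (by ext; simp)
  have hpow : ∀ d, ∃ J ∈ O, gaussSum τ ψ ^ d = J * gaussSum (τ ^ d) ψ := by
    intro d
    induction d with
    | zero => exact ⟨-1, neg_mem (one_mem _), by simp [gaussSum_one_left hψ1]⟩
    | succ d ih =>
      obtain ⟨J, hJ, h⟩ := ih
      obtain ⟨K, hK, h'⟩ := exists_gaussSum_mul_gaussSum_eq O hO (τ ^ d) τ hψ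
      exact ⟨J * K, mul_mem hJ hK, by rw [pow_succ, h, mul_assoc, h', pow_succ, mul_assoc]⟩
  induction n with
  | zero =>
    refine ⟨0, by simp, -1, neg_mem (one_mem _), ?_⟩
    simp [Nat.div_eq_of_lt hc, gaussSum_one_left hψ1]
  | succ n ih =>
    obtain ⟨s, hs, J, hJ, h⟩ := ih
    set r := 3 ^ n * c % N with hr
    set A := 3 ^ n * c / N with hA
    obtain ⟨K, hK, h'⟩ := hpow (3 * r / N)
    obtain ⟨I, hI, h''⟩ := exists_gaussSum_mul_gaussSum_eq O hO ((τ ^ A) ^ 3) (τ ^ (3 * r / N)) hψ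
    have hN : 0 < N := by omega
    have h3 : 3 ^ (n + 1) * c = N * (3 * A) + 3 * r := by
      rw [pow_succ, mul_right_comm, ← Nat.div_add_mod (3 ^ n * c) N]; ring
    refine ⟨s + 3 * r / N, ?_, J * K * I, mul_mem (mul_mem hJ hK) hI, ?_⟩
    · rw [Finset.sum_range_succ, Finset.sum_range_succ, mul_add, mul_add, ← hs, ← hr, h3,
        Nat.mul_add_mod]
      have := Nat.div_add_mod (3 * r) N
      omega
    · rw [h3, Nat.mul_add_div hN, pow_add, h, h', pow_add, mul_comm 3 A, pow_mul]
      rw [gaussSum_pow_three _ hψ3] at h''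
      linear_combination J * K * h''

/-- Stickelberger's lower bound for the divisibility of a Gauss sum by powers of 3. -/
lemma gaussSum_inv_eq_three_pow_mul [CharP F 3] [CharZero L]
    (hO : ∀ (χ : MulChar F L) (x : F), χ x ∈ O)
    {τ : MulChar F L} {ψ : AddChar F L} (hψ : ψ.IsPrimitive) (hψ3 : ∀ x, ψ (x ^ 3) = ψ x)
    (hψO : ∀ x, ψ x ∈ O) {V : L} (hV : V ∈ O) (hτ : gaussSum τ ψ ^ 2 * V = 3)
    {N M c h : ℕ} (hh : 2 ≤ h) (hF : Fintype.card F = 3 ^ (2 * h)) (hNM : N * M + 1 = 3 ^ (2 * h))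
    (hc : c < N) (hne : τ ^ (M * c) ≠ 1)
    (hsum : 2 * ∑ i ∈ Finset.range (2 * h), (3 ^ i * c) % N ≤ N * (2 * h + 4)) :
    ∃ x ∈ O, gaussSum (τ ^ (M * c))⁻¹ ψ = 3 ^ (h - 2) * x := by
  obtain ⟨s, hs, J, hJ, hg⟩ := exists_gaussSum_pow_eq O hO τ hψ hψ3 hc (2 * h)
  have hN : 0 < N := by omega
  have hF' : 3 ^ (2 * h) * c = N * (M * c) + c := by rw [← hNM]; ring
  have hdiv : 3 ^ (2 * h) * c / N = M * c := by
    rw [hF', Nat.mul_add_div hN, Nat.div_eq_of_lt hc, add_zero]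
  have hs' : s ≤ 2 * h + 4 := by
    have h1 := Finset.sum_range_succ' (fun i => (3 ^ i * c) % N) (2 * h)
    have h2 := Finset.sum_range_succ (fun i => (3 ^ i * c) % N) (2 * h)
    simp only [hF', pow_zero, one_mul, Nat.mul_add_mod] at h1 h2
    have : N * s ≤ N * (2 * h + 4) := by omega
    exact Nat.le_of_mul_le_mul_left this hN
  obtain ⟨d, hd⟩ := Nat.exists_eq_add_of_le hs'
  obtain ⟨k, rfl⟩ := Nat.exists_eq_add_of_le' hh
  rw [hdiv] at hg
  have hgO : gaussSum τ ψ ^ (2 * (k + 2 + 2)) * V ^ (k + 2 + 2) = 3 ^ (k + 2 + 2) := by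
    rw [pow_mul, ← mul_pow, hτ]
  have hq := gaussSum_mul_gaussSum_inv hne hψ
  rw [hF] at hq
  push_cast at hq
  have hG : gaussSum τ ψ ∈ O := sum_mem fun x _ => mul_mem (hO _ _) (hψO _)
  refine ⟨J * (τ ^ (M * c))⁻¹ (-1) * gaussSum τ ψ ^ d * V ^ (k + 2 + 2),
    mul_mem (mul_mem (mul_mem hJ (hO _ _)) (pow_mem hG _)) (pow_mem hV _), ?_⟩
  refine mul_left_cancel₀ (pow_ne_zero (k + 4) (three_ne_zero (α := L))) ?_
  have h1 : gaussSum τ ψ ^ (2 * (k + 2 + 2)) = gaussSum τ ψ ^ s * gaussSum τ ψ ^ d := by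
    rw [← pow_add]; congr 1
  rw [h1, hg] at hgO
  have h2 : (3 : L) ^ (2 * (k + 2)) = 3 ^ (k + 4) * 3 ^ k := by rw [← pow_add]; congr 1; ring
  rw [h2] at hq
  rw [show k + 4 = k + 2 + 2 from rfl] at hq ⊢
  rw [Nat.add_sub_cancel]
  linear_combination (J * gaussSum τ ψ ^ d * V ^ (k + 2 + 2)) * hq
    - gaussSum (τ ^ (M * c))⁻¹ ψ * hgO

end GaussSums

section WittVectors

variable {F : Type*} [Field F] [Fintype F]

lemma sum_eq_zero_and_sum_inv (hF : 3 < Fintype.card F) :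
    ∑ x : F, x⁻¹ = 0 ∧ ∑ x : F, (x⁻¹) ^ 2 = 0 := by
  have hb : Function.Bijective (fun x : F => x⁻¹) := inv_involutive.bijective
  constructor
  · rw [hb.sum_comp (fun x : F => x)]
    simpa using FiniteField.sum_pow_lt_card_sub_one F 1 (by omega)
  · rw [hb.sum_comp (fun x : F => x ^ 2)]
    exact FiniteField.sum_pow_lt_card_sub_one F 2 (by omega)

lemma sum_inv_mul_inv_one_sub (hF : 3 < Fintype.card F) :
    ∑ x : F, x⁻¹ * (1 - x)⁻¹ = -2 := by
  have h1 : ∀ x : F, x⁻¹ * (1 - x)⁻¹ =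
      x⁻¹ + (1 - x)⁻¹ - ((if x = 0 then 1 else 0) + (if x = 1 then 1 else 0)) := by
    intro x
    rcases eq_or_ne x 0 with rfl | h0
    · simp
    rcases eq_or_ne x 1 with rfl | h1
    · simp
    have h2 : 1 - x ≠ 0 := sub_ne_zero.2 h1.symm
    simp only [h0, h1, if_false]
    field_simp
    ring
  have hb : Function.Bijective (fun x : F => 1 - x) :=
    (Equiv.subLeft (1 : F)).bijective
  simp only [h1]
  rw [Finset.sum_sub_distrib, Finset.sum_add_distrib, Finset.sum_add_distrib,
    hb.sum_comp (fun x : F => x⁻¹), (sum_eq_zero_and_sum_inv hF).1]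
  simp
  norm_num

lemma sum_trace_sq_mul_inv_sq [CharP F 3] [Algebra (ZMod 3) F] (hF : 3 < Fintype.card F) :
    ∑ x : F, algebraMap (ZMod 3) F (Algebra.trace (ZMod 3) F x) ^ 2 * (x⁻¹) ^ 2 = -1 := by
  have : Fact (Nat.Prime 3) := ⟨by norm_num⟩
  set f := Module.finrank (ZMod 3) F with hf
  have hcard : Fintype.card F = 3 ^ f := by
    rw [Module.card_eq_pow_finrank (K := ZMod 3), ZMod.card]
  have hf1 : 1 < f := by
    by_contra h
    have : 3 ^ f ≤ 3 ^ 1 := Nat.pow_le_pow_right (by norm_num) (by omega)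
    omega
  have hterm : ∀ x : F, algebraMap (ZMod 3) F (Algebra.trace (ZMod 3) F x) ^ 2 * (x⁻¹) ^ 2 =
      ∑ i ∈ Finset.range f, ∑ j ∈ Finset.range f, x ^ (3 ^ i + 3 ^ j) * (x⁻¹) ^ 2 := by
    intro x
    rw [FiniteField.algebraMap_trace_eq_sum_pow, sq, Finset.sum_mul_sum, Finset.sum_mul]
    refine Finset.sum_congr rfl fun i _ => ?_
    rw [Finset.sum_mul]
    refine Finset.sum_congr rfl fun j _ => ?_
    rw [← pow_add, Nat.card_zmod]
  have hij : ∀ i < f, ∀ j < f, ∑ x : F, x ^ (3 ^ i + 3 ^ j) * (x⁻¹) ^ 2 =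
      if i = 0 ∧ j = 0 then -1 else 0 := by
    intro i hi j hj
    split_ifs with h
    · obtain ⟨rfl, rfl⟩ := h
      have : ∀ x : F, x ^ (3 ^ 0 + 3 ^ 0) * (x⁻¹) ^ 2 = 1 - if x = 0 then 1 else 0 := by
        intro x
        rcases eq_or_ne x 0 with rfl | h0
        · simp
        · simp only [h0, if_false]; field_simp; norm_num
      rw [Finset.sum_congr rfl fun x _ => this x, Finset.sum_sub_distrib]
      simp
    · have hi' : 3 ^ i ≤ 3 ^ (f - 1) := Nat.pow_le_pow_right (by norm_num) (by omega)
      have hj' : 3 ^ j ≤ 3 ^ (f - 1) := Nat.pow_le_pow_right (by norm_num) (by omega)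
      have hf' : 3 ^ f = 3 * 3 ^ (f - 1) := by rw [← pow_succ']; congr 1; omega
      have h3 : 2 < 3 ^ i + 3 ^ j := by
        have hi1 : 1 ≤ 3 ^ i := Nat.one_le_pow _ _ (by norm_num)
        have hj1 : 1 ≤ 3 ^ j := Nat.one_le_pow _ _ (by norm_num)
        rcases Nat.eq_zero_or_pos i with h0 | h0
        · have : 3 ^ 1 ≤ 3 ^ j := Nat.pow_le_pow_right (by norm_num) (by omega)
          omega
        · have : 3 ^ 1 ≤ 3 ^ i := Nat.pow_le_pow_right (by norm_num) (by omega)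
          omega
      obtain ⟨d, hd⟩ := Nat.exists_eq_add_of_lt h3
      rw [← FiniteField.sum_pow_lt_card_sub_one F (d + 1) (by omega)]
      refine Finset.sum_congr rfl fun x _ => ?_
      rcases eq_or_ne x 0 with rfl | h0
      · simp
      · rw [hd]; field_simp; ring
  simp only [hterm]
  rw [Finset.sum_comm]
  have : ∀ i ∈ Finset.range f, ∑ x : F, ∑ j ∈ Finset.range f, x ^ (3 ^ i + 3 ^ j) * (x⁻¹) ^ 2 =
      if i = 0 then -1 else 0 := by
    intro i hi
    rw [Finset.sum_comm, Finset.sum_congr rfl fun j hj =>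
      hij i (Finset.mem_range.1 hi) j (Finset.mem_range.1 hj)]
    by_cases h : i = 0
    · simp only [h, true_and, if_true]
      rw [Finset.sum_ite_eq' (Finset.range f) 0 fun _ => (-1 : F)]
      simp; omega
    · simp [h]
  rw [Finset.sum_congr rfl this, Finset.sum_ite_eq' (Finset.range f) 0 fun _ => (-1 : F)]
  simp; omega

lemma sum_trace_eq_zero_inv_sq [CharP F 3] [Algebra (ZMod 3) F] (hF : 3 < Fintype.card F) :
    ∑ x : F with Algebra.trace (ZMod 3) F x = 0, (x⁻¹) ^ 2 = 1 := by
  have h : ∀ x : F, (if Algebra.trace (ZMod 3) F x = 0 then (x⁻¹) ^ 2 else 0) =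
      (x⁻¹) ^ 2 - algebraMap (ZMod 3) F (Algebra.trace (ZMod 3) F x) ^ 2 * (x⁻¹) ^ 2 := by
    intro x
    have h3 : ∀ a : ZMod 3, a ^ 2 = if a = 0 then 0 else 1 := by decide
    rw [← map_pow, h3]
    split_ifs <;> simp
  rw [Finset.sum_filter, Finset.sum_congr rfl fun x _ => h x, Finset.sum_sub_distrib,
    (sum_eq_zero_and_sum_inv hF).2, sum_trace_sq_mul_inv_sq hF]
  norm_num

end WittVectors

section Setting

/-- A field of characteristic zero with a subring `O` of integral elements, together with a
multiplicative and an additive character of `F`, suited for 3-adic estimates of Gauss sums. -/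
structure StickelbergerSetting (F : Type) [Field F] [Fintype F] (L : Type) [Field L] where
  O : Subring L
  ψ : AddChar F L
  τ : MulChar F L
  V : L
  mem_of_pow_mem : ∀ (x : L) (n : ℕ), 0 < n → x ^ n ∈ O → x ∈ O
  dvd_of_eq : ∀ (a : ℤ), ∀ x ∈ O, (a : L) = 3 * x → 3 ∣ a
  ψ_pow : ∀ x, ψ x ^ 3 = 1
  ψ_frobenius : ∀ x, ψ (x ^ 3) = ψ x
  ψ_primitive : ψ.IsPrimitive
  τ_injective : ∀ x, τ x = 1 → x = 1
  V_mem : V ∈ O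
  gaussSum_sq_mul : gaussSum τ ψ ^ 2 * V = 3

variable {F : Type} [Field F] [Fintype F]

variable (F) in
/-- The Teichmüller character of a finite field, inverted. -/
def teichmullerInv (p : ℕ) [Fact p.Prime] : MulChar F (WittVector p F) where
  toFun x := WittVector.teichmuller p x⁻¹
  map_one' := by simp
  map_mul' x y := by simp [mul_comm]
  map_nonunit' x hx := by
    have : x = 0 := by simpa using hx
    simp [this]

omit [Fintype F] in
lemma teichmullerInv_coeff_zero {p : ℕ} [Fact p.Prime] (x : F) :
    WittVector.constantCoeff (teichmullerInv F p x) = x⁻¹ := rfl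

omit [Fintype F] in
lemma exists_mul_eq_one_of_constantCoeff [CharP F 3] [Fact (Nat.Prime 3)] (w : WittVector 3 F)
    (hw : WittVector.constantCoeff w ≠ 0) : ∃ v, w * v = 1 :=
  (WittVector.isUnit_of_coeff_zero_ne_zero w hw).exists_right_inv

theorem exists_stickelbergerSetting [CharP F 3] (hF : 3 < Fintype.card F) :
    ∃ (L : Type) (_ : Field L) (_ : CharZero L), Nonempty (StickelbergerSetting F L) := by
  have hp : Fact (Nat.Prime 3) := ⟨by norm_num⟩
  let : Algebra (ZMod 3) F := ZMod.algebra F 3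
  let W := WittVector 3 F
  let K := FractionRing W
  let L := AlgebraicClosure K
  have hWL : Function.Injective (algebraMap W L) := by
    rw [IsScalarTower.algebraMap_eq W K L]
    exact (algebraMap K L).injective.comp (IsFractionRing.injective W K)
  have h3F : (3 : F) = 0 := by exact_mod_cast CharP.cast_eq_zero F 3
  have hchar : CharZero W := by
    obtain ⟨r, hr⟩ := CharP.exists W
    have hrF : ((r : ℕ) : F) = 0 := by
      rw [← map_natCast (WittVector.constantCoeff : W →+* F), CharP.cast_eq_zero, map_zero]
    have h3r : 3 ∣ r := (CharP.cast_eq_zero_iff F 3 r).1 hrF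
    rcases CharP.char_is_prime_or_zero W r with h | rfl
    · obtain rfl : 3 = r := (Nat.prime_dvd_prime_iff_eq hp.out h).1 h3r
      exact absurd (CharP.cast_eq_zero W 3) (WittVector.irreducible 3 (k := F)).ne_zero
    · exact CharP.charP_to_charZero W
  have hcharL : CharZero L := charZero_of_injective_algebraMap hWL
  refine ⟨L, inferInstance, hcharL, ?_⟩
  obtain ⟨ζ, hζ⟩ := HasEnoughRootsOfUnity.exists_primitiveRoot L 3
  let tr : F →+ ZMod 3 := (Algebra.trace (ZMod 3) F).toAddMonoidHom
  let ψ : AddChar F L := (AddChar.zmodChar 3 hζ.pow_eq_one).compAddMonoidHom tr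
  have hψ : ∀ x, ψ x = ζ ^ (Algebra.trace (ZMod 3) F x).val := fun x => rfl
  have hψ1 : ∀ x, ψ x = 1 ↔ Algebra.trace (ZMod 3) F x = 0 := by
    intro x
    rw [hψ, hζ.pow_eq_one_iff_dvd, ← ZMod.val_eq_zero]
    have := ZMod.val_lt (Algebra.trace (ZMod 3) F x)
    omega
  have hψ3 : ∀ x, ψ x ^ 3 = 1 := by
    intro x
    rw [hψ, ← pow_mul, mul_comm, pow_mul, hζ.pow_eq_one, one_pow]
  have hψp : ψ.IsPrimitive := by
    refine AddChar.IsPrimitive.of_ne_one ?_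
    intro h
    obtain ⟨x, hx⟩ := Algebra.trace_surjective (ZMod 3) F 1
    have := (hψ1 x).1 (by rw [h]; rfl)
    rw [hx] at this
    exact one_ne_zero this
  let θ : MulChar F W := teichmullerInv F 3
  let τ : MulChar F L := θ.ringHomComp (algebraMap W L)
  have hτ1 : ∀ x, τ x = 1 → x = 1 := by
    intro x hx
    have h1 : θ x = 1 := hWL (by rw [map_one]; exact hx)
    have h2 := congrArg WittVector.constantCoeff h1
    rw [teichmullerInv_coeff_zero, map_one] at h2
    exact inv_eq_one.1 h2
  have hττ : τ * τ ≠ 1 := by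
    intro h
    have h1 : ∀ x : F, (x⁻¹) ^ 2 = 1 - if x = 0 then 1 else 0 := by
      intro x
      rcases eq_or_ne x 0 with rfl | hx
      · simp
      · have h2 : τ (x * x) = 1 := by
          rw [map_mul, ← MulChar.mul_apply, h, MulChar.one_apply (isUnit_iff_ne_zero.2 hx)]
        have h3 := hτ1 _ h2
        rw [inv_pow, sq, h3]
        simp [hx]
    have h2 := (sum_eq_zero_and_sum_inv hF).2
    rw [Finset.sum_congr rfl fun x _ => h1 x, Finset.sum_sub_distrib] at h2
    simp at h2
  obtain ⟨j, hj⟩ := exists_mul_eq_one_of_constantCoeff (jacobiSum θ θ) (by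
    have : WittVector.constantCoeff (jacobiSum θ θ) = (-2 : F) := by
      rw [← sum_inv_mul_inv_one_sub hF]
      simp only [jacobiSum, map_sum, map_mul]
      rfl
    rw [this, show (-2 : F) = 1 by linear_combination -h3F]
    exact one_ne_zero)
  obtain ⟨t, ht⟩ := exists_mul_eq_one_of_constantCoeff
    (∑ x : F with Algebra.trace (ZMod 3) F x = 0, θ x ^ 2) (by
      have : WittVector.constantCoeff (∑ x : F with Algebra.trace (ZMod 3) F x = 0, θ x ^ 2) =
          (1 : F) := by
        rw [← sum_trace_eq_zero_inv_sq hF]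
        simp only [map_sum, map_pow]
        rfl
      rw [this]
      exact one_ne_zero)
  have hJ : jacobiSum τ τ = algebraMap W L (jacobiSum θ θ) :=
    jacobiSum_ringHomComp θ θ (algebraMap W L)
  have hT : 2 * gaussSum (τ * τ) ψ =
      3 * algebraMap W L (∑ x : F with Algebra.trace (ZMod 3) F x = 0, θ x ^ 2) := by
    have h0 : ∑ x, (τ * τ) x = 0 := MulChar.sum_eq_zero_of_ne_one hττ
    have h1 : ∑ x, (τ * τ) x * ψ x ^ 2 = gaussSum (τ * τ) ψ := by
      unfold gaussSum
      rw [← Equiv.sum_comp (Equiv.neg F) (fun x => (τ * τ) x * ψ x)]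
      refine Finset.sum_congr rfl fun x _ => ?_
      have hx : ψ (-x) = ψ x ^ 2 := by
        have h2 : ψ (-x) * ψ x = 1 := by rw [← AddChar.map_add_eq_mul]; simp
        linear_combination (ψ x ^ 2) * h2 - ψ (-x) * hψ3 x
      have hx' : τ (-x) * τ (-x) = τ x * τ x := by rw [← map_mul, ← map_mul, neg_mul_neg]
      simp only [Equiv.neg_apply, MulChar.mul_apply, hx, hx']
    have h2 : ∑ x, (τ * τ) x * (1 + ψ x + ψ x ^ 2) = 2 * gaussSum (τ * τ) ψ := by
      simp only [mul_add, Finset.sum_add_distrib, mul_one]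
      rw [h0, h1]; unfold gaussSum; ring
    rw [← h2, map_sum, Finset.sum_filter, Finset.mul_sum]
    refine Finset.sum_congr rfl fun x _ => ?_
    split_ifs with hx
    · rw [(hψ1 x).2 hx, MulChar.mul_apply, map_pow]
      change τ x * τ x * _ = 3 * τ x ^ 2
      ring
    · have h3 : ψ x - 1 ≠ 0 := sub_ne_zero.2 (mt (hψ1 x).1 hx)
      have h4 : 1 + ψ x + ψ x ^ 2 = 0 := by
        refine mul_left_cancel₀ h3 ?_
        linear_combination hψ3 x
      rw [h4]; ring
  refine ⟨⟨(integralClosure W L).toSubring, ψ, τ, algebraMap W L (2 * j * t), ?_, ?_, hψ3, ?_, hψp,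
    hτ1, isIntegral_algebraMap, ?_⟩⟩
  · intro x n hn hx
    exact IsIntegral.of_pow hn hx
  · intro a x hx hax
    have hx' : IsIntegral W x := hx
    have hxK : algebraMap K L ((a : K) / 3) = x := by
      rw [map_div₀, map_intCast, hax, map_ofNat]
      exact mul_div_cancel_left₀ x three_ne_zero
    rw [← hxK, isIntegral_algebraMap_iff (algebraMap K L).injective,
      IsIntegrallyClosed.isIntegral_iff] at hx'
    obtain ⟨w, hw⟩ := hx'
    have hw' : 3 * w = (a : W) := by
      refine IsFractionRing.injective W K ?_
      rw [map_mul, hw, map_ofNat, map_intCast]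
      have := charZero_of_injective_algebraMap (IsFractionRing.injective W K)
      have h3 : (3 : K) ≠ 0 := by norm_num
      exact mul_div_cancel₀ _ h3
    have h2 := congrArg WittVector.constantCoeff hw'
    rw [map_mul, map_ofNat, map_intCast] at h2
    rw [h3F, zero_mul] at h2
    exact_mod_cast (CharP.intCast_eq_zero_iff F 3 a).1 h2.symm
  · intro x
    have hinj := FaithfulSMul.algebraMap_injective (ZMod 3) F
    have : Algebra.trace (ZMod 3) F (x ^ 3) = Algebra.trace (ZMod 3) F x := by
      refine hinj ?_
      have h := congrArg (algebraMap (ZMod 3) F) (ZMod.pow_card (Algebra.trace (ZMod 3) F x))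
      rw [map_pow (algebraMap (ZMod 3) F)] at h
      rw [← h, FiniteField.algebraMap_trace_eq_sum_pow, FiniteField.algebraMap_trace_eq_sum_pow,
        sum_pow_char]
      refine Finset.sum_congr rfl fun i _ => ?_
      rw [← pow_mul, ← pow_mul, mul_comm]
    rw [hψ, hψ, this]
  · have h1 := jacobiSum_mul_nontrivial hττ ψ
    have hj' : algebraMap W L (jacobiSum θ θ) * algebraMap W L j = 1 := by
      rw [← map_mul, hj, map_one]
    have ht' := congrArg (algebraMap W L) ht
    rw [map_mul, map_one] at ht'
    rw [sq, ← h1, hJ, map_mul, map_mul, map_ofNat]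
    linear_combination (algebraMap W L (jacobiSum θ θ) * algebraMap W L j * algebraMap W L t) * hT
      + 3 * algebraMap W L (jacobiSum θ θ) * algebraMap W L j * ht' + 3 * hj'

end Setting

section Divisibility

variable {F : Type} [Field F] [Fintype F] {L : Type} [Field L] (S : StickelbergerSetting F L)

namespace StickelbergerSetting

lemma addChar_mem (x : F) : S.ψ x ∈ S.O :=
  S.mem_of_pow_mem _ 3 (by norm_num) (by rw [S.ψ_pow]; exact one_mem _)

lemma mulChar_mem (χ : MulChar F L) (x : F) : χ x ∈ S.O := by
  rcases eq_or_ne x 0 with rfl | hx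
  · rw [MulChar.map_zero]; exact zero_mem _
  · refine S.mem_of_pow_mem _ (Fintype.card F - 1) (Nat.sub_pos_of_lt Fintype.one_lt_card) ?_
    rw [← map_pow, FiniteField.pow_card_sub_one_eq_one x hx, map_one]
    exact one_mem _

lemma three_pow_dvd_of_eq [CharZero L] (k : ℕ) (a : ℤ) {x : L} (hx : x ∈ S.O) (h : (a : L) = 3 ^ k * x) :
    3 ^ k ∣ a := by
  induction k generalizing a with
  | zero => simp
  | succ k ih =>
    obtain ⟨b, rfl⟩ := S.dvd_of_eq a (3 ^ k * x)
      (mul_mem (pow_mem (ofNat_mem _ 3) _) hx) (by rw [h, pow_succ']; ring)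
    rw [pow_succ']
    refine mul_dvd_mul_left 3 (ih b (mul_left_cancel₀ three_ne_zero ?_))
    rw [← mul_assoc, ← pow_succ', ← h]; push_cast; rfl

/-- The divisibility of semi-primitive Gauss sums of order 19. -/
lemma gaussSum_inv_eq_of_pow_eq_one [CharP F 3] [CharZero L] {χ : MulChar F L} (hχ : χ ≠ 1)
    (h19 : χ ^ 19 = 1) {h : ℕ} (hh : 2 ≤ h) (hF : Fintype.card F = 3 ^ (2 * h)) :
    ∃ x ∈ S.O, gaussSum χ⁻¹ S.ψ = 3 ^ (h - 2) * x := by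
  have hpow : ∀ j : ℕ, gaussSum (χ ^ 3 ^ j) S.ψ = gaussSum χ S.ψ := by
    intro j
    induction j with
    | zero => simp
    | succ j ih => rw [pow_succ, pow_mul, gaussSum_pow_three _ S.ψ_frobenius, ih]
  have hinv : χ⁻¹ = χ ^ 3 ^ 9 := by
    refine inv_eq_of_mul_eq_one_right ?_
    rw [← pow_succ', show 3 ^ 9 + 1 = 19 * 1036 by norm_num, pow_mul, h19, one_pow]
  obtain ⟨k, rfl⟩ := Nat.exists_eq_add_of_le' hh
  have h3 : (3 : L) ≠ 0 := three_ne_zero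
  have hq := gaussSum_mul_gaussSum_inv hχ S.ψ_primitive
  rw [hF, hinv, hpow 9] at hq
  rw [Nat.add_sub_cancel, hinv, hpow 9]
  refine ⟨gaussSum χ S.ψ / 3 ^ k, S.mem_of_pow_mem _ 2 (by norm_num) ?_, ?_⟩
  · have : (gaussSum χ S.ψ / 3 ^ k) ^ 2 = (χ ^ 3 ^ 9) (-1) * (81 : ℕ) := by
      rw [div_pow, sq (gaussSum χ S.ψ), hq, div_eq_iff (pow_ne_zero _ (pow_ne_zero _ h3))]
      push_cast
      ring
    rw [this]
    exact mul_mem (S.mulChar_mem _ _) (natCast_mem _ _)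
  · field_simp

lemma gaussSum_inv_eq [CharP F 3] [CharZero L] {n M c : ℕ}
    (hF : Fintype.card F = 3 ^ (144 * 17 ^ n))
    (hM : 323 * 17 ^ n * M + 1 = Fintype.card F) (hc : c < 323 * 17 ^ n)
    (hc17 : 17 ∣ c → 17 ^ (n + 1) ∣ c) (hne : S.τ ^ (M * c) ≠ 1) :
    ∃ x ∈ S.O, gaussSum (S.τ ^ (M * c))⁻¹ S.ψ = 3 ^ (72 * 17 ^ n - 2) * x := by
  have h17 : 0 < 17 ^ n := by positivity
  have h2 : 144 * 17 ^ n = 2 * (72 * 17 ^ n) := by ring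
  by_cases h : 17 ∣ c
  · refine S.gaussSum_inv_eq_of_pow_eq_one hne ?_ (by omega) (by rw [hF, h2])
    obtain ⟨d, rfl⟩ := hc17 h
    have : M * (17 ^ (n + 1) * d) * 19 = (Fintype.card F - 1) * d := by
      rw [← hM, Nat.add_sub_cancel]; ring
    rw [← pow_mul, this, pow_mul]
    have : S.τ ^ (Fintype.card F - 1) = 1 := by
      rw [← Fintype.card_units]; exact MulChar.pow_card_eq_one _
    rw [this, one_pow]
  · refine gaussSum_inv_eq_three_pow_mul S.O S.mulChar_mem S.ψ_primitive S.ψ_frobenius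
      S.addChar_mem S.V_mem S.gaussSum_sq_mul (N := 323 * 17 ^ n) (by omega) (by rw [hF, h2])
      (by rw [hM, hF, h2]) hc hne ?_
    rw [← h2]
    exact two_mul_sum_three_pow_mul_mod_le n c h

end StickelbergerSetting

end Divisibility

section Fourier

variable {F : Type*} [Field F] [Fintype F] {L : Type*} [Field L]

/-- Fourier expansion, along the powers of a multiplicative character `χ`, of a sum over a union of
fibres of `χ`. -/
lemma natCast_mul_sum_filter_eq {N : ℕ} {χ : MulChar F L} (hχ : χ ^ N = 1) {ζ : L}
    (hζ : IsPrimitiveRoot ζ N) {e : ℕ} {a : ℕ → ℕ}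
    (ha : ∀ i < e, ∀ j < e, ζ ^ a i = ζ ^ a j → i = j) (φ : F → L) :
    N * ∑ x with ∃ i < e, χ x = ζ ^ a i, φ x =
      ∑ c ∈ Finset.range N, (∑ i ∈ Finset.range e, ζ ^ (c * a i)) * ∑ x, (χ ^ c)⁻¹ x * φ x := by
  rcases Nat.eq_zero_or_pos N with rfl | hN
  · simp
  have hζ0 : ζ ≠ 0 := hζ.ne_zero hN.ne'
  have hgeom : ∀ z : L, z ^ N = 1 → ∑ c ∈ Finset.range N, z ^ c = if z = 1 then (N : L) else 0 := by
    intro z hz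
    split_ifs with h
    · simp [h]
    · refine mul_right_cancel₀ (sub_ne_zero.2 h) ?_
      rw [geom_sum_mul, hz, sub_self, zero_mul]
  have key : ∀ x : F, ∑ c ∈ Finset.range N, (∑ i ∈ Finset.range e, ζ ^ (c * a i)) * (χ ^ c)⁻¹ x =
      if ∃ i < e, χ x = ζ ^ a i then (N : L) else 0 := by
    intro x
    rcases eq_or_ne x 0 with rfl | hx
    · rw [if_neg, Finset.sum_eq_zero]
      · intro c _
        rw [MulChar.map_zero, mul_zero]
      · rintro ⟨i, -, h⟩
        rw [MulChar.map_zero] at h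
        exact pow_ne_zero _ hζ0 h.symm
    have hx0 : χ x ≠ 0 := ((isUnit_iff_ne_zero.2 hx).map χ).ne_zero
    have hxN : χ x ^ N = 1 := by
      rw [← MulChar.pow_apply' χ hN.ne', hχ, MulChar.one_apply (isUnit_iff_ne_zero.2 hx)]
    have hinv : ∀ c, (χ ^ c)⁻¹ x = (χ x)⁻¹ ^ c := by
      intro c
      have h1 : (χ ^ c) x = χ x ^ c := MulChar.pow_apply_coe χ c (Units.mk0 x hx)
      rw [MulChar.inv_apply_eq_inv', h1, inv_pow]
    have h1 : ∑ c ∈ Finset.range N, (∑ i ∈ Finset.range e, ζ ^ (c * a i)) * (χ ^ c)⁻¹ x =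
        ∑ i ∈ Finset.range e, if χ x = ζ ^ a i then (N : L) else 0 := by
      simp_rw [Finset.sum_mul]
      rw [Finset.sum_comm]
      refine Finset.sum_congr rfl fun i _ => ?_
      have h2 : (ζ ^ a i * (χ x)⁻¹) ^ N = 1 := by
        rw [mul_pow, inv_pow, hxN, ← pow_mul, mul_comm (a i), pow_mul, hζ.pow_eq_one]; simp
      have h3 := hgeom _ h2
      simp only [mul_inv_eq_one₀ hx0, eq_comm (b := χ x)] at h3
      rw [← h3]
      refine Finset.sum_congr rfl fun c _ => ?_
      rw [hinv, mul_pow, mul_comm c, pow_mul]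
    rw [h1]
    split_ifs with h
    · obtain ⟨i, hi, h⟩ := h
      rw [Finset.sum_eq_single_of_mem i (Finset.mem_range.2 hi), if_pos h]
      intro j hj hji
      rw [if_neg]
      intro h'
      exact hji (ha j (Finset.mem_range.1 hj) i hi (h'.symm.trans h))
    · refine Finset.sum_eq_zero fun i hi => if_neg fun h' => h ⟨i, Finset.mem_range.1 hi, h'⟩
  simp_rw [Finset.mul_sum (s := Finset.univ), ← mul_assoc]
  rw [Finset.sum_comm, Finset.sum_filter, Finset.mul_sum]
  refine Finset.sum_congr rfl fun x _ => ?_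
  rw [← Finset.sum_mul, key]
  split_ifs <;> simp

end Fourier

section StronglyRegular

variable {F : Type*} [Field F] [Fintype F] {L : Type*} [Field L] {ψ : AddChar F L}

lemma sum_mul_sum_addChar_eq (hψ : ψ.IsPrimitive) (D : Finset F) (z : F) :
    ∑ y, (∑ x ∈ D, ψ (y * x)) * ψ (-(y * z)) = Fintype.card F * if z ∈ D then 1 else 0 := by
  have h1 : ∀ x, ∑ y, ψ (y * x) * ψ (-(y * z)) = if x = z then (Fintype.card F : L) else 0 := by
    intro x
    have := AddChar.sum_mulShift (x - z) hψ
    simp only [sub_eq_zero] at this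
    rw [← Nat.cast_zero, ← Nat.cast_ite, ← this]
    refine Finset.sum_congr rfl fun y _ => ?_
    rw [← AddChar.map_add_eq_mul]; congr 1; ring
  simp_rw [Finset.sum_mul]
  rw [Finset.sum_comm, Finset.sum_congr rfl fun x _ => h1 x]
  simp

lemma sum_sq_sum_addChar_eq (hψ : ψ.IsPrimitive) (D : Finset F) (z : F) :
    ∑ y, (∑ x ∈ D, ψ (y * x)) ^ 2 * ψ (-(y * z)) =
      Fintype.card F * (D.filter fun a => z - a ∈ D).card := by
  have h1 : ∀ y, (∑ x ∈ D, ψ (y * x)) ^ 2 * ψ (-(y * z)) =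
      ∑ a ∈ D, (∑ x ∈ D, ψ (y * x)) * ψ (-(y * (z - a))) := by
    intro y
    rw [← Finset.mul_sum, sq, mul_assoc]
    refine congrArg _ ?_
    rw [Finset.sum_mul]
    refine Finset.sum_congr rfl fun a _ => ?_
    rw [← AddChar.map_add_eq_mul]; congr 1; ring
  rw [Finset.sum_congr rfl fun y _ => h1 y, Finset.sum_comm,
    Finset.sum_congr rfl fun a _ => sum_mul_sum_addChar_eq hψ D (z - a)]
  rw [← Finset.mul_sum, Finset.sum_boole]

/-- A symmetric set with two nontrivial character values, the roots of `X ^ 2 = A * X + B`, defines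
a strongly regular Cayley graph. -/
lemma exists_isSRGWith [CharZero L] (hψ : ψ.IsPrimitive) (D : Finset F) (h0 : 0 ∉ D)
    (hneg : ∀ x ∈ D, -x ∈ D) {A B : L}
    (hAB : ∀ y ≠ 0, (∑ x ∈ D, ψ (y * x)) ^ 2 = A * ∑ x ∈ D, ψ (y * x) + B) :
    ∃ l u : ℕ, (SimpleGraph.fromRel (fun x y : F => x - y ∈ D)).IsSRGWith
      (Fintype.card F) D.card l u := by
  have hadj : ∀ x y, (SimpleGraph.fromRel (fun x y : F => x - y ∈ D)).Adj x y ↔ x - y ∈ D := by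
    intro x y
    rw [SimpleGraph.fromRel_adj]
    constructor
    · rintro ⟨-, h | h⟩
      · exact h
      · simpa using hneg _ h
    · intro h
      refine ⟨?_, Or.inl h⟩
      rintro rfl
      exact h0 (by simpa using h)
  have hcount : ∀ z ≠ 0, (Fintype.card F : L) * (D.filter fun a => z - a ∈ D).card =
      (D.card : L) ^ 2 - A * D.card - B + A * (Fintype.card F * if z ∈ D then 1 else 0) := by
    intro z hz
    rw [← sum_sq_sum_addChar_eq hψ, ← sum_mul_sum_addChar_eq hψ]
    have h2 : ∑ y, ψ (-(y * z)) = 0 := by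
      have := AddChar.sum_mulShift (-z) hψ
      rw [if_neg (neg_ne_zero.2 hz), Nat.cast_zero] at this
      simpa only [mul_neg] using this
    have h3 : ∀ y, (∑ x ∈ D, ψ (y * x)) ^ 2 * ψ (-(y * z)) =
        A * ((∑ x ∈ D, ψ (y * x)) * ψ (-(y * z))) + B * ψ (-(y * z)) +
          if y = 0 then (D.card : L) ^ 2 - A * D.card - B else 0 := by
      intro y
      split_ifs with hy
      · subst hy; simp
      · rw [hAB y hy]; ring
    rw [Finset.sum_congr rfl fun y _ => h3 y, Finset.sum_add_distrib, Finset.sum_add_distrib,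
      ← Finset.mul_sum, ← Finset.mul_sum, h2]
    simp; ring
  have hconst : ∀ z ≠ 0, ∀ w ≠ 0, (z ∈ D ↔ w ∈ D) →
      (D.filter fun a => z - a ∈ D).card = (D.filter fun a => w - a ∈ D).card := by
    intro z hz w hw hzw
    have hq : (Fintype.card F : L) ≠ 0 := Nat.cast_ne_zero.2 Fintype.card_ne_zero
    have := (hcount z hz).trans (((by simp only [hzw] : _ = _)).trans (hcount w hw).symm)
    exact_mod_cast mul_left_cancel₀ hq this
  have hcommon : ∀ x y, Fintype.card
      ((SimpleGraph.fromRel (fun x y : F => x - y ∈ D)).commonNeighbors x y) =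
        (D.filter fun a => x - y - a ∈ D).card := by
    intro x y
    rw [← Set.toFinset_card]
    refine Finset.card_bij' (fun w _ => x - w) (fun a _ => x - a) ?_ ?_ ?_ ?_
    · intro w hw
      rw [Set.mem_toFinset, SimpleGraph.mem_commonNeighbors, hadj, hadj] at hw
      rw [Finset.mem_filter]
      refine ⟨hw.1, ?_⟩
      have := hneg _ hw.2
      rwa [show x - y - (x - w) = -(y - w) by ring]
    · intro a ha
      rw [Finset.mem_filter] at ha
      rw [Set.mem_toFinset, SimpleGraph.mem_commonNeighbors, hadj, hadj]
      refine ⟨by simpa using ha.1, ?_⟩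
      have := hneg _ ha.2
      rwa [show y - (x - a) = -(x - y - a) by ring]
    · intro w _; ring
    · intro a _; ring
  have hex : ∀ P : F → Prop, (∀ z w, P z → P w → (D.filter fun a => z - a ∈ D).card =
      (D.filter fun a => w - a ∈ D).card) →
      ∃ l, ∀ z, P z → (D.filter fun a => z - a ∈ D).card = l := by
    intro P hP
    by_cases h : ∃ z, P z
    · obtain ⟨w, hw⟩ := h
      exact ⟨_, fun z hz => hP z w hz hw⟩
    · exact ⟨0, fun z hz => absurd ⟨z, hz⟩ h⟩
  obtain ⟨l, hl⟩ := hex (fun z => z ∈ D) fun z w hz hw =>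
    hconst z (fun h => h0 (h ▸ hz)) w (fun h => h0 (h ▸ hw)) (by simp [hz, hw])
  obtain ⟨u, hu⟩ := hex (fun z => z ≠ 0 ∧ z ∉ D) fun z w hz hw =>
    hconst z hz.1 w hw.1 (by simp [hz.2, hw.2])
  refine ⟨l, u, ⟨rfl, ?_, ?_, ?_⟩⟩
  · intro x
    rw [← SimpleGraph.card_neighborFinset_eq_degree]
    refine Finset.card_bij' (fun w _ => x - w) (fun a _ => x - a) ?_ ?_ ?_ ?_
    · intro w hw
      rwa [SimpleGraph.mem_neighborFinset, hadj] at hw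
    · intro a ha
      rw [SimpleGraph.mem_neighborFinset, hadj]
      simpa using ha
    · intro w _; ring
    · intro a _; ring
  · intro x y hxy
    rw [hcommon]
    exact hl _ ((hadj x y).1 hxy)
  · intro x y hne hxy
    rw [hcommon]
    exact hu _ ⟨sub_ne_zero.2 hne, fun h => hxy ((hadj x y).2 h)⟩

end StronglyRegular

section Values

/-- Two-valuedness of an integral function from its first two moments. -/
lemma eq_or_eq_of_sum_sq {ι : Type*} {s : Finset ι} {f u : ι → ℤ} {n Q : ℤ} (hQ : 0 < Q)
    (hQ1 : 323 ∣ Q * 161 - 1) (hn : 323 * n = 81 * Q ^ 2 - 1) (hs : (s.card : ℤ) = 81 * Q ^ 2 - 1)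
    (hu : ∀ i ∈ s, 323 * f i + 1 = Q * u i) (h1 : ∑ i ∈ s, f i = -n)
    (h2 : ∑ i ∈ s, f i ^ 2 = 81 * Q ^ 2 * n - n ^ 2) :
    ∀ i ∈ s, u i = 161 ∨ u i = -162 := by
  have hv : ∀ i ∈ s, ∃ v, u i = 161 - 323 * v := by
    intro i hi
    have : (323 : ℤ) ∣ 161 - u i := by
      obtain ⟨k, hk⟩ := hQ1
      refine ⟨k * u i - 161 * f i, ?_⟩
      linear_combination 161 * hu i hi + u i * hk
    obtain ⟨v, hv⟩ := this
    exact ⟨v, by linear_combination -hv⟩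
  have hsum1 : ∑ i ∈ s, u i = 0 := by
    refine (mul_eq_zero.1 ?_).resolve_left hQ.ne'
    rw [Finset.mul_sum, ← Finset.sum_congr rfl hu, Finset.sum_add_distrib, ← Finset.mul_sum, h1]
    simp [hs]
    linear_combination -hn
  have hsum2 : ∑ i ∈ s, u i ^ 2 = 161 * 162 * (81 * Q ^ 2 - 1) := by
    have h3 : ∑ i ∈ s, (Q * u i) ^ 2 = ∑ i ∈ s, (323 ^ 2 * f i ^ 2 + 2 * 323 * f i + 1) :=
      Finset.sum_congr rfl fun i hi => by rw [← hu i hi]; ring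
    simp_rw [mul_pow] at h3
    rw [Finset.sum_add_distrib, Finset.sum_add_distrib, ← Finset.mul_sum, ← Finset.mul_sum,
      ← Finset.mul_sum, h1, h2] at h3
    simp only [Finset.sum_const, nsmul_eq_mul, hs, mul_one] at h3
    refine mul_left_cancel₀ (pow_ne_zero 2 hQ.ne') ?_
    rw [h3]
    linear_combination (323 * 81 * Q ^ 2 - 323 * n - 81 * Q ^ 2 + 1 - 2) * hn
  have hnonneg : ∀ i ∈ s, 0 ≤ (u i - 161) * (u i + 162) := by
    intro i hi
    obtain ⟨v, hv⟩ := hv i hi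
    rw [hv]
    rcases le_or_gt v 0 with h | h <;> nlinarith
  have hzero : ∑ i ∈ s, (u i - 161) * (u i + 162) = 0 := by
    have : ∀ i, (u i - 161) * (u i + 162) = u i ^ 2 + u i - 161 * 162 := fun i => by ring
    simp_rw [this]
    rw [Finset.sum_sub_distrib, Finset.sum_add_distrib, hsum1, hsum2]
    simp [hs]
    ring
  intro i hi
  rcases mul_eq_zero.1 ((Finset.sum_eq_zero_iff_of_nonneg hnonneg).1 hzero i hi) with h | h
  · left; linear_combination h
  · right; linear_combination h

/-- A symmetric sum of values of an additive character of order 3 is an integer. -/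
lemma exists_int_eq_sum_addChar {F : Type*} [Field F] {L : Type*} [Field L] [CharZero L]
    {ψ : AddChar F L} (hψ : ∀ x, ψ x ^ 3 = 1) (D : Finset F) (hneg : ∀ x ∈ D, -x ∈ D) (y : F) :
    ∃ a : ℤ, ∑ x ∈ D, ψ (y * x) = a := by
  have hisInt : IsIntegral ℤ (∑ x ∈ D, ψ (y * x)) := IsIntegral.sum _ fun x _ =>
    IsIntegral.of_pow (n := 3) (by norm_num) (by rw [hψ]; exact isIntegral_one)
  have hpair : ∀ x, ψ (y * x) + ψ (y * -x) = ((if ψ (y * x) = 1 then 2 else -1 : ℤ) : L) := by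
    intro x
    have h1 : ψ (y * x) * ψ (y * -x) = 1 := by rw [← AddChar.map_add_eq_mul]; simp
    split_ifs with h
    · rw [h, one_mul] at h1
      rw [h, h1]; norm_num
    · have h2 : ψ (y * x) + ψ (y * -x) + 1 = 0 := by
        refine mul_left_cancel₀ (sub_ne_zero.2 h) ?_
        linear_combination hψ (y * x) * ψ (y * -x) + (1 - ψ (y * x) ^ 2) * h1
      push_cast
      linear_combination h2
  have htwo : 2 * ∑ x ∈ D, ψ (y * x) = ((∑ x ∈ D, if ψ (y * x) = 1 then 2 else -1 : ℤ) : L) := by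
    have h1 : ∑ x ∈ D, ψ (y * -x) = ∑ x ∈ D, ψ (y * x) :=
      Finset.sum_bij' (fun x _ => -x) (fun x _ => -x) hneg hneg (by simp) (by simp) (by simp)
    rw [two_mul]
    nth_rw 2 [← h1]
    rw [← Finset.sum_add_distrib, Finset.sum_congr rfl fun x _ => hpair x]
    push_cast; rfl
  set b : ℤ := ∑ x ∈ D, if ψ (y * x) = 1 then 2 else -1
  have hrat : ∑ x ∈ D, ψ (y * x) = algebraMap ℚ L (b / 2) := by
    rw [map_div₀, map_intCast, ← htwo, map_ofNat, mul_div_cancel_left₀ _ two_ne_zero]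
  rw [hrat, isIntegral_algebraMap_iff (algebraMap ℚ L).injective,
    IsIntegrallyClosed.isIntegral_iff] at hisInt
  obtain ⟨a, ha⟩ := hisInt
  refine ⟨a, ?_⟩
  rw [hrat, ← ha]
  simp

end Values

namespace StickelbergerSetting

variable {F : Type} [Field F] [Fintype F] {L : Type} [Field L] (S : StickelbergerSetting F L)
  {γ : Fˣ} {n M : ℕ}

lemma isPrimitiveRoot (hγ : orderOf γ = Fintype.card F - 1) :
    IsPrimitiveRoot (S.τ γ) (Fintype.card F - 1) := by
  rw [← hγ]
  refine ⟨?_, fun k hk => ?_⟩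
  · rw [← map_pow, ← Units.val_pow_eq_pow_val, pow_orderOf_eq_one]; simp
  · rw [← map_pow, ← Units.val_pow_eq_pow_val] at hk
    exact orderOf_dvd_of_pow_eq_one (Units.ext (S.τ_injective _ hk))

lemma isPrimitiveRoot_pow (hγ : orderOf γ = Fintype.card F - 1) {N : ℕ}
    (hM : N * M + 1 = Fintype.card F) : IsPrimitiveRoot ((S.τ ^ M) γ) N := by
  rw [MulChar.pow_apply_coe]
  exact (S.isPrimitiveRoot hγ).pow (Nat.sub_pos_of_lt Fintype.one_lt_card)
    (by rw [← hM, Nat.add_sub_cancel, mul_comm])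

lemma pow_mul_ne_one (hγ : orderOf γ = Fintype.card F - 1) {N c : ℕ}
    (hM : N * M + 1 = Fintype.card F) (hc0 : c ≠ 0) (hc : c < N) : S.τ ^ (M * c) ≠ 1 := by
  intro h
  have h1 : (S.τ ^ M) γ ^ c = 1 := by
    rw [← MulChar.pow_apply_coe, ← pow_mul, h, MulChar.one_apply_coe]
  exact (S.isPrimitiveRoot_pow hγ hM).pow_ne_one_of_pos_of_lt hc0 hc h1

lemma pow_pow_eq_one {N : ℕ} (hM : N * M + 1 = Fintype.card F) : (S.τ ^ M) ^ N = 1 := by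
  rw [← pow_mul, mul_comm, show N * M = Fintype.card Fˣ by rw [Fintype.card_units]; omega]
  exact MulChar.pow_card_eq_one _

/-- The union of cyclotomic cosets, as a union of fibres of a multiplicative character. -/
def cosetUnion (γ : Fˣ) (M n k : ℕ) : Finset F :=
  Finset.univ.filter fun x => ∃ i < 17 ^ n, (S.τ ^ M) x = (S.τ ^ M) γ ^ (19 * i + k * 17 ^ n)

lemma pow_injOn (hγ : orderOf γ = Fintype.card F - 1)
    (hM : 323 * 17 ^ n * M + 1 = Fintype.card F) (k : ℕ) :
    ∀ i < 17 ^ n, ∀ j < 17 ^ n, (S.τ ^ M) γ ^ (19 * i + k * 17 ^ n) =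
      (S.τ ^ M) γ ^ (19 * j + k * 17 ^ n) → i = j := by
  intro i hi j hj h
  have hζ := S.isPrimitiveRoot_pow hγ hM
  rw [pow_add, pow_add] at h
  have := hζ.pow_inj (by omega) (by omega)
    (mul_right_cancel₀ (pow_ne_zero _ (hζ.ne_zero (by positivity))) h)
  omega

lemma card_cosetUnion [CharZero L] (hγ : orderOf γ = Fintype.card F - 1)
    (hM : 323 * 17 ^ n * M + 1 = Fintype.card F) (k : ℕ) :
    323 * (S.cosetUnion γ M n k).card + 1 = Fintype.card F := by
  have h := natCast_mul_sum_filter_eq (S.pow_pow_eq_one hM) (S.isPrimitiveRoot_pow hγ hM)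
    (S.pow_injOn hγ hM k) (fun _ => 1)
  rw [Finset.sum_eq_single_of_mem 0 (Finset.mem_range.2 (by positivity))] at h
  · simp only [zero_mul, pow_zero, inv_one, mul_one, MulChar.sum_one_eq_card_units,
      Finset.sum_const, Finset.card_range, nsmul_eq_mul, Fintype.card_units] at h
    have h' : 17 ^ n * (323 * (S.cosetUnion γ M n k).card) = 17 ^ n * (Fintype.card F - 1) := by
      rw [← mul_assoc, mul_comm (17 ^ n) 323]
      exact_mod_cast h
    have := Nat.eq_of_mul_eq_mul_left (by positivity) h'
    have := Fintype.card_pos (α := F)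
    omega
  · intro c hc hc0
    have h1 : (S.τ ^ M) ^ c ≠ 1 := by
      rw [← pow_mul]; exact S.pow_mul_ne_one hγ hM hc0 (Finset.mem_range.1 hc)
    simp only [mul_one, MulChar.sum_eq_zero_of_ne_one (inv_ne_one.2 h1), mul_zero]

lemma zero_notMem_cosetUnion (hγ : orderOf γ = Fintype.card F - 1)
    (hM : 323 * 17 ^ n * M + 1 = Fintype.card F) (k : ℕ) : 0 ∉ S.cosetUnion γ M n k := by
  intro h
  obtain ⟨i, -, h⟩ := (Finset.mem_filter.1 h).2
  rw [MulChar.map_zero] at h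
  exact pow_ne_zero _ ((S.isPrimitiveRoot_pow hγ hM).ne_zero (by positivity)) h.symm

lemma neg_mem_cosetUnion (hM : 323 * 17 ^ n * M + 1 = Fintype.card F) (k : ℕ) :
    ∀ x ∈ S.cosetUnion γ M n k, -x ∈ S.cosetUnion γ M n k := by
  intro x hx
  have h1 : (S.τ ^ M) (-1) ^ 2 = 1 := by rw [← map_pow]; simp
  have h2 : (S.τ ^ M) (-1) = 1 := by
    obtain ⟨j, hj⟩ : Odd (323 * 17 ^ n) := by
      rw [Nat.odd_mul]
      exact ⟨by decide, Odd.pow (by decide)⟩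
    have h3 : (S.τ ^ M) (-1) ^ (323 * 17 ^ n) = 1 := by
      rw [← MulChar.pow_apply' _ (by positivity), S.pow_pow_eq_one hM,
        MulChar.one_apply isUnit_one.neg]
    rwa [hj, pow_succ, pow_mul, h1, one_pow, one_mul] at h3
  unfold cosetUnion at hx ⊢
  rw [Finset.mem_filter] at hx ⊢
  rw [← neg_one_mul x, map_mul, h2, one_mul]
  exact ⟨Finset.mem_univ _, hx.2⟩

lemma mem_cosetUnion_iff (hγ : orderOf γ = Fintype.card F - 1)
    (hM : 323 * 17 ^ n * M + 1 = Fintype.card F) (k : ℕ) (x : F) :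
    x ∈ S.cosetUnion γ M n k ↔
      ∃ i < 17 ^ n, ∃ t : ℕ, x = (γ : F) ^ (19 * i + k * 17 ^ n + 323 * 17 ^ n * t) := by
  have hζ := S.isPrimitiveRoot_pow hγ hM
  constructor
  · intro hx
    have hx0 : x ≠ 0 := fun h => S.zero_notMem_cosetUnion hγ hM k (h ▸ hx)
    obtain ⟨i, hi, h⟩ := (Finset.mem_filter.1 hx).2
    refine ⟨i, hi, ?_⟩
    obtain ⟨s, hs⟩ : ∃ s : ℕ, γ ^ s = Units.mk0 x hx0 := by
      refine mem_powers_iff_mem_zpowers.2 ?_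
      rw [(Subgroup.eq_top_of_card_eq (Subgroup.zpowers γ) ?_)]
      · exact Subgroup.mem_top _
      · rw [Nat.card_zpowers, hγ, Nat.card_eq_fintype_card, Fintype.card_units]
    have hxs : x = (γ : F) ^ s := by
      rw [← Units.val_pow_eq_pow_val, hs, Units.val_mk0]
    set a := 19 * i + k * 17 ^ n with ha
    rw [hxs, map_pow, (hζ.isOfFinOrder (by positivity)).pow_inj_mod, ← hζ.eq_orderOf] at h
    change s ≡ a [MOD 323 * 17 ^ n] at h
    have h1 : a ≡ s + 323 * 17 ^ n * (M * a) [MOD 323 * 17 ^ n] := by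
      refine h.symm.trans ?_
      simp [Nat.ModEq]
    have hMpos : 0 < 323 * 17 ^ n * M := by
      have := Fintype.one_lt_card (α := F); omega
    have h2 : a ≤ s + 323 * 17 ^ n * (M * a) := by
      rw [← mul_assoc]
      exact (Nat.le_mul_of_pos_left a hMpos).trans (Nat.le_add_left _ _)
    obtain ⟨t, ht⟩ := (Nat.modEq_iff_dvd' h2).1 h1
    refine ⟨t, ?_⟩
    have h3 : a + 323 * 17 ^ n * t = s + 323 * 17 ^ n * M * a := by
      rw [mul_assoc (323 * 17 ^ n) M a]; omega
    rw [h3, pow_add, pow_mul, show 323 * 17 ^ n * M = orderOf γ by omega,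
      ← Units.val_pow_eq_pow_val _ (orderOf γ), pow_orderOf_eq_one, Units.val_one, one_pow, mul_one,
      hxs]
  · rintro ⟨i, hi, t, rfl⟩
    refine Finset.mem_filter.2 ⟨Finset.mem_univ _, i, hi, ?_⟩
    rw [map_pow, pow_add, pow_mul, hζ.pow_eq_one, one_pow, mul_one]

lemma natCast_mul_sum_cosetUnion_eq [CharP F 3] [CharZero L]
    (hγ : orderOf γ = Fintype.card F - 1) (hF : Fintype.card F = 3 ^ (144 * 17 ^ n))
    (hM : 323 * 17 ^ n * M + 1 = Fintype.card F) (k : ℕ) {y : F} (hy : y ≠ 0) :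
    ∃ x ∈ S.O, 17 ^ n * (323 * ∑ x ∈ S.cosetUnion γ M n k, S.ψ (y * x) + 1) =
      3 ^ (72 * 17 ^ n - 2) * x := by
  have hζ := S.isPrimitiveRoot_pow hγ hM
  have h := natCast_mul_sum_filter_eq (S.pow_pow_eq_one hM) (S.isPrimitiveRoot_pow hγ hM)
    (S.pow_injOn hγ hM k) (fun x => S.ψ (y * x))
  obtain ⟨N, hN⟩ : ∃ N, 323 * 17 ^ n = N + 1 := ⟨323 * 17 ^ n - 1, by
    have : 0 < 17 ^ n := by positivity
    omega⟩
  have hterm : ∀ c ∈ Finset.range N, ∃ x ∈ S.O,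
      (∑ i ∈ Finset.range (17 ^ n), (S.τ ^ M) γ ^ ((c + 1) * (19 * i + k * 17 ^ n))) *
        ∑ x, ((S.τ ^ M) ^ (c + 1))⁻¹ x * S.ψ (y * x) = 3 ^ (72 * 17 ^ n - 2) * x := by
    intro c hc
    have hcN : c + 1 < 323 * 17 ^ n := by rw [hN]; have := Finset.mem_range.1 hc; omega
    by_cases hc17 : 17 ∣ c + 1 ∧ ¬ 17 ^ (n + 1) ∣ c + 1
    · refine ⟨0, zero_mem _, ?_⟩
      obtain ⟨⟨d, hd⟩, hc17⟩ := hc17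
      have hz : (S.τ ^ M) γ ^ (19 * (c + 1)) ≠ 1 := by
        rw [Ne, hζ.pow_eq_one_iff_dvd, show 323 * 17 ^ n = 19 * 17 ^ (n + 1) by ring,
          Nat.mul_dvd_mul_iff_left (by norm_num)]
        exact hc17
      have hze : ((S.τ ^ M) γ ^ (19 * (c + 1))) ^ 17 ^ n = 1 := by
        rw [hd, ← pow_mul, show 19 * (17 * d) * 17 ^ n = 323 * 17 ^ n * d by ring, pow_mul,
          hζ.pow_eq_one, one_pow]
      have hsum : ∑ i ∈ Finset.range (17 ^ n), ((S.τ ^ M) γ ^ (19 * (c + 1))) ^ i = 0 := by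
        refine mul_right_cancel₀ (sub_ne_zero.2 hz) ?_
        rw [geom_sum_mul, hze, sub_self, zero_mul]
      have hsum' : ∑ i ∈ Finset.range (17 ^ n),
          (S.τ ^ M) γ ^ ((c + 1) * (19 * i + k * 17 ^ n)) = 0 := by
        have : ∀ i, (S.τ ^ M) γ ^ ((c + 1) * (19 * i + k * 17 ^ n)) =
            ((S.τ ^ M) γ ^ (19 * (c + 1))) ^ i * (S.τ ^ M) γ ^ ((c + 1) * (k * 17 ^ n)) := by
          intro i; rw [← pow_mul, ← pow_add]; congr 1; ring
        simp_rw [this]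
        rw [← Finset.sum_mul, hsum, zero_mul]
      rw [hsum', zero_mul, mul_zero]
    · obtain ⟨x, hx, hxg⟩ := S.gaussSum_inv_eq hF hM hcN (by tauto)
        (S.pow_mul_ne_one hγ hM (Nat.succ_ne_zero c) hcN)
      have hshift := gaussSum_mulShift ((S.τ ^ M) ^ (c + 1))⁻¹ S.ψ (Units.mk0 y hy)
      have hmul : ((S.τ ^ M) ^ (c + 1)) y * ((S.τ ^ M) ^ (c + 1))⁻¹ y = 1 := by
        rw [← MulChar.mul_apply, mul_inv_cancel, MulChar.one_apply (isUnit_iff_ne_zero.2 hy)]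
      refine ⟨(∑ i ∈ Finset.range (17 ^ n), (S.τ ^ M) γ ^ ((c + 1) * (19 * i + k * 17 ^ n))) *
        (((S.τ ^ M) ^ (c + 1)) y * x), mul_mem (sum_mem fun i _ => pow_mem (S.mulChar_mem _ _) _)
        (mul_mem (S.mulChar_mem _ _) hx), ?_⟩
      rw [pow_mul] at hxg
      rw [hxg] at hshift
      change ((S.τ ^ M) ^ (c + 1))⁻¹ y *
        ∑ x, ((S.τ ^ M) ^ (c + 1))⁻¹ x * S.ψ (y * x) = _ at hshift
      generalize ∑ x, ((S.τ ^ M) ^ (c + 1))⁻¹ x * S.ψ (y * x) = g at hshift ⊢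
      generalize ∑ i ∈ Finset.range (17 ^ n),
        (S.τ ^ M) γ ^ ((c + 1) * (19 * i + k * 17 ^ n)) = w
      linear_combination w * ((S.τ ^ M) ^ (c + 1)) y * hshift - w * g * hmul
  have hzero : ∑ x, (1 : MulChar F L) x * S.ψ (y * x) = -1 := by
    have h1 : AddChar.mulShift S.ψ y ≠ 1 := S.ψ_primitive hy
    exact gaussSum_one_left h1
  choose! g hgO hg using hterm
  refine ⟨∑ c ∈ Finset.range N, g c, sum_mem hgO, ?_⟩
  rw [hN, Finset.sum_range_succ', Finset.sum_congr rfl hg, ← Finset.mul_sum, pow_zero, inv_one,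
    hzero, ← hN] at h
  simp only [zero_mul, pow_zero, Finset.sum_const, Finset.card_range, nsmul_eq_mul] at h
  push_cast at h
  unfold cosetUnion
  linear_combination h

end StickelbergerSetting

/-- The unions of cyclotomic cosets have two nontrivial character values. -/
lemma StickelbergerSetting.exists_sum_cosetUnion_sq_eq {F : Type} [Field F] [Fintype F] {L : Type}
    [Field L] (S : StickelbergerSetting F L) {γ : Fˣ} {n M : ℕ} [CharP F 3] [CharZero L]
    (hγ : orderOf γ = Fintype.card F - 1) (hF : Fintype.card F = 3 ^ (144 * 17 ^ n))
    (hM : 323 * 17 ^ n * M + 1 = Fintype.card F) (k : ℕ) :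
    ∃ A B : L, ∀ y ≠ 0, (∑ x ∈ S.cosetUnion γ M n k, S.ψ (y * x)) ^ 2 =
      A * ∑ x ∈ S.cosetUnion γ M n k, S.ψ (y * x) + B := by
  set D := S.cosetUnion γ M n k with hD
  have hcard := S.card_cosetUnion hγ hM k
  have h0 := S.zero_notMem_cosetUnion hγ hM k
  have hneg := S.neg_mem_cosetUnion (γ := γ) hM k
  rw [← hD] at hcard h0 hneg
  choose f hf using exists_int_eq_sum_addChar S.ψ_pow D hneg
  obtain ⟨j, hj⟩ : Odd (17 ^ n) := Odd.pow (by decide)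
  set t := 72 * 17 ^ n - 2 with ht
  set Q : ℤ := 3 ^ t with hQ
  have hqQ : (Fintype.card F : ℤ) = 81 * Q ^ 2 := by
    rw [hF, hQ, ← pow_mul, show 144 * 17 ^ n = 4 + t * 2 by omega, pow_add]
    norm_num
  have hQ1 : 323 ∣ Q * 161 - 1 := by
    rw [hQ, show t = 144 * j + 70 by omega, pow_add, pow_mul]
    refine (Int.modEq_iff_dvd).1 ?_
    have h1 : (3 : ℤ) ^ 144 ≡ 1 [ZMOD 323] := by decide +kernel
    have h2 : (3 : ℤ) ^ 70 * 161 ≡ 1 [ZMOD 323] := by decide +kernel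
    rw [mul_assoc]
    simpa using ((h1.pow j).mul h2).symm
  have hcop : IsCoprime Q (17 ^ n) := by
    refine IsCoprime.pow ?_
    rw [Int.isCoprime_iff_gcd_eq_one]; rfl
  have hu : ∀ y, ∃ u : ℤ, y ≠ 0 → 323 * f y + 1 = Q * u := by
    intro y
    by_cases hy : y = 0
    · exact ⟨0, fun h => absurd hy h⟩
    obtain ⟨x, hx, h⟩ := S.natCast_mul_sum_cosetUnion_eq hγ hF hM k hy
    rw [← hD, hf y] at h
    obtain ⟨u, hu⟩ := hcop.dvd_of_dvd_mul_left
      (S.three_pow_dvd_of_eq t (17 ^ n * (323 * f y + 1)) hx (by exact_mod_cast h))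
    exact ⟨u, fun _ => hu⟩
  choose u hu using hu
  have hf0 : f 0 = D.card := by
    have h := hf 0
    simp only [zero_mul, AddChar.map_zero_eq_one, Finset.sum_const, nsmul_eq_mul, mul_one] at h
    exact_mod_cast h.symm
  have hsum1 : ∑ y, f y = 0 := by
    have h := sum_mul_sum_addChar_eq S.ψ_primitive D 0
    simp only [mul_zero, neg_zero, AddChar.map_zero_eq_one, mul_one, if_neg h0, hf] at h
    exact_mod_cast h
  have hsum2 : ∑ y, f y ^ 2 = Fintype.card F * D.card := by
    have h := sum_sq_sum_addChar_eq S.ψ_primitive D 0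
    rw [Finset.filter_true_of_mem (by simpa using hneg)] at h
    simp only [mul_zero, neg_zero, AddChar.map_zero_eq_one, mul_one, hf] at h
    exact_mod_cast h
  rw [← Finset.add_sum_erase _ _ (Finset.mem_univ 0), hf0] at hsum1 hsum2
  have hval := eq_or_eq_of_sum_sq (s := Finset.univ.erase 0) (f := f) (u := u) (n := D.card)
    (Q := Q) (by positivity) hQ1 (by rw [← hqQ, ← hcard]; push_cast; ring)
    (by
      rw [← hqQ, Finset.card_erase_of_mem (Finset.mem_univ 0), Finset.card_univ,
        Nat.cast_sub Fintype.card_pos]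
      rfl)
    (fun y hy => hu y (Finset.ne_of_mem_erase hy)) (by linear_combination hsum1)
    (by rw [← hqQ]; linear_combination hsum2)
  refine ⟨-(646 + 323 * Q) / 323 ^ 2, (161 * 162 * Q ^ 2 - Q - 1) / 323 ^ 2, fun y hy => ?_⟩
  have hX : (323 * (f y : L) + 1 - 161 * Q) * (323 * f y + 1 + 162 * Q) = 0 := by
    have h1 := hu y hy
    have : (323 * f y + 1 - 161 * Q) * (323 * f y + 1 + 162 * Q) = 0 := by
      rcases hval y (Finset.mem_erase.2 ⟨hy, Finset.mem_univ y⟩) with h | h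
      · rw [h1, h]; ring
      · rw [h1, h]; ring
    exact_mod_cast this
  rw [hf y]
  field_simp
  linear_combination hX

lemma charP_three_of_card {F : Type*} [Field F] [Fintype F] {r : ℕ}
    (hF : Fintype.card F = 3 ^ r) : CharP F 3 := by
  obtain ⟨p, hp⟩ := CharP.exists F
  obtain ⟨s, hprime, hs⟩ := FiniteField.card F p
  have h1 : p ∣ 3 ^ r := by rw [← hF, hs]; exact dvd_pow_self p s.ne_zero
  rwa [← (Nat.prime_dvd_prime_iff_eq hprime Nat.prime_three).1 (hprime.dvd_of_dvd_pow h1)]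

lemma mul_dvd_three_pow_sub_one (n : ℕ) : 323 * 17 ^ n ∣ 3 ^ (144 * 17 ^ n) - 1 := by
  have hphi : Nat.totient (17 ^ (n + 1)) = 17 ^ n * 16 := by
    rw [Nat.totient_prime_pow_succ (by norm_num)]
  have h1 : 17 ^ (n + 1) ∣ 3 ^ (144 * 17 ^ n) - 1 := by
    refine (Nat.modEq_iff_dvd' (Nat.one_le_pow _ _ (by norm_num))).1 ?_
    rw [show 144 * 17 ^ n = Nat.totient (17 ^ (n + 1)) * 9 by rw [hphi]; ring, pow_mul]
    have := (Nat.ModEq.pow_totient (x := 3) (n := 17 ^ (n + 1))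
      (Nat.Coprime.pow_right _ (by norm_num))).pow 9
    rw [one_pow] at this
    exact this.symm
  have h2 : 19 ∣ 3 ^ (144 * 17 ^ n) - 1 := by
    refine (Nat.modEq_iff_dvd' (Nat.one_le_pow _ _ (by norm_num))).1 ?_
    have := (show 3 ^ 144 ≡ 1 [MOD 19] by decide +kernel).pow (17 ^ n)
    rw [one_pow, ← pow_mul] at this
    exact this.symm
  rw [show 323 * 17 ^ n = 19 * 17 ^ (n + 1) by ring]
  exact Nat.Coprime.mul_dvd_of_dvd_of_dvd (Nat.Coprime.pow_right _ (by norm_num)) h2 h1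

/-- Each `Cay(F_q, D_k)` is a strongly regular graph of degree `(q-1)/323`,
where `q = 3^{144*17^(m-1)}`, `N = 17^m*19`. -/
theorem cayley_srg_example_12
    (m N q : ℕ) (hm : 1 ≤ m)
    (hN : N = 17 ^ m * 19) (hq : q = 3 ^ (144 * 17 ^ (m - 1)))
    (F : Type) [Field F] [Fintype F] (hF : Fintype.card F = q)
    (γ : Fˣ) (hγ : orderOf γ = q - 1)
    (D : ℕ → Set F)
    (hD : ∀ k, D k = {x : F | ∃ i < 17 ^ (m - 1), ∃ t : ℕ,
        x = ((γ : F)) ^ (19 * i + k * 17 ^ (m - 1) + N * t)}) :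
    ∀ k ≤ 322,
      SimpleGraph.fromRel (fun x y : F => x - y ∈ D k) ≠ ⊤ ∧
      SimpleGraph.fromRel (fun x y : F => x - y ∈ D k) ≠ ⊥ ∧
      ∃ l u : ℕ, (SimpleGraph.fromRel (fun x y : F => x - y ∈ D k)).IsSRGWith
        q ((q - 1) / 323) l u := by
  intro k _
  obtain ⟨n, rfl⟩ := Nat.exists_eq_add_of_le' hm
  rw [Nat.add_sub_cancel] at hq hD
  replace hN : N = 323 * 17 ^ n := by rw [hN]; ring
  subst hN
  subst hF
  have := charP_three_of_card hq
  have hlarge : 3 < Fintype.card F := by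
    have : 0 < 17 ^ n := by positivity
    rw [hq]
    exact lt_self_pow₀ (by norm_num) (by omega)
  obtain ⟨M, hM⟩ := mul_dvd_three_pow_sub_one n
  replace hM : 323 * 17 ^ n * M + 1 = Fintype.card F := by omega
  obtain ⟨L, _, _, ⟨S⟩⟩ := exists_stickelbergerSetting (F := F) hlarge
  have hcard := S.card_cosetUnion hγ hM k
  have h0 := S.zero_notMem_cosetUnion hγ hM k
  have hneg := S.neg_mem_cosetUnion (γ := γ) hM k
  have hmem : ∀ x, x ∈ D k ↔ x ∈ S.cosetUnion γ M n k := fun x => by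
    rw [S.mem_cosetUnion_iff hγ hM, hD]; rfl
  obtain ⟨A, B, hAB⟩ := S.exists_sum_cosetUnion_sq_eq hγ hq hM k
  obtain ⟨l, u, hsrg⟩ := exists_isSRGWith S.ψ_primitive (S.cosetUnion γ M n k) h0 hneg hAB
  simp only [hmem]
  have hdeg : (S.cosetUnion γ M n k).card = (Fintype.card F - 1) / 323 := by omega
  refine ⟨fun htop => ?_, fun hbot => ?_, l, u, ?_⟩
  · have h1 : Finset.univ.erase 0 ⊆ S.cosetUnion γ M n k := by
      intro x hx
      have hadj : (SimpleGraph.fromRel fun x y : F => x - y ∈ S.cosetUnion γ M n k).Adj x 0 := by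
        rw [htop]; exact Finset.ne_of_mem_erase hx
      rcases hadj.2 with h | h
      · simpa using h
      · simpa using hneg _ h
    have h2 := Finset.card_le_card h1
    rw [Finset.card_erase_of_mem (Finset.mem_univ 0), Finset.card_univ] at h2
    omega
  · obtain ⟨x, hx⟩ : (S.cosetUnion γ M n k).Nonempty := Finset.card_pos.1 (by omega)
    have hadj : (SimpleGraph.fromRel fun x y : F => x - y ∈ S.cosetUnion γ M n k).Adj x 0 :=
      ⟨fun h => h0 (h ▸ hx), Or.inl (by simpa using hx)⟩
    rw [hbot] at hadj
    exact hadj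
  · rw [← hdeg]
    convert hsrg
end
end

section
/- Let m ≥ 1, p = 3, p1 = 19, p2 = 17, N = 19^m·17, and q = 3^{144·19^{m−1}}. Then for every k with 0 ≤ k ≤ 322, the Cayley graph Cay(F_q, D_k) is a strongly regular graph of degree (q−1)/323, where D_k = ∪_{i=0}^{19^{m−1}−1} C_{17i + k·19^{m−1}}. -/
open scoped Classical

noncomputable section

lemma sum_range_mul_three {A : Type*} [AddCommMonoid A] (L : ℕ) (hL : 0 < L)
    (hL3 : Nat.Coprime 3 L) (h : ℕ → A) (hh : ∀ n, h (n + L) = h n) :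
    ∑ n ∈ Finset.range L, h (3 * n) = ∑ n ∈ Finset.range L, h n := by
  have hp : ∀ n, h (n % L) = h n := fun n => Function.Periodic.map_mod_nat hh n
  have hinj : Set.InjOn (fun n => 3 * n % L) (Finset.range L : Set ℕ) := by
    intro a ha b hb hab
    have : a ≡ b [MOD L] := Nat.ModEq.cancel_left_of_coprime (c := 3) hL3.symm hab
    simp only [Finset.coe_range, Set.mem_Iio] at ha hb
    exact Nat.ModEq.eq_of_lt_of_lt this ha hb
  have himg : (Finset.range L).image (fun n => 3 * n % L) = Finset.range L := by
    apply Finset.eq_of_subset_of_card_le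
    · intro x hx
      obtain ⟨y, -, rfl⟩ := Finset.mem_image.1 hx
      exact Finset.mem_range.2 (Nat.mod_lt _ hL)
    · rw [Finset.card_image_of_injOn hinj]
  conv_rhs => rw [← himg, Finset.sum_image hinj]
  simp only [hp]

/-- A representative of the orbit of `c` under multiplication by `3` modulo `323`. -/
def orbitRep (c : ℕ) : ℕ :=
  if c % 17 = 0 then (if c % 19 = 0 then 0 else 17)
  else if c % 19 = 0 then 19
  else if (c ^ 8 % 17 = 1 ↔ c ^ 9 % 19 = 1) then 1 else 322

set_option maxRecDepth 100000 in
lemma exists_pow_mul_orbitRep :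
    ∀ c < 323, ∃ e < 144, 3 ^ e * orbitRep c % 323 = c := by
  decide +kernel

lemma apply_pow_three_mul {A : Type*} {h : ℕ → A} (h3 : ∀ c, h (3 * c) = h c) (e c : ℕ) :
    h (3 ^ e * c) = h c := by
  induction e with
  | zero => simp
  | succ e ih => rw [pow_succ', mul_assoc, h3, ih]

lemma apply_eq_apply_orbitRep {A : Type*} {h : ℕ → A} (hper : ∀ c, h (c + 323) = h c)
    (h3 : ∀ c, h (3 * c) = h c) (c : ℕ) : h c = h (orbitRep (c % 323)) := by
  have hp : ∀ n, h (n % 323) = h n := fun n => Function.Periodic.map_mod_nat hper n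
  obtain ⟨e, -, he⟩ := exists_pow_mul_orbitRep (c % 323) (Nat.mod_lt _ (by norm_num))
  rw [← hp c]
  conv_lhs => rw [← he]
  rw [hp, apply_pow_three_mul h3]

set_option maxRecDepth 100000 in
lemma sum_range_eq_of_orbit (h : ℕ → ℤ) (hper : ∀ c, h (c + 323) = h c)
    (h3 : ∀ c, h (3 * c) = h c) :
    ∑ c ∈ Finset.range 323, h c = h 0 + 18 * h 17 + 16 * h 19 + 144 * h 1 + 144 * h 322 := by
  have h1 : ∑ c ∈ Finset.range 323, h c = ∑ c ∈ Finset.range 323, h (orbitRep c) :=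
    Finset.sum_congr rfl fun c hc => by
      conv_lhs => rw [apply_eq_apply_orbitRep hper h3 c, Nat.mod_eq_of_lt (Finset.mem_range.1 hc)]
  have himg : (Finset.range 323).image orbitRep = {0, 17, 19, 1, 322} := by decide +kernel
  rw [h1, Finset.sum_comp h orbitRep, himg]
  have c0 : (Finset.filter (fun c => orbitRep c = 0) (Finset.range 323)).card = 1 := by
    decide +kernel
  have c1 : (Finset.filter (fun c => orbitRep c = 17) (Finset.range 323)).card = 18 := by
    decide +kernel
  have c2 : (Finset.filter (fun c => orbitRep c = 19) (Finset.range 323)).card = 16 := by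
    decide +kernel
  have c3 : (Finset.filter (fun c => orbitRep c = 1) (Finset.range 323)).card = 144 := by
    decide +kernel
  have c4 : (Finset.filter (fun c => orbitRep c = 322) (Finset.range 323)).card = 144 := by
    decide +kernel
  simp [c0, c1, c2, c3, c4]
  ring

set_option maxRecDepth 100000 in
lemma sum_mod_three_pow_ge :
    ∀ j < 323, ¬ 19 ∣ j → 70 * 323 ≤ ∑ i ∈ Finset.range 144, 3 ^ i * j % 323 := by
  decide +kernel

lemma sum_range_congr_shift_three {h : ℕ → ℤ} (hper : ∀ c, h (c + 323) = h c)
    (h3 : ∀ c, h (3 * c) = h c) {d e : ℕ} (hde : d * e = 323) (hd : Nat.Coprime 3 d) (c : ℕ) :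
    ∑ l ∈ Finset.range d, h (3 * c + e * l) = ∑ l ∈ Finset.range d, h (c + e * l) := by
  have hd0 : 0 < d := Nat.pos_of_ne_zero (by rintro rfl; simp at hde)
  rw [← sum_range_mul_three d hd0 hd (fun l => h (3 * c + e * l))]
  · refine Finset.sum_congr rfl fun l _ => ?_
    rw [← h3 (c + e * l)]
    congr 1
    ring
  · intro n
    rw [← hper (3 * c + e * n)]
    congr 1
    rw [← hde]
    ring

lemma exists_two_values_aux {x y : ℤ} (h : x ^ 2 + 323 * y ^ 2 = 324)
    (h19 : (19 : ℤ) ∣ x - 18) (h17 : (17 : ℤ) ∣ x + 18) : x = -1 ∧ (y = 1 ∨ y = -1) := by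
  have hy : y ^ 2 ≤ 1 := by nlinarith [sq_nonneg x]
  have hy1 : y ≤ 1 := by nlinarith
  have hy2 : -1 ≤ y := by nlinarith
  have hx1 : x ≤ 18 := by nlinarith
  have hx2 : -18 ≤ x := by nlinarith
  interval_cases y <;> interval_cases x <;> omega

lemma three_pow_mod_seventeen {M : ℕ} (hM : Odd M) : (17 : ℤ) ∣ 3 ^ (72 * M) + 1 := by
  have : (17 : ℤ) ∣ (3 ^ 72) ^ M + 1 ^ M :=
    dvd_trans (by norm_num) (Odd.add_dvd_pow_add_pow (3 ^ 72 : ℤ) 1 hM)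
  rwa [one_pow, ← pow_mul] at this

lemma three_pow_mod_nineteen (M : ℕ) : (19 : ℤ) ∣ 3 ^ (72 * M) - 1 := by
  have : (19 : ℤ) ∣ (3 ^ 72) ^ M - 1 ^ M :=
    dvd_trans (by norm_num) (sub_dvd_pow_sub_pow (3 ^ 72 : ℤ) 1 M)
  rwa [one_pow, ← pow_mul] at this

/-- The five values of a function on the orbits of `3` on `ℤ/323` are determined up to two
choices by the conditions coming from Gauss sums. -/
lemma orbit_values {a z A B p n : ℤ} (ha0 : a ≠ 0) (ha17 : (17 : ℤ) ∣ 9 * a + 1)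
    (ha19 : (19 : ℤ) ∣ 9 * a - 1) (h1 : z + 18 * A + 16 * B + 144 * p + 144 * n = -1)
    (hq0 : 323 * (z * z + 18 * (A * A) + 16 * (B * B) + 144 * (p * p) + 144 * (n * n)) =
      323 * (81 * a ^ 2) - (81 * a ^ 2 - 1))
    (hq1 : 323 * ((z + 18 * A) ^ 2 + 16 * (B + 9 * p + 9 * n) ^ 2) =
      323 * (81 * a ^ 2) - 19 * (81 * a ^ 2 - 1))
    (hq2 : 323 * ((z + 16 * B) ^ 2 + 18 * (A + 8 * p + 8 * n) ^ 2) =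
      323 * (81 * a ^ 2) - 17 * (81 * a ^ 2 - 1))
    (dz : a ∣ 19 * z - (z + 18 * A)) (dA : a ∣ 19 * A - (z + 18 * A))
    (dB : a ∣ 19 * B - (B + 9 * p + 9 * n)) (dp : a ∣ 19 * p - (B + 9 * p + 9 * n))
    (dn : a ∣ 19 * n - (B + 9 * p + 9 * n)) :
    ∀ v ∈ [z, A, B, p, n], 323 * v + 1 = 161 * a ∨ 323 * v + 1 = -(162 * a) := by
  have g17 : z + 18 * A - B - 9 * p - 9 * n = 9 * a := by
    have hmul : (z + 18 * A - B - 9 * p - 9 * n - 9 * a) *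
        (z + 18 * A - B - 9 * p - 9 * n + 9 * a) = 0 := by
      have : 304 * ((z + 18 * A - B - 9 * p - 9 * n - 9 * a) *
          (z + 18 * A - B - 9 * p - 9 * n + 9 * a)) = 0 := by
        linear_combination hq1 - 19 * (z + 18 * A + 16 * B + 144 * p + 144 * n - 1) * h1
      simpa using this
    rcases mul_eq_zero.1 hmul with h | h
    · linarith
    · obtain ⟨k, hk⟩ := ha17
      omega
  have g19 : z - A + 16 * B - 8 * p - 8 * n = -(9 * a) := by
    have hmul : (z - A + 16 * B - 8 * p - 8 * n - 9 * a) *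
        (z - A + 16 * B - 8 * p - 8 * n + 9 * a) = 0 := by
      have : 306 * ((z - A + 16 * B - 8 * p - 8 * n - 9 * a) *
          (z - A + 16 * B - 8 * p - 8 * n + 9 * a)) = 0 := by
        linear_combination hq2 - 17 * (z + 18 * A + 16 * B + 144 * p + 144 * n - 1) * h1
      simpa using this
    rcases mul_eq_zero.1 hmul with h | h
    · obtain ⟨k, hk⟩ := ha19
      omega
    · linarith
  have c17 : IsCoprime a 17 := by
    obtain ⟨k, hk⟩ := ha17
    exact ⟨-9, k, by linarith⟩
  have c19 : IsCoprime a 19 := by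
    obtain ⟨k, hk⟩ := ha19
    exact ⟨9, -k, by linarith⟩
  have c323 : IsCoprime a 323 := by
    have := c17.mul_right c19
    norm_num at this
    exact this
  have hx : a ∣ 2 * (z - A - B) + p + n := by
    refine c323.dvd_of_dvd_mul_left ?_
    have : 323 * (2 * (z - A - B) + p + n) = 17 * (2 * (19 * z - (z + 18 * A)) -
        2 * (19 * A - (z + 18 * A)) - 2 * (19 * B - (B + 9 * p + 9 * n)) +
        (19 * p - (B + 9 * p + 9 * n)) + (19 * n - (B + 9 * p + 9 * n))) := by
      ring
    rw [this]
    exact (((((dz.mul_left 2).sub (dA.mul_left 2)).sub (dB.mul_left 2)).add dp).add dn).mul_left _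
  have hy : a ∣ p - n := by
    refine c323.dvd_of_dvd_mul_left ?_
    have : 323 * (p - n) = 17 * ((19 * p - (B + 9 * p + 9 * n)) -
      (19 * n - (B + 9 * p + 9 * n))) := by ring
    rw [this]
    exact (dp.sub dn).mul_left _
  have hnorm : (2 * (z - A - B) + p + n) ^ 2 + 323 * (p - n) ^ 2 = 324 * a ^ 2 := by
    have : 72 * ((2 * (z - A - B) + p + n) ^ 2 + 323 * (p - n) ^ 2) = 72 * (324 * a ^ 2) := by
      linear_combination hq0 - (z + 18 * A + 16 * B + 144 * p + 144 * n - 1) * h1 -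
        16 * (z + 18 * A - B - 9 * p - 9 * n + 9 * a) * g17 -
        18 * (z - A + 16 * B - 8 * p - 8 * n - 9 * a) * g19
    linarith
  obtain ⟨x, hx⟩ := hx
  obtain ⟨y, hy⟩ := hy
  have hxy : x ^ 2 + 323 * y ^ 2 = 324 := by
    have : a ^ 2 * (x ^ 2 + 323 * y ^ 2) = a ^ 2 * 324 := by
      rw [hx, hy] at hnorm
      linear_combination hnorm
    exact mul_left_cancel₀ (pow_ne_zero 2 ha0) this
  have x19 : (19 : ℤ) ∣ x - 18 := by
    refine c19.symm.dvd_of_dvd_mul_left (?_ : (19 : ℤ) ∣ a * (x - 18))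
    exact ⟨-2 * A + p + n, by linear_combination -hx + 2 * g17⟩
  have x17 : (17 : ℤ) ∣ x + 18 := by
    refine c17.symm.dvd_of_dvd_mul_left (?_ : (17 : ℤ) ∣ a * (x + 18))
    exact ⟨-2 * B + p + n, by linear_combination -hx + 2 * g19⟩
  obtain ⟨rfl, hy' | hy'⟩ := exists_two_values_aux hxy x19 x17 <;> subst hy' <;>
    simp only [List.mem_cons, List.not_mem_nil, or_false] <;>
    rintro v (rfl | rfl | rfl | rfl | rfl)
  · right; linarith
  · left; linarith
  · right; linarith
  · left; linarith
  · right; linarith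
  · right; linarith
  · left; linarith
  · right; linarith
  · right; linarith
  · left; linarith

/-- A function on `ℤ/323` invariant under multiplication by `3`, with the autocorrelation and
the divisibility of the Gauss periods, takes only two values. -/
lemma two_values_of_autocorrelation {M : ℕ} (hM : Odd M) {a : ℤ} (ha : 9 * a = 3 ^ (72 * M))
    (U : ℕ → ℤ) (hper : ∀ c, U (c + 323) = U c) (h3 : ∀ c, U (3 * c) = U c)
    (hsum : ∑ c ∈ Finset.range 323, U c = -1)
    (hcorr : ∀ t, 323 * ∑ c ∈ Finset.range 323, U c * U (c + t) =
      (if 323 ∣ t then 323 * (81 * a ^ 2) else 0) - (81 * a ^ 2 - 1))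
    (hdiv : ∀ c, a ∣ 19 * U c - ∑ l ∈ Finset.range 19, U (c + 17 * l)) (c : ℕ) :
    323 * U c + 1 = 161 * a ∨ 323 * U c + 1 = -(162 * a) := by
  have hrep := fun c => apply_eq_apply_orbitRep hper h3 c
  have r0 : ∀ d e, d * e = 323 → Nat.Coprime 3 d →
      323 * ∑ c ∈ Finset.range 323, U c * ∑ l ∈ Finset.range d, U (c + e * l) =
        323 * (81 * a ^ 2) - d * (81 * a ^ 2 - 1) := by
    intro d e hde _
    have hd0 : 0 < d := Nat.pos_of_ne_zero (by rintro rfl; simp at hde)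
    have he0 : 0 < e := Nat.pos_of_ne_zero (by rintro rfl; simp at hde)
    have hswap : 323 * ∑ c ∈ Finset.range 323, U c * ∑ l ∈ Finset.range d, U (c + e * l) =
        ∑ l ∈ Finset.range d, 323 * ∑ c ∈ Finset.range 323, U c * U (c + e * l) := by
      simp_rw [Finset.mul_sum]
      rw [Finset.sum_comm]
    simp_rw [hswap, hcorr, Finset.sum_sub_distrib]
    rw [Finset.sum_eq_single_of_mem 0 (Finset.mem_range.2 hd0)]
    · simp [mul_sub]
    · intro b hb hb0
      rw [if_neg]
      rw [← hde, mul_comm d e, Nat.mul_dvd_mul_iff_left he0]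
      exact Nat.not_dvd_of_pos_of_lt (Nat.pos_of_ne_zero hb0) (Finset.mem_range.1 hb)
  have hP : ∀ d e, d * e = 323 → Nat.Coprime 3 d →
      ∑ c ∈ Finset.range 323, U c * ∑ l ∈ Finset.range d, U (c + e * l) =
      U 0 * (∑ l ∈ Finset.range d, U (0 + e * l)) +
        18 * (U 17 * (∑ l ∈ Finset.range d, U (17 + e * l)))
      + 16 * (U 19 * (∑ l ∈ Finset.range d, U (19 + e * l)))
      + 144 * (U 1 * (∑ l ∈ Finset.range d, U (1 + e * l)))
      + 144 * (U 322 * (∑ l ∈ Finset.range d, U (322 + e * l))) := by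
    intro d e hde hd
    apply sum_range_eq_of_orbit (fun c => U c * ∑ l ∈ Finset.range d, U (c + e * l))
    · intro c
      simp only [hper]
      congr 1
      refine Finset.sum_congr rfl fun l _ => ?_
      rw [← hper (c + e * l)]
      congr 1
      ring
    · intro c
      simp only [h3]
      rw [sum_range_congr_shift_three hper h3 hde hd]
  have q0 := sum_range_eq_of_orbit (fun c => U c * U c) (fun c => by simp only [hper])
    (fun c => by simp only [h3])
  have hq0 := hcorr 0
  simp only [add_zero, dvd_zero, if_true] at hq0
  rw [q0] at hq0
  rw [sum_range_eq_of_orbit U hper h3] at hsum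
  have s17 : ∀ c, ∑ l ∈ Finset.range 19, U (c + 17 * l) =
      ∑ l ∈ Finset.range 19, U (orbitRep ((c + 17 * l) % 323)) :=
    fun c => Finset.sum_congr rfl fun l _ => hrep _
  have s19 : ∀ c, ∑ l ∈ Finset.range 17, U (c + 19 * l) =
      ∑ l ∈ Finset.range 17, U (orbitRep ((c + 19 * l) % 323)) :=
    fun c => Finset.sum_congr rfl fun l _ => hrep _
  have hq1 := r0 19 17 (by norm_num) (by norm_num)
  rw [hP 19 17 (by norm_num) (by norm_num)] at hq1
  have hq2 := r0 17 19 (by norm_num) (by norm_num)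
  rw [hP 17 19 (by norm_num) (by norm_num)] at hq2
  have d0 := hdiv 0
  have d17 := hdiv 17
  have d19 := hdiv 19
  have d1 := hdiv 1
  have d322 := hdiv 322
  simp only [s17] at hq1 d0 d17 d19 d1 d322
  simp only [s19] at hq2
  simp only [Finset.sum_range_succ, Finset.sum_range_zero, orbitRep] at hq1 hq2 d0 d17 d19 d1 d322
  norm_num at hq1 hq2 d0 d17 d19 d1 d322
  have h17 := three_pow_mod_seventeen hM
  have h19 := three_pow_mod_nineteen M
  rw [← ha] at h17 h19
  have ha0 : a ≠ 0 := by
    rintro rfl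
    norm_num at h17
  have key := orbit_values (z := U 0) (A := U 17) (B := U 19) (p := U 1) (n := U 322) ha0 h17 h19
    hsum hq0 (by linear_combination hq1) (by linear_combination hq2)
    (by ring_nf at d0 ⊢; exact d0) (by ring_nf at d17 ⊢; exact d17)
    (by ring_nf at d19 ⊢; exact d19) (by ring_nf at d1 ⊢; exact d1)
    (by ring_nf at d322 ⊢; exact d322)
  apply key
  rw [hrep c, orbitRep]
  split_ifs <;> simp

lemma nineteen_pow_dvd_iff (s k : ℕ) :
    (19 : ℤ) ^ (s + 1) ∣ 3 ^ (144 * k) - 1 ↔ 19 ^ s ∣ k := by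
  have h := Int.emultiplicity_pow_sub_pow (p := 19) (by norm_num) (by decide)
    (x := 3 ^ 144) (y := 1) (by norm_num) (by norm_num) k
  have h1 : emultiplicity ((19 : ℕ) : ℤ) (3 ^ 144 - 1) = (1 : ℕ) :=
    emultiplicity_eq_coe.2 ⟨by norm_num, by norm_num⟩
  rw [h1, one_pow, ← pow_mul] at h
  have h2 : (19 : ℤ) = ((19 : ℕ) : ℤ) := by norm_num
  rw [h2, pow_dvd_iff_le_emultiplicity, pow_dvd_iff_le_emultiplicity, h, add_comm s 1]
  push_cast
  exact ENat.add_le_add_iff_left (by simp)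

lemma sum_range_mul_eq {A : Type*} [AddCommMonoid A] (n m : ℕ) (h : ℕ → A) :
    ∑ i ∈ Finset.range (n * m), h i =
      ∑ k ∈ Finset.range m, ∑ i ∈ Finset.range n, h (n * k + i) := by
  induction m with
  | zero => simp
  | succ m ih => rw [Nat.mul_succ, Finset.sum_range_add, ih, Finset.sum_range_succ]

lemma three_pow_mul_mod (k j : ℕ) : 3 ^ (144 * k) * j % 323 = j % 323 := by
  have h : (3 ^ 144) ^ k ≡ 1 ^ k [MOD 323] := Nat.ModEq.pow k (by decide +kernel)
  rw [one_pow, ← pow_mul] at h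
  have h' := h.mul_right j
  rwa [one_mul] at h'

lemma mod_eq_div_add {M : ℕ} (k j : ℕ) : 3 ^ (144 * k) * j % (323 * M) =
    323 * (3 ^ (144 * k) * j % (323 * M) / 323) + j % 323 := by
  conv_lhs => rw [← Nat.div_add_mod (3 ^ (144 * k) * j % (323 * M)) 323]
  rw [Nat.mod_mul_right_mod, three_pow_mul_mod]

lemma injOn_three_pow_mul {s j : ℕ} (hj : ¬ 19 ∣ j) :
    Set.InjOn (fun k => 3 ^ (144 * k) * j % (323 * 19 ^ s) / 323)
      (Finset.range (19 ^ s) : Set ℕ) := by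
  intro k hk k' hk' hkk
  wlog hle : k' ≤ k generalizing k k'
  · exact (this hk' hk hkk.symm (by omega)).symm
  simp only [Finset.coe_range, Set.mem_Iio] at hk hk' hkk
  have h1 : 3 ^ (144 * k') * j ≡ 3 ^ (144 * k) * j [MOD 323 * 19 ^ s] := by
    rw [Nat.ModEq, mod_eq_div_add, mod_eq_div_add k, hkk]
  have h2 : 3 ^ (144 * k') * j ≡ 3 ^ (144 * k) * j [MOD 19 ^ (s + 1)] :=
    h1.of_dvd ⟨17, by ring⟩
  have hc : Nat.Coprime (19 ^ (s + 1)) j :=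
    Nat.Coprime.pow_left _ ((Nat.Prime.coprime_iff_not_dvd (by norm_num)).2 hj)
  have h3 := (Nat.ModEq.cancel_right_of_coprime hc h2)
  have h4 : 3 ^ (144 * k') * 1 ≡ 3 ^ (144 * k') * 3 ^ (144 * (k - k')) [MOD 19 ^ (s + 1)] := by
    rw [mul_one, ← pow_add, ← mul_add, Nat.add_sub_cancel' hle]
    exact h3
  have h5 := Nat.ModEq.cancel_left_of_coprime
    (Nat.Coprime.pow_left _ (Nat.Coprime.pow_right _ (by norm_num))) h4
  have h6 := (Nat.modEq_iff_dvd.1 h5)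
  push_cast at h6
  rw [nineteen_pow_dvd_iff] at h6
  have := Nat.eq_zero_of_dvd_of_lt h6 (by omega)
  omega

lemma image_three_pow_mul {s j : ℕ} (hj : ¬ 19 ∣ j) :
    (Finset.range (19 ^ s)).image (fun k => 3 ^ (144 * k) * j % (323 * 19 ^ s) / 323) =
      Finset.range (19 ^ s) := by
  apply Finset.eq_of_subset_of_card_le
  · intro x hx
    obtain ⟨y, -, rfl⟩ := Finset.mem_image.1 hx
    exact Finset.mem_range.2 (Nat.div_lt_of_lt_mul (Nat.mod_lt _ (by positivity)))
  · rw [Finset.card_image_of_injOn (injOn_three_pow_mul hj)]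

lemma exists_three_pow_mul_modEq (s : ℕ) {j b : ℕ} (hj : ¬ 19 ∣ j) (hb : b ≡ j [MOD 323]) :
    ∃ k, 3 ^ (144 * k) * j ≡ b [MOD 323 * 19 ^ s] := by
  have h : b % (323 * 19 ^ s) / 323 ∈ Finset.range (19 ^ s) :=
    Finset.mem_range.2 (Nat.div_lt_of_lt_mul (Nat.mod_lt _ (by positivity)))
  rw [← image_three_pow_mul hj] at h
  obtain ⟨k, -, hk⟩ := Finset.mem_image.1 h
  refine ⟨k, ?_⟩
  rw [Nat.ModEq, mod_eq_div_add, hk, ← hb]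
  conv_rhs => rw [← Nat.div_add_mod (b % (323 * 19 ^ s)) 323]
  rw [Nat.mod_mul_right_mod]

/-- The digit sum bound: twice this sum divided by `323 * 19 ^ s` is the sum of the ternary
digits of `j * (3 ^ (144 * 19 ^ s) - 1) / (323 * 19 ^ s)`. -/
lemma sum_three_pow_mul_mod_ge (s : ℕ) {j : ℕ} (hj : ¬ 19 ∣ j) :
    (144 * 19 ^ s - 4) * (323 * 19 ^ s) ≤
      2 * ∑ i ∈ Finset.range (144 * 19 ^ s), 3 ^ i * j % (323 * 19 ^ s) := by
  set M := 19 ^ s with hM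
  have hM1 : 1 ≤ M := Nat.one_le_pow _ _ (by norm_num)
  have hi : ∀ i, 2 * ∑ k ∈ Finset.range M, 3 ^ (144 * k + i) * j % (323 * M) =
      323 * (M * (M - 1)) + 2 * M * (3 ^ i * j % 323) := by
    intro i
    have hj' : ¬ 19 ∣ 3 ^ i * j := by
      rw [Nat.Prime.dvd_mul (by norm_num)]
      rintro (h | h)
      · have := Nat.Prime.dvd_of_dvd_pow (by norm_num) h
        omega
      · exact hj h
    have h1 : ∀ k, 3 ^ (144 * k + i) * j % (323 * M) =
        323 * (3 ^ (144 * k) * (3 ^ i * j) % (323 * M) / 323) + 3 ^ i * j % 323 := by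
      intro k
      rw [pow_add, mul_assoc]
      exact mod_eq_div_add k _
    simp_rw [h1, Finset.sum_add_distrib, ← Finset.mul_sum]
    have h2 : ∑ k ∈ Finset.range M, 3 ^ (144 * k) * (3 ^ i * j) % (323 * M) / 323 =
        ∑ t ∈ Finset.range M, t := by
      conv_rhs => rw [hM, ← image_three_pow_mul (s := s) hj',
        Finset.sum_image (injOn_three_pow_mul hj')]
    rw [h2, ← Finset.sum_range_id_mul_two]
    simp only [Finset.sum_const, Finset.card_range, smul_eq_mul]
    ring
  rw [sum_range_mul_eq, Finset.sum_comm, Finset.mul_sum, Finset.sum_congr rfl fun i _ => hi i,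
    Finset.sum_add_distrib, ← Finset.mul_sum]
  have h70 := sum_mod_three_pow_ge (j % 323) (Nat.mod_lt _ (by norm_num)) (by omega)
  simp only [Nat.mul_mod_mod] at h70
  simp only [Finset.sum_const, Finset.card_range, smul_eq_mul]
  obtain ⟨r, hr⟩ : ∃ r, M = r + 1 := ⟨M - 1, by omega⟩
  have h71 := Nat.mul_le_mul_left (2 * M) h70
  rw [Finset.mul_sum] at h71
  rw [hr] at h71 ⊢
  have e1 : 144 * (r + 1) - 4 = 144 * r + 140 := by omega
  rw [e1, Nat.add_sub_cancel]
  nlinarith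

section Stickelberger

/-- The exponential of `tr x` to the base `ζ`. -/
def traceChar {F R : Type} [Field F] [CommRing R] (ζ : R) (tr : F →+ ZMod 3) (x : F) : R :=
  ζ ^ (tr x).val

lemma traceChar_add {F R : Type} [Field F] [CommRing R] {ζ : R} (hζ : ζ ^ 2 + ζ + 1 = 0)
    (tr : F →+ ZMod 3) (x y : F) : traceChar ζ tr (x + y) = traceChar ζ tr x * traceChar ζ tr y := by
  have h3 : ζ ^ 3 = 1 := by linear_combination (ζ - 1) * hζ
  rw [traceChar, traceChar, traceChar, map_add, ZMod.val_add, ← pow_add,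
    ← pow_eq_pow_mod _ h3]

variable {F : Type} [Field F] [Fintype F] [CharP F 3]

lemma sum_eq_apply_zero_add_sum_units {F A : Type} [Field F] [Fintype F] [AddCommMonoid A]
    (f : F → A) : ∑ x, f x = f 0 + ∑ x : Fˣ, f x := by
  rw [← Finset.add_sum_erase _ _ (Finset.mem_univ (0 : F))]
  congr 1
  symm
  exact Finset.sum_bij (fun (x : Fˣ) _ => (x : F)) (by simp) (fun _ _ _ _ h => Units.ext h)
    (fun b hb => ⟨Units.mk0 b (Finset.ne_of_mem_erase hb), Finset.mem_univ _, rfl⟩)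
    (fun _ _ => rfl)

lemma bijective_units_cube : Function.Bijective (fun x : Fˣ => x ^ 3) := by
  rw [← Finite.injective_iff_bijective]
  intro x y hxy
  apply Units.ext
  apply frobenius_inj F 3
  have := congrArg (Units.val) hxy
  simpa [frobenius_def] using this

/-- The inverse of the Teichmüller character, with values in the Witt vectors. -/
def teichInv (F : Type) [Field F] [Fintype F] [CharP F 3] :
    F →*₀ WittVector 3 F where
  toFun x := WittVector.teichmuller 3 x⁻¹
  map_zero' := by simp
  map_one' := by simp
  map_mul' x y := by rw [mul_inv, map_mul]

lemma coeff_teichInv (x : F) : WittVector.constantCoeff (teichInv F x) = x⁻¹ :=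
  WittVector.teichmuller_coeff_zero 3 x⁻¹

lemma sum_teichInv_pow {n : ℕ} (hn0 : 0 < n) (hn : n < Fintype.card F - 1) :
    ∑ x : Fˣ, teichInv F x ^ n = 0 := by
  let f : Fˣ →* WittVector 3 F := ((teichInv F : F →* WittVector 3 F).comp (Units.coeHom F)) ^ n
  have hf : f ≠ 1 := by
    intro h
    have h1 : ∀ x : Fˣ, x ^ n = 1 := by
      intro x
      have h2 : teichInv F x ^ n = 1 := DFunLike.congr_fun h x
      have h3 := congrArg WittVector.constantCoeff h2
      rw [map_pow, coeff_teichInv, map_one, inv_pow, inv_eq_one] at h3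
      exact Units.ext (by simpa using h3)
    rw [FiniteField.forall_pow_eq_one_iff] at h1
    exact absurd (Nat.le_of_dvd hn0 h1) (by omega)
  exact sum_hom_units_eq_zero f hf

/-- A Jacobi sum for the powers of `teichInv`. -/
def jacobiTeich (F : Type) [Field F] [Fintype F] [CharP F 3] (n : ℕ) :
    WittVector 3 F :=
  ∑ x : Fˣ, teichInv F x ^ n * teichInv F (1 - x)

lemma constantCoeff_jacobiTeich {n : ℕ} (hn : n + 1 < Fintype.card F - 1) :
    WittVector.constantCoeff (jacobiTeich F n) = -((n : F) + 1) := by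
  have hx : ∀ x : Fˣ, (x : F) ^ n * (1 - (x : F)⁻¹)⁻¹ =
      ∑ k ∈ Finset.range (n + 1), (x : F) ^ k + ((x : F) - 1)⁻¹ -
        (if x = 1 then (n : F) + 1 else 0) := by
    intro x
    by_cases h : x = 1
    · subst h
      simp
    · have h1 : (x : F) - 1 ≠ 0 := by
        rw [sub_ne_zero]
        exact fun h2 => h (Units.ext h2)
      have h2 : 1 - (x : F)⁻¹ = ((x : F) - 1) * (x : F)⁻¹ := by
        rw [sub_mul, mul_inv_cancel₀ x.ne_zero, one_mul]
      have h3 := geom_sum_mul (x : F) (n + 1)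
      rw [if_neg h, sub_zero, h2, mul_inv, inv_inv]
      apply mul_right_cancel₀ h1
      rw [add_mul, h3, inv_mul_cancel₀ h1]
      field_simp
      ring
  have hpow : ∀ k ∈ Finset.range (n + 1), k ≠ 0 → ∑ x : Fˣ, (x : F) ^ k = 0 := by
    intro k hk hk0
    rw [FiniteField.sum_pow_units, if_neg]
    intro hd
    have := Nat.le_of_dvd (Nat.pos_of_ne_zero hk0) hd
    have := Finset.mem_range.1 hk
    omega
  have hinv : ∑ x : Fˣ, ((x : F) - 1)⁻¹ = 1 := by
    have h1 : ∑ x : F, (x - 1)⁻¹ = 0 := by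
      rw [Fintype.sum_equiv (Equiv.subRight (1 : F)) (fun x => (x - 1)⁻¹) (fun y => y⁻¹)
        (fun x => rfl), Fintype.sum_equiv inv_involutive.toPerm (fun y => y⁻¹) (fun y => y ^ 1)
        (fun x => by simp)]
      exact FiniteField.sum_pow_lt_card_sub_one F 1 (by omega)
    rw [sum_eq_apply_zero_add_sum_units, zero_sub, inv_neg, inv_one] at h1
    linear_combination h1
  rw [jacobiTeich, map_sum]
  simp only [map_mul, map_pow, coeff_teichInv]
  rw [Fintype.sum_equiv (Equiv.inv Fˣ) _ (fun x : Fˣ => (x : F) ^ n * (1 - (x : F)⁻¹)⁻¹)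
    (fun x => by simp), Finset.sum_congr rfl fun x _ => hx x, Finset.sum_sub_distrib,
    Finset.sum_add_distrib, Finset.sum_comm, hinv, Finset.sum_eq_single_of_mem 0 (by simp) hpow]
  have hcard : ((Fintype.card Fˣ : ℕ) : F) = -1 := by
    rw [Fintype.card_units, Nat.cast_sub Fintype.card_pos]
    simp
  simp [hcard]

variable {R : Type} [CommRing R] [Algebra (WittVector 3 F) R]

/-- The Gauss sum of the `n`-th power of `teichInv`. -/
def gaussTeich (ζ : R) (tr : F →+ ZMod 3) (n : ℕ) : R :=
  ∑ x : Fˣ, algebraMap (WittVector 3 F) R (teichInv F x ^ n) * traceChar ζ tr x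

lemma gaussTeich_mul {ζ : R} (hζ : ζ ^ 2 + ζ + 1 = 0) (tr : F →+ ZMod 3) {n : ℕ}
    (hn : n + 1 < Fintype.card F - 1) :
    gaussTeich ζ tr n * gaussTeich ζ tr 1 =
      algebraMap (WittVector 3 F) R (jacobiTeich F n) * gaussTeich ζ tr (n + 1) := by
  set φ := algebraMap (WittVector 3 F) R
  have hy : gaussTeich ζ tr 1 = ∑ y : F, φ (teichInv F y) * traceChar ζ tr y := by
    rw [sum_eq_apply_zero_add_sum_units, map_zero, map_zero, zero_mul, zero_add, gaussTeich]
    simp only [pow_one, φ]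
  have hx : gaussTeich ζ tr n * gaussTeich ζ tr 1 = ∑ s : F, traceChar ζ tr s *
      φ (∑ x : Fˣ, teichInv F x ^ n * teichInv F (s - x)) := by
    rw [hy, gaussTeich, Finset.sum_mul]
    simp_rw [Finset.mul_sum, map_sum, Finset.mul_sum]
    rw [Finset.sum_comm (γ := F)]
    refine Finset.sum_congr rfl fun x _ => ?_
    refine Fintype.sum_equiv (Equiv.addLeft (x : F)) _ _ fun y => ?_
    simp only [Equiv.coe_addLeft, traceChar_add hζ, map_mul, add_sub_cancel_left]
    ring
  have h0 : ∑ x : Fˣ, teichInv F x ^ n * teichInv F (0 - x) = 0 := by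
    have : ∀ x : F, teichInv F (0 - x) = teichInv F (-1) * teichInv F x := fun x => by
      rw [← map_mul]
      simp
    calc _ = teichInv F (-1) * ∑ x : Fˣ, teichInv F x ^ (n + 1) := by
          rw [Finset.mul_sum]
          refine Finset.sum_congr rfl fun x _ => ?_
          rw [this, pow_succ]
          ring
      _ = 0 := by rw [sum_teichInv_pow (by omega) hn, mul_zero]
  have hs : ∀ s : Fˣ, ∑ x : Fˣ, teichInv F x ^ n * teichInv F (s - x) =
      teichInv F s ^ (n + 1) * jacobiTeich F n := by
    intro s
    rw [jacobiTeich, Finset.mul_sum]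
    symm
    refine Fintype.sum_equiv (Equiv.mulLeft s) _ _ fun x => ?_
    have : (s : F) - ((s * x : Fˣ) : F) = s * (1 - x) := by
      rw [Units.val_mul]
      ring
    rw [Equiv.coe_mulLeft, this, Units.val_mul, map_mul, map_mul]
    ring
  rw [hx, sum_eq_apply_zero_add_sum_units, h0, map_zero, mul_zero, zero_add, gaussTeich,
    Finset.mul_sum]
  refine Finset.sum_congr rfl fun s _ => ?_
  rw [hs, map_mul]
  ring

lemma gaussTeich_three_mul (ζ : R) {tr : F →+ ZMod 3} (htr : ∀ x, tr (x ^ 3) = tr x) (n : ℕ) :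
    gaussTeich ζ tr (3 * n) = gaussTeich ζ tr n := by
  rw [gaussTeich, gaussTeich]
  refine Fintype.sum_equiv (Equiv.ofBijective _ bijective_units_cube) _ _ fun x => ?_
  simp [traceChar, htr, pow_mul]

lemma sub_one_dvd_gaussTeich_one (ζ : R) (tr : F →+ ZMod 3) (hF : 1 < Fintype.card F - 1) :
    ζ - 1 ∣ gaussTeich ζ tr 1 := by
  have h : gaussTeich ζ tr 1 = ∑ x : Fˣ, algebraMap (WittVector 3 F) R (teichInv F x ^ 1) *
      (traceChar ζ tr x - 1) := by
    simp_rw [mul_sub, Finset.sum_sub_distrib, mul_one, ← map_sum]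
    rw [sum_teichInv_pow one_pos hF, map_zero, sub_zero, gaussTeich]
  rw [h]
  refine Finset.dvd_sum fun x _ => Dvd.dvd.mul_left ?_ _
  simpa [traceChar] using sub_dvd_pow_sub_pow ζ 1 (tr x).val

lemma gaussTeich_succ_dvd {ζ : R} (hζ : ζ ^ 2 + ζ + 1 = 0) (tr : F →+ ZMod 3) {n e : ℕ}
    (hn : n + 1 < Fintype.card F - 1) (hn3 : ¬ 3 ∣ n + 1) (h : (ζ - 1) ^ e ∣ gaussTeich ζ tr n) :
    (ζ - 1) ^ (e + 1) ∣ gaussTeich ζ tr (n + 1) := by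
  have hu : IsUnit (jacobiTeich F n) := by
    apply WittVector.isUnit_of_coeff_zero_ne_zero
    have := constantCoeff_jacobiTeich hn
    intro h0
    have h1 : WittVector.constantCoeff (jacobiTeich F n) = 0 := h0
    rw [this, neg_eq_zero] at h1
    apply hn3
    rw [← CharP.cast_eq_zero_iff F 3]
    exact_mod_cast h1
  have hu' := hu.map (algebraMap (WittVector 3 F) R)
  rw [← hu'.dvd_mul_left, ← gaussTeich_mul hζ tr hn, pow_succ]
  exact mul_dvd_mul h (sub_one_dvd_gaussTeich_one ζ tr (by omega))

/-- The lower bound in Stickelberger's theorem: the power of `ζ - 1` dividing a Gauss sum is at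
least the sum of the ternary digits. -/
lemma sub_one_pow_dvd_gaussTeich {ζ : R} (hζ : ζ ^ 2 + ζ + 1 = 0) {tr : F →+ ZMod 3}
    (htr : ∀ x, tr (x ^ 3) = tr x) {N j f : ℕ} (hN : 0 < N)
    (hf : 3 ^ f * j / N < Fintype.card F - 1) (i : ℕ) (hi : i ≤ f) :
    (ζ - 1) ^ (∑ t ∈ Finset.range i, (3 ^ (t + 1) * j / N - 3 * (3 ^ t * j / N))) ∣
      gaussTeich ζ tr (3 ^ i * j / N) := by
  induction i with
  | zero => simp
  | succ i ih =>
    rw [Finset.sum_range_succ]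
    have ih := ih (by omega)
    set n := 3 ^ i * j / N with hn
    set n' := 3 ^ (i + 1) * j / N with hn'
    have hle : n' < Fintype.card F - 1 := lt_of_le_of_lt
      (Nat.div_le_div_right (Nat.mul_le_mul_right _ (Nat.pow_le_pow_right (by norm_num) hi))) hf
    have h1 : 3 * n ≤ n' := by
      rw [hn', Nat.le_div_iff_mul_le hN, pow_succ]
      have := Nat.div_mul_le_self (3 ^ i * j) N
      rw [← hn] at this
      nlinarith
    have h2 : n' < 3 * n + 3 := by
      rw [hn', Nat.div_lt_iff_lt_mul hN, pow_succ]
      have := Nat.lt_div_mul_add hN (a := 3 ^ i * j)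
      rw [← hn] at this
      nlinarith
    rw [← gaussTeich_three_mul ζ htr n] at ih
    generalize ∑ t ∈ Finset.range i, (3 ^ (t + 1) * j / N - 3 * (3 ^ t * j / N)) = e at ih ⊢
    obtain h | h | h : n' = 3 * n ∨ n' = 3 * n + 1 ∨ n' = 3 * n + 1 + 1 := by omega
    · rw [h]
      simpa using ih
    · have := gaussTeich_succ_dvd hζ tr (by omega) (by omega) ih
      rw [h, Nat.add_sub_cancel_left]
      exact this
    · have h3 := gaussTeich_succ_dvd hζ tr (by omega) (by omega) ih
      have h4 := gaussTeich_succ_dvd hζ tr (by omega) (by omega) h3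
      rw [h, add_assoc, Nat.add_sub_cancel_left, ← add_assoc, ← add_assoc]
      exact h4

end Stickelberger

section TraceWeight

variable {F : Type} [Field F]

/-- An integer-valued function on `ZMod 3` whose even part is that of an additive character. -/
def traceWeight (t : ZMod 3) : ℤ := if t = 0 then 1 else if t = 1 then -1 else 0

lemma sum_mul_traceChar {X : Type} [Fintype X] [InvolutiveNeg X] {v : X → F}
    (hv : ∀ x, v (-x) = -v x) {R : Type} [CommRing R] {ζ : R} (hζ : ζ ^ 2 + ζ + 1 = 0)
    (tr : F →+ ZMod 3) {f : X → R} (hf : ∀ x, f (-x) = f x) :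
    ∑ x, f x * traceChar ζ tr (v x) = ∑ x, f x * (traceWeight (tr (v x)) : R) := by
  rw [← sub_eq_zero, ← Finset.sum_sub_distrib]
  have key : ∀ t : ZMod 3, ζ ^ t.val - (traceWeight t : R) + (ζ ^ (-t).val - (traceWeight (-t) : R))
      = 0 := by
    intro t
    have h1 : (1 : ZMod 3).val = 1 := rfl
    have h2 : (2 : ZMod 3).val = 2 := rfl
    have h3 : (-1 : ZMod 3) = 2 := rfl
    have h4 : (-2 : ZMod 3) = 1 := rfl
    have h5 : (2 : ZMod 3) ≠ 0 := by decide
    have h6 : (2 : ZMod 3) ≠ 1 := by decide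
    obtain rfl | rfl | rfl : t = 0 ∨ t = 1 ∨ t = 2 := by revert t; decide
    · simp [traceWeight]
    · simp [traceWeight, h1, h2, h3, h5, h6]
      linear_combination hζ
    · simp [traceWeight, h1, h2, h4, h5, h6]
      linear_combination hζ
  refine Finset.sum_involution (fun x _ => -x) ?_ ?_ (fun _ _ => Finset.mem_univ _)
    (fun x _ => neg_neg x)
  · intro x _
    have := key (tr (v x))
    rw [hf, traceChar, traceChar, hv, map_neg]
    linear_combination f x * this
  · intro x _ h1 h2
    apply h1
    have h3 : tr (v x) = -tr (v x) := by
      rw [← map_neg, ← hv, h2]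
    have h4 : tr (v x) = 0 := by
      revert h3
      generalize tr (v x) = t
      revert t
      decide
    simp [traceChar, h4, traceWeight]

end TraceWeight

section Stickelberger

variable {F : Type} [Field F] [Fintype F] [CharP F 3]

lemma QuadraticAlgebra.omega_sq_add_omega_add_one (W : Type) [CommRing W] :
    (⟨0, 1⟩ : QuadraticAlgebra W (-1) (-1)) ^ 2 + ⟨0, 1⟩ + 1 = 0 := by
  rw [pow_two]
  apply QuadraticAlgebra.ext <;> simp [QuadraticAlgebra.re_one, QuadraticAlgebra.im_one]

omit [Fintype F] in
lemma WittVector.three_ne_zero_of_charP : (3 : WittVector 3 F) ≠ 0 := by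
  have := WittVector.p_nonzero 3 F
  exact_mod_cast this

omit [Fintype F] in
lemma WittVector.three_pow_dvd_intCast (n : ℕ) {z : ℤ} (h : (3 : WittVector 3 F) ^ n ∣ z) :
    (3 : ℤ) ^ n ∣ z := by
  induction n generalizing z with
  | zero => simp
  | succ n ih =>
    obtain ⟨y, rfl⟩ := ih (dvd_trans (pow_dvd_pow _ n.le_succ) h)
    push_cast at h
    rw [pow_succ, mul_dvd_mul_iff_left (pow_ne_zero _ WittVector.three_ne_zero_of_charP)] at h
    rw [pow_succ]
    apply mul_dvd_mul_left
    have h1 := map_dvd WittVector.constantCoeff h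
    rw [map_intCast, map_ofNat] at h1
    have h2 : (3 : F) = 0 := by exact_mod_cast CharP.cast_eq_zero F 3
    rw [h2, zero_dvd_iff, CharP.intCast_eq_zero_iff F 3] at h1
    exact_mod_cast h1

omit [Fintype F] in
lemma QuadraticAlgebra.three_pow_dvd_intCast (n : ℕ) {z : ℤ}
    (h : (3 : QuadraticAlgebra (WittVector 3 F) (-1) (-1)) ^ n ∣ z) : (3 : ℤ) ^ n ∣ z := by
  apply WittVector.three_pow_dvd_intCast (F := F)
  have h1 : algebraMap (WittVector 3 F) (QuadraticAlgebra (WittVector 3 F) (-1) (-1)) (3 ^ n) ∣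
      algebraMap _ _ (z : WittVector 3 F) := by
    rw [map_pow, map_ofNat, map_intCast]
    exact h
  exact QuadraticAlgebra.algebraMap_dvd_iff_dvd.1 h1

lemma three_pow_dvd_gaussTeich {R : Type} [CommRing R] [Algebra (WittVector 3 F) R] {ζ : R}
    (hζ : ζ ^ 2 + ζ + 1 = 0) {tr : F →+ ZMod 3} (htr : ∀ x, tr (x ^ 3) = tr x) {s K j : ℕ}
    (hF : Fintype.card F = 3 ^ (144 * 19 ^ s)) (hK : 323 * 19 ^ s * K + 1 = Fintype.card F)
    (hj : ¬ 19 ∣ j) (hjN : j < 323 * 19 ^ s) :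
    (3 : R) ^ (72 * 19 ^ s - 2) ∣ gaussTeich ζ tr (K * j) := by
  have hr := sum_three_pow_mul_mod_ge s hj
  set M := 19 ^ s with hM
  have hM0 : 0 < M := by positivity
  set N := 323 * M with hN
  have hN0 : 0 < N := by positivity
  have hK0 : 0 < K := by
    rcases Nat.eq_zero_or_pos K with rfl | h
    · have := Fintype.one_lt_card (α := F)
      omega
    · exact h
  have hlast : 3 ^ (144 * M) * j = N * (K * j) + j := by
    rw [← hF, ← hK]
    ring
  have hdiv : 3 ^ (144 * M) * j / N = K * j := by
    rw [hlast, Nat.mul_add_div hN0, Nat.div_eq_of_lt hjN, add_zero]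
  have hmod : 3 ^ (144 * M) * j % N = j := by
    rw [hlast, Nat.mul_add_mod, Nat.mod_eq_of_lt hjN]
  have hlt : 3 ^ (144 * M) * j / N < Fintype.card F - 1 := by
    rw [hdiv, ← hK, Nat.add_sub_cancel, mul_comm N]
    exact Nat.mul_lt_mul_of_pos_left hjN hK0
  have key := sub_one_pow_dvd_gaussTeich hζ htr hN0 hlt _ le_rfl
  rw [hdiv] at key
  have hE : 144 * M - 4 ≤
      ∑ t ∈ Finset.range (144 * M), (3 ^ (t + 1) * j / N - 3 * (3 ^ t * j / N)) := by
    have h1 : ∀ t, N * (3 ^ (t + 1) * j / N - 3 * (3 ^ t * j / N)) + 3 ^ (t + 1) * j % N =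
        3 * (3 ^ t * j % N) := by
      intro t
      have h2 := Nat.div_add_mod (3 ^ (t + 1) * j) N
      have h3 := Nat.div_add_mod (3 ^ t * j) N
      have h4 : 3 * (3 ^ t * j / N) ≤ 3 ^ (t + 1) * j / N := by
        rw [Nat.le_div_iff_mul_le hN0, pow_succ]
        nlinarith [Nat.zero_le (3 ^ t * j % N)]
      obtain ⟨d, hd⟩ := Nat.exists_eq_add_of_le h4
      rw [hd, Nat.add_sub_cancel_left]
      rw [hd] at h2
      rw [pow_succ] at h2 ⊢
      linarith
    have h5 : ∑ t ∈ Finset.range (144 * M), 3 ^ (t + 1) * j % N =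
        ∑ t ∈ Finset.range (144 * M), 3 ^ t * j % N := by
      have h6 := Finset.sum_range_succ (fun t => 3 ^ t * j % N) (144 * M)
      have h7 := Finset.sum_range_succ' (fun t => 3 ^ t * j % N) (144 * M)
      have h8 : 3 ^ 0 * j % N = j := by rw [pow_zero, one_mul, Nat.mod_eq_of_lt hjN]
      omega
    have h9 := Finset.sum_congr rfl fun t (_ : t ∈ Finset.range (144 * M)) => h1 t
    rw [Finset.sum_add_distrib, ← Finset.mul_sum, ← Finset.mul_sum, h5] at h9
    apply Nat.le_of_mul_le_mul_left _ hN0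
    linarith
  refine dvd_trans ?_ (dvd_trans (pow_dvd_pow _ hE) key)
  have h3 : 144 * M - 4 = 2 * (72 * M - 2) := by omega
  have h4 : (ζ - 1) ^ 2 = 3 * -ζ := by linear_combination hζ
  rw [h3, pow_mul, h4, mul_pow]
  exact dvd_mul_right _ _

lemma geom_sum_eq_ite {W : Type} [CommRing W] [IsDomain W] {y : W} {n : ℕ} (hy : y ^ n = 1) :
    ∑ j ∈ Finset.range n, y ^ j = if y = 1 then (n : W) else 0 := by
  split_ifs with h
  · simp [h]
  · have := geom_sum_mul y n
    rw [hy, sub_self] at this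
    exact (mul_eq_zero.1 this).resolve_right (sub_ne_zero.2 h)

lemma sum_pow_not_dvd {W : Type} [CommRing W] [IsDomain W] {y : W} {n : ℕ}
    (hy : y ^ (19 * n) = 1) :
    ∑ j ∈ (Finset.range (19 * n)).filter (fun j => ¬ 19 ∣ j), y ^ j =
      n * (19 * (if y = 1 then 1 else 0) - (if y ^ 19 = 1 then 1 else 0)) := by
  have h1 := Finset.sum_filter_add_sum_filter_not (Finset.range (19 * n)) (fun j => 19 ∣ j)
    (fun j => y ^ j)
  have h2 : ∑ j ∈ (Finset.range (19 * n)).filter (fun j => 19 ∣ j), y ^ j =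
      ∑ j ∈ Finset.range n, (y ^ 19) ^ j := by
    symm
    refine Finset.sum_bij (fun j _ => 19 * j) ?_ ?_ ?_ ?_
    · intro j hj
      simp only [Finset.mem_filter, Finset.mem_range] at hj ⊢
      exact ⟨by omega, dvd_mul_right _ _⟩
    · intro i _ j _ h
      omega
    · intro b hb
      simp only [Finset.mem_filter, Finset.mem_range] at hb
      obtain ⟨h3, c, rfl⟩ := hb
      exact ⟨c, Finset.mem_range.2 (by omega), rfl⟩
    · intro j _
      rw [pow_mul]
  rw [h2, geom_sum_eq_ite hy, geom_sum_eq_ite (by rw [← pow_mul, hy])] at h1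
  rw [eq_sub_iff_add_eq'.2 h1]
  push_cast
  split_ifs <;> ring

lemma three_pow_dvd_intCast_sum_traceWeight {R : Type} [CommRing R] [Algebra (WittVector 3 F) R]
    {ζ : R} (hζ : ζ ^ 2 + ζ + 1 = 0) {tr : F →+ ZMod 3} (htr : ∀ x, tr (x ^ 3) = tr x) {s K : ℕ}
    (hF : Fintype.card F = 3 ^ (144 * 19 ^ s)) (hK : 323 * 19 ^ s * K + 1 = Fintype.card F)
    (z : Fˣ) :
    (3 : R) ^ (72 * 19 ^ s - 2) ∣
      (((17 * 19 ^ s : ℕ) * (19 * ∑ x : Fˣ, (if x ^ K = z ^ K then traceWeight (tr x) else 0) -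
        ∑ x : Fˣ, if x ^ (19 * K) = z ^ (19 * K) then traceWeight (tr x) else 0) : ℤ) : R) := by
  have hKeven : Even K := by
    have h1 : Odd (Fintype.card F) := by
      rw [hF]
      exact Odd.pow (by decide)
    rw [← hK, Nat.odd_add_one, Nat.not_odd_iff_even, Nat.even_mul] at h1
    refine h1.resolve_left ?_
    rw [Nat.not_even_iff_odd]
    exact Odd.mul (by decide) (Odd.pow (by decide))
  have hneg : ∀ x : Fˣ, (-x) ^ K = x ^ K := fun x => hKeven.neg_pow x
  have hinj : ∀ {x y : F}, teichInv F x = teichInv F y → x = y := by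
    intro x y h
    have := congrArg WittVector.constantCoeff h
    rwa [coeff_teichInv, coeff_teichInv, inv_inj] at this
  have hone : ∀ (x : Fˣ) (n : ℕ), teichInv F (x * z⁻¹ : Fˣ) ^ n = 1 ↔ x ^ n = z ^ n := by
    intro x n
    rw [← map_pow, ← map_one (teichInv F)]
    constructor
    · intro h
      have h1 : ((x * z⁻¹) ^ n : Fˣ) = 1 := Units.ext (by simpa using hinj h)
      rwa [mul_pow, inv_pow, mul_inv_eq_one] at h1
    · intro h
      rw [← Units.val_pow_eq_pow_val, mul_pow, inv_pow, mul_inv_eq_one.2 h, Units.val_one]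
  have hkernel : ∀ x : Fˣ, ∑ j ∈ (Finset.range (19 * (17 * 19 ^ s))).filter (fun j => ¬ 19 ∣ j),
      teichInv F (x * z⁻¹ : Fˣ) ^ (K * j) = ((17 * 19 ^ s : ℕ) : WittVector 3 F) *
        (19 * (if x ^ K = z ^ K then 1 else 0) - if x ^ (19 * K) = z ^ (19 * K) then 1 else 0) := by
    intro x
    simp_rw [pow_mul _ K]
    rw [sum_pow_not_dvd, ← pow_mul, mul_comm K 19]
    · simp only [hone]
    · have h1 : K * (19 * (17 * 19 ^ s)) = Fintype.card F - 1 := by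
        rw [← hK, Nat.add_sub_cancel]
        ring
      rw [← pow_mul, hone, h1, ← Fintype.card_units, pow_card_eq_one, pow_card_eq_one]
  have hsum : ∑ j ∈ (Finset.range (19 * (17 * 19 ^ s))).filter (fun j => ¬ 19 ∣ j),
      algebraMap (WittVector 3 F) R (teichInv F (z⁻¹ : Fˣ) ^ (K * j)) * gaussTeich ζ tr (K * j) =
      (((17 * 19 ^ s : ℕ) * (19 * ∑ x : Fˣ, (if x ^ K = z ^ K then traceWeight (tr x) else 0) -
        ∑ x : Fˣ, if x ^ (19 * K) = z ^ (19 * K) then traceWeight (tr x) else 0) : ℤ) : R) := by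
    calc _ = ∑ x : Fˣ, algebraMap (WittVector 3 F) R (((17 * 19 ^ s : ℕ) : WittVector 3 F) *
        (19 * (if x ^ K = z ^ K then 1 else 0) - if x ^ (19 * K) = z ^ (19 * K) then 1 else 0)) *
          traceChar ζ tr x := by
          simp_rw [gaussTeich, Finset.mul_sum]
          rw [Finset.sum_comm]
          refine Finset.sum_congr rfl fun x _ => ?_
          rw [← hkernel, map_sum, Finset.sum_mul]
          refine Finset.sum_congr rfl fun j _ => ?_
          rw [Units.val_mul, map_mul, mul_pow, map_mul]
          ring
      _ = ∑ x : Fˣ, algebraMap (WittVector 3 F) R (((17 * 19 ^ s : ℕ) : WittVector 3 F) *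
        (19 * (if x ^ K = z ^ K then 1 else 0) - if x ^ (19 * K) = z ^ (19 * K) then 1 else 0)) *
          (traceWeight (tr x) : R) := by
          apply sum_mul_traceChar (fun x => Units.val_neg x) hζ
          intro x
          rw [pow_mul', pow_mul' x, hneg]
      _ = _ := by
          rw [Finset.mul_sum, ← Finset.sum_sub_distrib, Finset.mul_sum, Int.cast_sum]
          refine Finset.sum_congr rfl fun x _ => ?_
          push_cast
          split_ifs <;> simp [map_ofNat] <;> ring
  rw [← hsum]
  refine Finset.dvd_sum fun j hj => Dvd.dvd.mul_left ?_ _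
  rw [Finset.mem_filter, Finset.mem_range] at hj
  exact three_pow_dvd_gaussTeich hζ htr hF hK hj.2 (by omega)

lemma three_pow_dvd_sum_traceWeight {tr : F →+ ZMod 3} (htr : ∀ x, tr (x ^ 3) = tr x) {s K : ℕ}
    (hF : Fintype.card F = 3 ^ (144 * 19 ^ s)) (hK : 323 * 19 ^ s * K + 1 = Fintype.card F)
    (z : Fˣ) :
    (3 : ℤ) ^ (72 * 19 ^ s - 2) ∣
      19 * ∑ x : Fˣ, (if x ^ K = z ^ K then traceWeight (tr x) else 0) -
        ∑ x : Fˣ, if x ^ (19 * K) = z ^ (19 * K) then traceWeight (tr x) else 0 := by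
  have hcop : IsCoprime ((3 : ℤ) ^ (72 * 19 ^ s - 2)) ((17 * 19 ^ s : ℕ) : ℤ) := by
    rw [← Nat.cast_ofNat (n := 3), ← Nat.cast_pow, Nat.isCoprime_iff_coprime]
    exact Nat.Coprime.pow_left _ (Nat.Coprime.mul_right (by norm_num)
      (Nat.Coprime.pow_right _ (by norm_num)))
  apply hcop.dvd_of_dvd_mul_left
  apply QuadraticAlgebra.three_pow_dvd_intCast (F := F)
  exact three_pow_dvd_intCast_sum_traceWeight
    (QuadraticAlgebra.omega_sq_add_omega_add_one _) htr hF hK z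

end Stickelberger

section Periods

set_option linter.constructorNameAsVariable false

lemma sum_range_add_of_periodic {A : Type*} [AddCommGroup A] {n : ℕ} {h : ℕ → A}
    (hh : ∀ b, h (b + n) = h b) (k : ℕ) :
    ∑ b ∈ Finset.range n, h (b + k) = ∑ b ∈ Finset.range n, h b := by
  induction k with
  | zero => rfl
  | succ k ih =>
    rw [← ih]
    have h1 := Finset.sum_range_succ (fun b => h (b + k)) n
    have h2 := Finset.sum_range_succ' (fun b => h (b + k)) n
    have h3 : h (n + k) = h (0 + k) := by rw [zero_add, add_comm, hh]
    rw [h1, h3, add_left_inj] at h2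
    rw [h2]
    exact Finset.sum_congr rfl fun b _ => congrArg h (by ring)

variable {s : ℕ} {η : ℕ → ℤ}

lemma injOn_mul_add_seventeen_mul (s : ℕ) :
    Set.InjOn (fun x : ℕ × ℕ => (19 ^ s * x.1 + 17 * x.2) % (323 * 19 ^ s))
      ((Finset.range 323 ×ˢ Finset.range (19 ^ s) : Finset (ℕ × ℕ)) : Set (ℕ × ℕ)) := by
  rintro ⟨c, i⟩ hx ⟨c', i'⟩ hx' h
  simp only [Finset.coe_product, Set.mem_prod, Finset.coe_range, Set.mem_Iio] at hx hx' h
  have hM : 0 < 19 ^ s := by positivity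
  have h1 : 19 ^ s * c + 17 * i ≡ 19 ^ s * c' + 17 * i' [MOD 19 ^ s] :=
    Nat.ModEq.of_mul_left 323 h
  have h2 : 17 * i ≡ 17 * i' [MOD 19 ^ s] := by
    unfold Nat.ModEq at h1 ⊢
    rwa [Nat.mul_add_mod, Nat.mul_add_mod] at h1
  have h3 : i ≡ i' [MOD 19 ^ s] := by
    refine Nat.ModEq.cancel_left_of_coprime ?_ h2
    exact Nat.Coprime.pow_left _ (by norm_num)
  have hi : i = i' := h3.eq_of_lt_of_lt hx.2 hx'.2
  subst hi
  have h4 : 19 ^ s * c ≡ 19 ^ s * c' [MOD 19 ^ s * 323] := by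
    rw [mul_comm _ 323]
    exact Nat.ModEq.add_right_cancel' _ h
  have h5 : c ≡ c' [MOD 323] := Nat.ModEq.mul_left_cancel' hM.ne' h4
  rw [h5.eq_of_lt_of_lt hx.1 hx'.1]

lemma image_mul_add_seventeen_mul (s : ℕ) :
    (Finset.range 323 ×ˢ Finset.range (19 ^ s)).image
      (fun x : ℕ × ℕ => (19 ^ s * x.1 + 17 * x.2) % (323 * 19 ^ s)) =
        Finset.range (323 * 19 ^ s) := by
  apply Finset.eq_of_subset_of_card_le
  · rw [Finset.image_subset_iff]
    intro y _
    rw [Finset.mem_range]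
    exact Nat.mod_lt _ (by positivity)
  · rw [Finset.card_image_of_injOn (injOn_mul_add_seventeen_mul s)]
    rw [Finset.card_range, Finset.card_product, Finset.card_range, Finset.card_range]

lemma not_dvd_mul_add_seventeen_mul {s c i : ℕ} (hi0 : 0 < i) (hi : i < 19 ^ s) :
    ¬ 19 ^ s ∣ 19 ^ s * c + 17 * i := by
  rw [Nat.dvd_add_right (dvd_mul_right _ _)]
  intro h
  have := (Nat.Coprime.pow_left s (by norm_num : Nat.Coprime 19 17)).dvd_of_dvd_mul_left h
  exact absurd (Nat.le_of_dvd hi0 this) (by omega)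

lemma apply_mul_add_seventeen_mul {A : Type*} {G : ℕ → A}
    (hG : ∀ b, ¬ 19 ^ s ∣ b → G (b + 17) = G b) {c i : ℕ} (hi0 : 0 < i) (hi : i ≤ 19 ^ s) :
    G (19 ^ s * c + 17 * i) = G (19 ^ s * (c + 17)) := by
  induction hi using Nat.decreasingInduction with
  | self => congr 1; ring
  | of_succ k hk ih =>
    rw [← ih (by omega), ← hG _ (not_dvd_mul_add_seventeen_mul hi0 hk)]
    congr 1

lemma exists_apply_eq_apply_mul {A : Type*} {G : ℕ → A} (hper : ∀ b, G (b + 323 * 19 ^ s) = G b)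
    (hG : ∀ b, ¬ 19 ^ s ∣ b → G (b + 17) = G b) (b : ℕ) : ∃ c, G b = G (19 ^ s * c) := by
  have hmod : ∀ b, G (b % (323 * 19 ^ s)) = G b := fun n => Function.Periodic.map_mod_nat hper n
  have hb : b % (323 * 19 ^ s) ∈ Finset.range (323 * 19 ^ s) :=
    Finset.mem_range.2 (Nat.mod_lt _ (by positivity))
  rw [← image_mul_add_seventeen_mul, Finset.mem_image] at hb
  obtain ⟨⟨c, i⟩, hci, h⟩ := hb
  simp only [Finset.mem_product, Finset.mem_range] at hci h
  rw [← hmod b, ← h, hmod]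
  rcases Nat.eq_zero_or_pos i with rfl | hi
  · exact ⟨c, rfl⟩
  · exact ⟨c + 17, apply_mul_add_seventeen_mul hG hi hci.2.le⟩

lemma sum_range_eq_pow_mul_sum {G : ℕ → ℤ} (hper : ∀ b, G (b + 323 * 19 ^ s) = G b)
    (hG : ∀ b, ¬ 19 ^ s ∣ b → G (b + 17) = G b) :
    ∑ b ∈ Finset.range (323 * 19 ^ s), G b =
      19 ^ s * ∑ c ∈ Finset.range 323, G (19 ^ s * c) := by
  have hmod : ∀ b, G (b % (323 * 19 ^ s)) = G b := fun n => Function.Periodic.map_mod_nat hper n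
  have hshift : ∑ c ∈ Finset.range 323, G (19 ^ s * (c + 17)) =
      ∑ c ∈ Finset.range 323, G (19 ^ s * c) :=
    sum_range_add_of_periodic (h := fun c => G (19 ^ s * c))
      (fun b => by rw [← hper (19 ^ s * b)]; congr 1; ring) 17
  rw [← image_mul_add_seventeen_mul, Finset.sum_image (injOn_mul_add_seventeen_mul s),
    Finset.sum_product_right]
  simp only [hmod]
  rw [Finset.sum_congr rfl (g := fun _ => ∑ c ∈ Finset.range 323, G (19 ^ s * c))]
  · simp
  · intro i hi
    rcases Nat.eq_zero_or_pos i with rfl | hi0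
    · rfl
    · rw [← hshift]
      exact Finset.sum_congr rfl fun c _ =>
        apply_mul_add_seventeen_mul hG hi0 (Finset.mem_range.1 hi).le

lemma apply_add_seventeen_mul_pow (hper : ∀ b, η (b + 323 * 19 ^ s) = η b)
    (h3 : ∀ b, η (3 * b) = η b) {b : ℕ} (hb : ¬ 19 ^ s ∣ b) : η (b + 17 * 19 ^ s) = η b := by
  have hmod : ∀ b, η (b % (323 * 19 ^ s)) = η b := fun n => Function.Periodic.map_mod_nat hper n
  have hb0 : b ≠ 0 := fun h => hb (h ▸ dvd_zero _)
  obtain ⟨v, b', hb', rfl⟩ := Nat.exists_eq_pow_mul_and_not_dvd hb0 19 (by norm_num)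
  have hv : v < s := by
    by_contra h
    exact hb (dvd_mul_of_dvd_left (pow_dvd_pow _ (by omega)) _)
  obtain ⟨r, rfl⟩ := Nat.exists_eq_add_of_lt hv
  have h1 : b' + 17 * 19 ^ (r + 1) ≡ b' [MOD 323] := by
    have : 17 * 19 ^ (r + 1) = 323 * 19 ^ r := by ring
    rw [this]
    exact Nat.add_modulus_mul_modEq_iff.2 rfl
  obtain ⟨k, hk⟩ := exists_three_pow_mul_modEq (r + 1) hb' h1
  have h2 := Nat.ModEq.mul_left' (19 ^ v) hk
  have h4 : 19 ^ v * (323 * 19 ^ (r + 1)) = 323 * 19 ^ (v + r + 1) := by ring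
  have h5 : 19 ^ v * (3 ^ (144 * k) * b') = 3 ^ (144 * k) * (19 ^ v * b') := by ring
  have h6 : 19 ^ v * (b' + 17 * 19 ^ (r + 1)) = 19 ^ v * b' + 17 * 19 ^ (v + r + 1) := by ring
  rw [h4, h5, h6] at h2
  rw [← hmod, ← h2, hmod, apply_pow_three_mul h3]

/-- The sums of `η` over the arithmetic progressions of length `19 ^ s` and difference `17`. -/
def progSum (s : ℕ) (η : ℕ → ℤ) (b : ℕ) : ℤ := ∑ i ∈ Finset.range (19 ^ s), η (b + 17 * i)

lemma progSum_add_period (hper : ∀ b, η (b + 323 * 19 ^ s) = η b) (b : ℕ) :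
    progSum s η (b + 323 * 19 ^ s) = progSum s η b := by
  refine Finset.sum_congr rfl fun i _ => ?_
  rw [← hper (b + 17 * i), add_right_comm]

lemma progSum_add_seventeen (hper : ∀ b, η (b + 323 * 19 ^ s) = η b)
    (h3 : ∀ b, η (3 * b) = η b) {b : ℕ} (hb : ¬ 19 ^ s ∣ b) :
    progSum s η (b + 17) = progSum s η b := by
  have h1 := Finset.sum_range_succ (fun i => η (b + 17 * i)) (19 ^ s)
  have h2 := Finset.sum_range_succ' (fun i => η (b + 17 * i)) (19 ^ s)
  rw [h1, apply_add_seventeen_mul_pow hper h3 hb, mul_zero, add_zero, add_left_inj] at h2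
  rw [progSum, progSum, h2]
  exact Finset.sum_congr rfl fun b _ => congrArg η (by ring)

lemma progSum_mul_add_period (hper : ∀ b, η (b + 323 * 19 ^ s) = η b) (c : ℕ) :
    progSum s η (19 ^ s * (c + 323)) = progSum s η (19 ^ s * c) := by
  rw [← progSum_add_period hper (19 ^ s * c)]
  congr 1
  ring

lemma progSum_mul_eq (hper : ∀ b, η (b + 323 * 19 ^ s) = η b) (h3 : ∀ b, η (3 * b) = η b)
    (c : ℕ) :
    19 * (progSum s η (19 ^ s * c) - η (19 ^ s * c)) =
      ∑ n ∈ Finset.range (19 ^ s * 19), η (19 ^ s * c + 17 * n) -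
        ∑ l ∈ Finset.range 19, η (19 ^ s * (c + 17 * l)) := by
  have hT : ∀ c, progSum s η (19 ^ s * c) - η (19 ^ s * c) =
      ∑ i ∈ (Finset.range (19 ^ s)).erase 0, η (19 ^ s * c + 17 * i) := by
    intro c
    rw [progSum, ← Finset.add_sum_erase _ _ (Finset.mem_range.2 (by positivity : 0 < 19 ^ s)),
      mul_zero, add_zero, add_sub_cancel_left]
  have hstep : ∀ c, progSum s η (19 ^ s * (c + 17)) - η (19 ^ s * (c + 17)) =
      progSum s η (19 ^ s * c) - η (19 ^ s * c) := by
    intro c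
    rw [hT, hT]
    refine Finset.sum_congr rfl fun i hi => ?_
    rw [Finset.mem_erase, Finset.mem_range] at hi
    rw [← apply_add_seventeen_mul_pow hper h3
      (not_dvd_mul_add_seventeen_mul (c := c) (Nat.pos_of_ne_zero hi.1) hi.2)]
    congr 1
    ring
  have hstep' : ∀ l c, progSum s η (19 ^ s * (c + 17 * l)) - η (19 ^ s * (c + 17 * l)) =
      progSum s η (19 ^ s * c) - η (19 ^ s * c) := by
    intro l c
    induction l with
    | zero => rfl
    | succ l ih => rw [← ih, ← hstep (c + 17 * l)]; rfl
  have hsum := Finset.sum_congr rfl fun l (_ : l ∈ Finset.range 19) => hstep' l c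
  rw [Finset.sum_const, Finset.card_range, Finset.sum_sub_distrib, nsmul_eq_mul] at hsum
  rw [sum_range_mul_eq]
  push_cast at hsum
  rw [← hsum]
  congr 1
  refine Finset.sum_congr rfl fun l _ => Finset.sum_congr rfl fun i _ => congrArg η ?_
  ring

lemma progSum_three_mul (hper : ∀ b, η (b + 323 * 19 ^ s) = η b) (h3 : ∀ b, η (3 * b) = η b)
    (c : ℕ) : progSum s η (19 ^ s * (3 * c)) = progSum s η (19 ^ s * c) := by
  have h1 := progSum_mul_eq hper h3 (3 * c)
  have h2 := progSum_mul_eq hper h3 c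
  have e1 : ∀ d, η (19 ^ s * (3 * d)) = η (19 ^ s * d) := fun d => by
    rw [← h3 (19 ^ s * d)]
    congr 1
    ring
  have e2 : ∑ n ∈ Finset.range (19 ^ s * 19), η (19 ^ s * (3 * c) + 17 * n) =
      ∑ n ∈ Finset.range (19 ^ s * 19), η (19 ^ s * c + 17 * n) := by
    rw [← sum_range_mul_three _ (by positivity)
      (Nat.Coprime.mul_right (Nat.Coprime.pow_right _ (by norm_num)) (by norm_num))]
    · refine Finset.sum_congr rfl fun n _ => ?_
      rw [← h3 (19 ^ s * c + 17 * n)]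
      congr 1
      ring
    · intro n
      rw [← hper (19 ^ s * (3 * c) + 17 * n)]
      congr 1
      ring
  have e3 : ∑ l ∈ Finset.range 19, η (19 ^ s * (3 * c + 17 * l)) =
      ∑ l ∈ Finset.range 19, η (19 ^ s * (c + 17 * l)) := by
    rw [← sum_range_mul_three 19 (by norm_num) (by norm_num)]
    · refine Finset.sum_congr rfl fun n _ => ?_
      rw [← e1 (c + 17 * n)]
      congr 1
      ring
    · intro n
      rw [← hper (19 ^ s * (3 * c + 17 * n))]
      congr 1
      ring
  rw [e1, e2, e3] at h1
  linarith

lemma sum_progSum (hper : ∀ b, η (b + 323 * 19 ^ s) = η b) (h3 : ∀ b, η (3 * b) = η b)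
    (hsum : ∑ b ∈ Finset.range (323 * 19 ^ s), η b = -1) :
    ∑ c ∈ Finset.range 323, progSum s η (19 ^ s * c) = -1 := by
  have h1 := sum_range_eq_pow_mul_sum (progSum_add_period hper)
    (fun b hb => progSum_add_seventeen hper h3 hb)
  simp_rw [progSum] at h1
  rw [Finset.sum_comm, Finset.sum_congr rfl fun i _ =>
    (sum_range_add_of_periodic hper (17 * i)).trans hsum] at h1
  have hM : (19 : ℤ) ^ s ≠ 0 := by positivity
  apply mul_left_cancel₀ hM
  simp_rw [progSum]
  rw [← h1]
  simp

/-- Under the divisibility and correlation properties of Gauss periods, the sums `progSum` take only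
two values. -/
lemma progSum_two_values {a : ℤ} (ha : 9 * a = 3 ^ (72 * 19 ^ s))
    (hper : ∀ b, η (b + 323 * 19 ^ s) = η b) (h3 : ∀ b, η (3 * b) = η b)
    (hsum : ∑ b ∈ Finset.range (323 * 19 ^ s), η b = -1)
    (hdiv : ∀ b, a ∣ 19 * η b - ∑ l ∈ Finset.range 19, η (b + 17 * (19 ^ s * l)))
    (hcorr : ∀ t, 323 * ∑ b ∈ Finset.range (323 * 19 ^ s),
      progSum s η b * progSum s η (b + 19 ^ s * t) =
        19 ^ s * ((if 323 ∣ t then 323 * (81 * a ^ 2) else 0) - (81 * a ^ 2 - 1))) (b : ℕ) :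
    323 * progSum s η b + 1 = 161 * a ∨ 323 * progSum s η b + 1 = -(162 * a) := by
  have hstep : ∀ b, ¬ 19 ^ s ∣ b → progSum s η (b + 17) = progSum s η b :=
    fun b hb => progSum_add_seventeen hper h3 hb
  obtain ⟨c, hc⟩ := exists_apply_eq_apply_mul (progSum_add_period hper) hstep b
  rw [hc]
  refine two_values_of_autocorrelation (M := 19 ^ s) (Odd.pow (by decide)) ha
    (fun c => progSum s η (19 ^ s * c)) (progSum_mul_add_period hper) (progSum_three_mul hper h3)
    (sum_progSum hper h3 hsum) (fun t => ?_) (fun c => ?_) c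
  · have h1 := sum_range_eq_pow_mul_sum
      (G := fun b => progSum s η b * progSum s η (b + 19 ^ s * t)) (s := s) ?_ ?_
    · have h2 := hcorr t
      rw [h1] at h2
      have hM : (19 : ℤ) ^ s ≠ 0 := by positivity
      apply mul_left_cancel₀ hM
      rw [← h2]
      simp_rw [mul_add]
      ring
    · intro b
      rw [add_right_comm, progSum_add_period hper, progSum_add_period hper]
    · intro b hb
      rw [add_right_comm, hstep b hb, hstep]
      rwa [Nat.dvd_add_left (dvd_mul_right _ _)]
  · have h1 := progSum_mul_eq hper h3 c
    have h2 := hdiv (19 ^ s * c)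
    have h4 : ∑ n ∈ Finset.range (19 ^ s * 19), η (19 ^ s * c + 17 * n) =
        ∑ l ∈ Finset.range 19, progSum s η (19 ^ s * (c + 17 * l)) := by
      rw [sum_range_mul_eq]
      refine Finset.sum_congr rfl fun l _ => Finset.sum_congr rfl fun i _ => congrArg η ?_
      ring
    have h5 : ∑ l ∈ Finset.range 19, η (19 ^ s * c + 17 * (19 ^ s * l)) =
        ∑ l ∈ Finset.range 19, η (19 ^ s * (c + 17 * l)) :=
      Finset.sum_congr rfl fun l _ => congrArg η (by ring)
    rw [h5] at h2
    rw [h4] at h1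
    have h6 : 19 * progSum s η (19 ^ s * c) -
        ∑ l ∈ Finset.range 19, progSum s η (19 ^ s * (c + 17 * l)) = 19 * η (19 ^ s * c) -
          ∑ l ∈ Finset.range 19, η (19 ^ s * (c + 17 * l)) := by
      linarith
    rw [h6]
    exact h2

end Periods

section CharacterSums

variable {F : Type} [Field F] [Fintype F]

/-- The integer value at `b` of the Fourier transform of a symmetric set `A`. -/
def hatSum (tr : F →+ ZMod 3) (A : Finset F) (b : F) : ℤ := ∑ x ∈ A, traceWeight (tr (b * x))

lemma sum_traceChar_eq_ite {ζ : ℂ} (hζ : ζ ^ 2 + ζ + 1 = 0) {tr : F →+ ZMod 3}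
    (htr : ∃ x, tr x ≠ 0) (x : F) :
    ∑ b : F, traceChar ζ tr (b * x) = if x = 0 then (Fintype.card F : ℂ) else 0 := by
  split_ifs with hx
  · simp [hx, traceChar]
  · obtain ⟨c, hc⟩ := htr
    have h1 : traceChar ζ tr c ≠ 1 := by
      have h2 : ζ ≠ 1 := by
        rintro rfl
        norm_num at hζ
      have h3 : ζ ^ 2 ≠ 1 := by
        intro h
        have h4 : ζ = -2 := by linear_combination hζ - h
        rw [h4] at hζ
        norm_num at hζ
      have h5 : (tr c).val = 1 ∨ (tr c).val = 2 := by
        revert hc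
        generalize tr c = t
        revert t
        decide
      rw [traceChar]
      rcases h5 with h | h <;> rw [h]
      · rwa [pow_one]
      · exact h3
    have h2 : traceChar ζ tr c * ∑ b : F, traceChar ζ tr (b * x) =
        ∑ b : F, traceChar ζ tr (b * x) := by
      rw [Finset.mul_sum]
      refine Fintype.sum_equiv (Equiv.addLeft (c / x)) _ _ fun b => ?_
      rw [← traceChar_add hζ, Equiv.coe_addLeft, add_mul, div_mul_cancel₀ _ hx]
    have h3 : (traceChar ζ tr c - 1) * ∑ b : F, traceChar ζ tr (b * x) = 0 := by
      linear_combination h2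
    exact (mul_eq_zero.1 h3).resolve_left (sub_ne_zero.2 h1)

lemma hatSum_cast {ζ : ℂ} (hζ : ζ ^ 2 + ζ + 1 = 0) (tr : F →+ ZMod 3) {A : Finset F}
    (hA : ∀ x, -x ∈ A ↔ x ∈ A) (b : F) :
    (hatSum tr A b : ℂ) = ∑ x ∈ A, traceChar ζ tr (b * x) := by
  have h := sum_mul_traceChar (v := fun x : F => b * x) (fun x => mul_neg b x) hζ tr
    (f := fun x => if x ∈ A then 1 else 0) (fun x => by simp only [hA])
  simp only [ite_mul, one_mul, zero_mul, Finset.sum_ite_mem, Finset.univ_inter] at h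
  rw [h, hatSum, Int.cast_sum]

lemma exists_sq_add_self_add_one_eq_zero : ∃ ζ : ℂ, ζ ^ 2 + ζ + 1 = 0 := by
  obtain ⟨z, hz⟩ := IsAlgClosed.exists_pow_nat_eq (-3 : ℂ) (n := 2) (by norm_num)
  exact ⟨(-1 + z) / 2, by linear_combination hz / 4⟩

lemma sum_traceWeight_units {tr : F →+ ZMod 3} (htr : ∃ x, tr x ≠ 0) :
    ∑ x : Fˣ, traceWeight (tr x) = -1 := by
  obtain ⟨ζ, hζ⟩ := exists_sq_add_self_add_one_eq_zero
  have h1 := sum_mul_traceChar (v := fun x : Fˣ => (x : F)) (fun x => Units.val_neg x) hζ tr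
    (f := fun _ => 1) (fun _ => rfl)
  have h2 := sum_traceChar_eq_ite hζ htr 1
  rw [if_neg one_ne_zero, sum_eq_apply_zero_add_sum_units] at h2
  simp only [one_mul, mul_one] at h1 h2
  rw [h1, traceChar, map_zero, ZMod.val_zero, pow_zero] at h2
  have h3 : ((∑ x : Fˣ, traceWeight (tr x) : ℤ) : ℂ) = (-1 : ℤ) := by
    push_cast
    linear_combination h2
  exact_mod_cast h3

lemma sum_hatSum_mul_hatSum {tr : F →+ ZMod 3} (htr : ∃ x, tr x ≠ 0) {A B : Finset F}
    (hA : ∀ x, -x ∈ A ↔ x ∈ A) (hB : ∀ x, -x ∈ B ↔ x ∈ B) :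
    ∑ b : F, hatSum tr A b * hatSum tr B b = Fintype.card F * (A ∩ B).card := by
  obtain ⟨ζ, hζ⟩ := exists_sq_add_self_add_one_eq_zero
  have h : ((∑ b : F, hatSum tr A b * hatSum tr B b : ℤ) : ℂ) =
      ((Fintype.card F * (A ∩ B).card : ℤ) : ℂ) := by
    push_cast
    simp_rw [hatSum_cast hζ tr hA, hatSum_cast hζ tr hB, Finset.sum_mul_sum,
      ← traceChar_add hζ, ← mul_add]
    rw [Finset.sum_comm]
    have h1 : ∀ x ∈ A, ∑ b : F, ∑ y ∈ B, traceChar ζ tr (b * (x + y)) =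
        if x ∈ B then (Fintype.card F : ℂ) else 0 := by
      intro x _
      rw [Finset.sum_comm]
      simp_rw [sum_traceChar_eq_ite hζ htr, add_eq_zero_iff_neg_eq]
      rw [Finset.sum_ite_eq]
      simp only [hB]
    rw [Finset.sum_congr rfl h1, ← Finset.sum_filter, Finset.sum_const, Finset.filter_mem_eq_inter,
      nsmul_eq_mul, mul_comm]
  exact_mod_cast h

/-- The number of representations of `d` as a sum of two elements of `A`. -/
def repCount (A : Finset F) (d : F) : ℕ := ∑ x ∈ A, ∑ y ∈ A, if x + y = d then 1 else 0

lemma card_mul_repCount {ζ : ℂ} (hζ : ζ ^ 2 + ζ + 1 = 0) {tr : F →+ ZMod 3}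
    (htr : ∃ x, tr x ≠ 0) {A : Finset F} (hA : ∀ x, -x ∈ A ↔ x ∈ A) (d : F) :
    (Fintype.card F * repCount A d : ℂ) =
      ∑ b : F, (hatSum tr A b : ℂ) ^ 2 * traceChar ζ tr (b * -d) := by
  simp_rw [hatSum_cast hζ tr hA, pow_two, Finset.sum_mul_sum, ← traceChar_add hζ, ← mul_add,
    Finset.sum_mul, ← traceChar_add hζ, ← mul_add]
  rw [Finset.sum_comm, repCount]
  push_cast
  rw [Finset.mul_sum]
  refine Finset.sum_congr rfl fun x _ => ?_
  rw [Finset.sum_comm, Finset.mul_sum]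
  refine Finset.sum_congr rfl fun y _ => ?_
  rw [sum_traceChar_eq_ite hζ htr]
  simp only [← sub_eq_add_neg, sub_eq_zero, mul_ite, mul_one, mul_zero]

lemma sum_hatSum_mul_traceChar {ζ : ℂ} (hζ : ζ ^ 2 + ζ + 1 = 0) {tr : F →+ ZMod 3}
    (htr : ∃ x, tr x ≠ 0) {A : Finset F} (hA : ∀ x, -x ∈ A ↔ x ∈ A) (d : F) :
    ∑ b : F, (hatSum tr A b : ℂ) * traceChar ζ tr (b * -d) =
      if d ∈ A then (Fintype.card F : ℂ) else 0 := by
  simp_rw [hatSum_cast hζ tr hA, Finset.sum_mul, ← traceChar_add hζ, ← mul_add]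
  rw [Finset.sum_comm]
  simp_rw [sum_traceChar_eq_ite hζ htr, ← sub_eq_add_neg, sub_eq_zero]
  rw [Finset.sum_ite_eq']

/-- If the nontrivial Fourier coefficients of a symmetric set satisfy a common quadratic equation,
then the number of representations of a nonzero element depends only on its membership. -/
lemma repCount_eq_repCount {tr : F →+ ZMod 3} (htr : ∃ x, tr x ≠ 0) {A : Finset F}
    (hA : ∀ x, -x ∈ A ↔ x ∈ A) {e₂ e₁ e₀ : ℤ} (he : e₂ ≠ 0)
    (hquad : ∀ b : F, b ≠ 0 → e₂ * hatSum tr A b ^ 2 + e₁ * hatSum tr A b + e₀ = 0)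
    {d d' : F} (hd : d ≠ 0) (hd' : d' ≠ 0) (hdd' : d ∈ A ↔ d' ∈ A) :
    repCount A d = repCount A d' := by
  obtain ⟨ζ, hζ⟩ := exists_sq_add_self_add_one_eq_zero
  have key : ∀ d : F, d ≠ 0 → (e₂ * (Fintype.card F * repCount A d) : ℂ) =
      e₂ * hatSum tr A 0 ^ 2 + e₁ * hatSum tr A 0 + e₀ -
        e₁ * (if d ∈ A then (Fintype.card F : ℂ) else 0) := by
    intro d hd
    have h1 : ∑ b : F, (e₂ * hatSum tr A b ^ 2 + e₁ * hatSum tr A b + e₀ : ℂ) *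
        traceChar ζ tr (b * -d) = e₂ * hatSum tr A 0 ^ 2 + e₁ * hatSum tr A 0 + e₀ := by
      rw [Finset.sum_eq_single 0]
      · simp [traceChar]
      · intro b _ hb
        have := hquad b hb
        have h2 : (e₂ * hatSum tr A b ^ 2 + e₁ * hatSum tr A b + e₀ : ℂ) = 0 := by
          exact_mod_cast this
        rw [h2, zero_mul]
      · simp
    have h2 := sum_traceChar_eq_ite hζ htr (-d)
    rw [if_neg (neg_ne_zero.2 hd)] at h2
    simp_rw [add_mul, Finset.sum_add_distrib, mul_assoc, ← Finset.mul_sum] at h1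
    rw [h2, ← card_mul_repCount hζ htr hA, sum_hatSum_mul_traceChar hζ htr hA] at h1
    linear_combination h1
  have h1 := key d hd
  simp only [hdd'] at h1
  rw [← key d' hd'] at h1
  have hq : (Fintype.card F : ℂ) ≠ 0 := by exact_mod_cast Fintype.card_ne_zero
  have h2 := mul_left_cancel₀ hq (mul_left_cancel₀ (Int.cast_ne_zero.2 he) h1)
  exact_mod_cast h2

omit [Fintype F] in
lemma fromRel_adj_iff {A : Finset F} (hA : ∀ x, -x ∈ A ↔ x ∈ A) (h0 : (0 : F) ∉ A) (x y : F) :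
    (SimpleGraph.fromRel (fun x y : F => x - y ∈ A)).Adj x y ↔ x - y ∈ A := by
  rw [SimpleGraph.fromRel_adj, ← neg_sub x y, hA, or_self]
  refine ⟨And.right, fun h => ⟨?_, h⟩⟩
  rintro rfl
  exact h0 (by simpa using h)

lemma card_commonNeighbors_eq_repCount {A : Finset F} (hA : ∀ x, -x ∈ A ↔ x ∈ A)
    (h0 : (0 : F) ∉ A) (v w : F) :
    Fintype.card ((SimpleGraph.fromRel (fun x y : F => x - y ∈ A)).commonNeighbors v w) =
      repCount A (v - w) := by
  have h1 : repCount A (v - w) = ((A ×ˢ A).filter (fun x => x.1 + x.2 = v - w)).card := by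
    rw [Finset.card_filter, Finset.sum_product, repCount]
  rw [h1, ← Set.toFinset_card]
  refine Finset.card_bij (fun z _ => (v - z, z - w)) ?_ ?_ ?_
  · intro z hz
    rw [Set.mem_toFinset, SimpleGraph.mem_commonNeighbors, fromRel_adj_iff hA h0,
      fromRel_adj_iff hA h0, ← neg_sub z w, hA] at hz
    simp [hz.1, hz.2]
  · intro z _ z' _ h
    simpa using congrArg Prod.snd h
  · rintro ⟨x, y⟩ hxy
    simp only [Finset.mem_filter, Finset.mem_product] at hxy
    refine ⟨v - x, ?_, ?_⟩
    · rw [Set.mem_toFinset, SimpleGraph.mem_commonNeighbors, fromRel_adj_iff hA h0,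
        fromRel_adj_iff hA h0, ← neg_sub (v - x) w, hA]
      have : v - x - w = y := by linear_combination -hxy.2
      simp [this, hxy.1]
    · ext
      · simp
      · linear_combination -hxy.2

/-- A symmetric set whose nontrivial Fourier coefficients satisfy a common quadratic equation is
the connection set of a strongly regular Cayley graph. -/
lemma fromRel_isSRGWith {tr : F →+ ZMod 3} (htr : ∃ x, tr x ≠ 0) {A : Finset F}
    (hA : ∀ x, -x ∈ A ↔ x ∈ A) (h0 : (0 : F) ∉ A) (hne : A.Nonempty)
    (hcard : A.card + 1 < Fintype.card F) {e₂ e₁ e₀ : ℤ} (he : e₂ ≠ 0)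
    (hquad : ∀ b : F, b ≠ 0 → e₂ * hatSum tr A b ^ 2 + e₁ * hatSum tr A b + e₀ = 0) :
    SimpleGraph.fromRel (fun x y : F => x - y ∈ A) ≠ ⊤ ∧
      SimpleGraph.fromRel (fun x y : F => x - y ∈ A) ≠ ⊥ ∧
      ∃ l u : ℕ, (SimpleGraph.fromRel (fun x y : F => x - y ∈ A)).IsSRGWith
        (Fintype.card F) A.card l u := by
  obtain ⟨d, hd⟩ := hne
  obtain ⟨d', hd'⟩ : ∃ d', d' ∉ insert 0 A := by
    by_contra! h
    have h1 := Finset.card_le_card (fun x _ => h x : (Finset.univ : Finset F) ⊆ insert 0 A)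
    have h2 := Finset.card_insert_le (0 : F) A
    rw [Finset.card_univ] at h1
    omega
  rw [Finset.mem_insert, not_or] at hd'
  refine ⟨fun h => ?_, fun h => ?_, repCount A d, repCount A d', ?_⟩
  · have h1 := fromRel_adj_iff hA h0 d' 0
    rw [h, SimpleGraph.top_adj, sub_zero] at h1
    exact hd'.2 (h1.1 hd'.1)
  · have h1 := fromRel_adj_iff hA h0 d 0
    rw [h, SimpleGraph.bot_adj, sub_zero] at h1
    exact h1.2 hd
  · refine ⟨rfl, fun v => ?_, fun v w hvw => ?_, fun v w hvw hvw' => ?_⟩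
    · rw [← SimpleGraph.card_neighborFinset_eq_degree]
      refine Finset.card_bij (fun z _ => v - z) ?_ ?_ ?_
      · intro z hz
        rwa [SimpleGraph.mem_neighborFinset, fromRel_adj_iff hA h0] at hz
      · intro z _ z' _ h
        exact sub_right_injective h
      · intro x hx
        refine ⟨v - x, ?_, by simp⟩
        rw [SimpleGraph.mem_neighborFinset, fromRel_adj_iff hA h0]
        simpa using hx
    · rw [card_commonNeighbors_eq_repCount hA h0]
      rw [fromRel_adj_iff hA h0] at hvw
      exact repCount_eq_repCount htr hA he hquad (fun h => h0 (h ▸ hvw)) (fun h => h0 (h ▸ hd))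
        (iff_of_true hvw hd)
    · rw [card_commonNeighbors_eq_repCount hA h0]
      rw [fromRel_adj_iff hA h0] at hvw'
      exact repCount_eq_repCount htr hA he hquad (sub_ne_zero.2 hvw) hd'.1
        (iff_of_false hvw' hd'.2)

end CharacterSums

section CyclotomicPeriods

variable {F : Type} [Field F] [Fintype F] {γ : Fˣ}

lemma exists_pow_eq_of_orderOf (hγ : orderOf γ = Fintype.card F - 1) (x : Fˣ) :
    ∃ n < orderOf γ, γ ^ n = x := by
  have h : Nat.card Fˣ = orderOf γ := by rw [Nat.card_eq_fintype_card, Fintype.card_units, hγ]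
  have hx : x ∈ Subgroup.zpowers γ := by
    rw [Subgroup.eq_top_of_card_eq (Subgroup.zpowers γ) (by rw [Nat.card_zpowers, h])]
    exact Subgroup.mem_top x
  rw [mem_zpowers_iff_mem_range_orderOf] at hx
  obtain ⟨n, hn, h⟩ := Finset.mem_image.1 hx
  exact ⟨n, Finset.mem_range.1 hn, h⟩

lemma sum_ite_pow_eq (hγ : orderOf γ = Fintype.card F - 1) {A : Type} [AddCommMonoid A]
    {L L' : ℕ} (hL : L * L' + 1 = Fintype.card F) (z : Fˣ) (f : Fˣ → A) :
    ∑ x : Fˣ, (if x ^ L = z ^ L then f x else 0) =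
      ∑ k ∈ Finset.range L, f (z * γ ^ (L' * k)) := by
  have hord : orderOf γ = L * L' := by omega
  have hpos : 0 < L * L' := hord ▸ orderOf_pos γ
  have hL0 : 0 < L := Nat.pos_of_mul_pos_right hpos
  have hL1 : 0 < L' := Nat.pos_of_mul_pos_left hpos
  rw [← Finset.sum_filter]
  symm
  refine Finset.sum_bij (fun k _ => z * γ ^ (L' * k)) ?_ ?_ ?_ (fun _ _ => rfl)
  · intro k _
    rw [Finset.mem_filter]
    refine ⟨Finset.mem_univ _, ?_⟩
    rw [mul_pow, ← pow_mul, show L' * k * L = orderOf γ * k by rw [hord]; ring, pow_mul,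
      pow_orderOf_eq_one, one_pow, mul_one]
  · intro k hk k' hk' h
    rw [Finset.mem_range] at hk hk'
    have h1 := pow_injOn_Iio_orderOf (x := γ) (by rw [Set.mem_Iio, hord]; nlinarith)
      (by rw [Set.mem_Iio, hord]; nlinarith) (mul_left_cancel h)
    exact Nat.eq_of_mul_eq_mul_left hL1 h1
  · intro x hx
    obtain ⟨n, hn, hx'⟩ := exists_pow_eq_of_orderOf hγ (z⁻¹ * x)
    have h1 : γ ^ (n * L) = 1 := by
      rw [pow_mul, hx', mul_pow, (Finset.mem_filter.1 hx).2, ← mul_pow, inv_mul_cancel, one_pow]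
    have h2 := orderOf_dvd_of_pow_eq_one h1
    rw [hord, mul_comm L L'] at h2
    obtain ⟨k, rfl⟩ := Nat.dvd_of_mul_dvd_mul_right hL0 h2
    refine ⟨k, Finset.mem_range.2 ?_, ?_⟩
    · rw [hord] at hn
      nlinarith
    · rw [hx', mul_inv_cancel_left]

lemma sum_units_eq_sum_range (hγ : orderOf γ = Fintype.card F - 1) {A : Type} [AddCommMonoid A]
    (f : Fˣ → A) : ∑ x, f x = ∑ n ∈ Finset.range (Fintype.card F - 1), f (γ ^ n) := by
  have h0 : 0 < Fintype.card F := Fintype.card_pos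
  have h := sum_ite_pow_eq hγ (L := Fintype.card F - 1) (L' := 1) (by omega) 1 f
  have h1 : ∀ x : Fˣ, x ^ (Fintype.card F - 1) = 1 := fun x => by
    rw [← Fintype.card_units, pow_card_eq_one]
  simpa [h1] using h

/-- The Gaussian period, up to the antisymmetric part of the additive character. -/
def period (γ : Fˣ) (tr : F →+ ZMod 3) (N K b : ℕ) : ℤ :=
  ∑ k ∈ Finset.range K, traceWeight (tr ((γ ^ (b + N * k) : Fˣ) : F))

lemma period_eq (hγ : orderOf γ = Fintype.card F - 1) (tr : F →+ ZMod 3) {N K : ℕ}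
    (hK : N * K + 1 = Fintype.card F) (b : ℕ) : period γ tr N K b =
      ∑ x : Fˣ, (if x ^ K = (γ ^ b) ^ K then traceWeight (tr x) else 0) := by
  rw [sum_ite_pow_eq hγ (L' := N) (by rw [mul_comm, hK]) (γ ^ b) fun x => traceWeight (tr x),
    period]
  simp only [pow_add]

lemma period_add_period (hγ : orderOf γ = Fintype.card F - 1) (tr : F →+ ZMod 3) {N K : ℕ}
    (hK : N * K + 1 = Fintype.card F) (b : ℕ) : period γ tr N K (b + N) = period γ tr N K b := by
  have h : (γ ^ (b + N)) ^ K = (γ ^ b) ^ K := by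
    rw [pow_add, mul_pow, ← pow_mul γ N, show N * K = orderOf γ by omega, pow_orderOf_eq_one,
      mul_one]
  rw [period_eq hγ tr hK, period_eq hγ tr hK, h]

lemma period_three_mul [CharP F 3] (hγ : orderOf γ = Fintype.card F - 1) {tr : F →+ ZMod 3}
    (htr : ∀ x, tr (x ^ 3) = tr x) {N K : ℕ} (hK : N * K + 1 = Fintype.card F) (b : ℕ) :
    period γ tr N K (3 * b) = period γ tr N K b := by
  rw [period_eq hγ tr hK, period_eq hγ tr hK]
  symm
  refine Fintype.sum_equiv (Equiv.ofBijective _ bijective_units_cube) _ _ fun x => ?_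
  have h : (x ^ 3) ^ K = (γ ^ (3 * b)) ^ K ↔ x ^ K = (γ ^ b) ^ K := by
    have h1 : (x ^ 3) ^ K = (x ^ K) ^ 3 := pow_right_comm x 3 K
    have h2 : (γ ^ (3 * b)) ^ K = ((γ ^ b) ^ K) ^ 3 := by
      rw [mul_comm, pow_mul, pow_right_comm]
    rw [h1, h2]
    exact bijective_units_cube.1.eq_iff
  simp only [Equiv.ofBijective_apply, h, Units.val_pow_eq_pow_val, htr]

lemma sum_period (hγ : orderOf γ = Fintype.card F - 1) {tr : F →+ ZMod 3}
    (htr : ∃ x, tr x ≠ 0) {N K : ℕ} (hK : N * K + 1 = Fintype.card F) :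
    ∑ b ∈ Finset.range N, period γ tr N K b = -1 := by
  rw [← sum_traceWeight_units htr, sum_units_eq_sum_range hγ,
    show Fintype.card F - 1 = N * K by omega, sum_range_mul_eq, Finset.sum_comm]
  simp only [period, add_comm]

lemma sum_period_add_mul (hγ : orderOf γ = Fintype.card F - 1) (tr : F →+ ZMod 3) {L N K : ℕ}
    (hK : L * N * K + 1 = Fintype.card F) (b : ℕ) :
    ∑ l ∈ Finset.range L, period γ tr (L * N) K (b + N * l) =
      ∑ x : Fˣ, (if x ^ (L * K) = (γ ^ b) ^ (L * K) then traceWeight (tr x) else 0) := by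
  rw [sum_ite_pow_eq hγ (L' := N) (by rw [← hK]; ring) (γ ^ b) fun x => traceWeight (tr x),
    sum_range_mul_eq, Finset.sum_comm]
  refine Finset.sum_congr rfl fun l _ => Finset.sum_congr rfl fun k _ => ?_
  rw [← pow_add]
  ring_nf

lemma three_pow_dvd_period [CharP F 3] (hγ : orderOf γ = Fintype.card F - 1) {tr : F →+ ZMod 3}
    (htr : ∀ x, tr (x ^ 3) = tr x) {s K : ℕ} (hF : Fintype.card F = 3 ^ (144 * 19 ^ s))
    (hK : 323 * 19 ^ s * K + 1 = Fintype.card F) (b : ℕ) :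
    (3 : ℤ) ^ (72 * 19 ^ s - 2) ∣ 19 * period γ tr (323 * 19 ^ s) K b -
      ∑ l ∈ Finset.range 19, period γ tr (323 * 19 ^ s) K (b + 17 * (19 ^ s * l)) := by
  have h := three_pow_dvd_sum_traceWeight htr hF hK (γ ^ b)
  have e : 323 * 19 ^ s = 19 * (17 * 19 ^ s) := by ring
  rw [e] at hK ⊢
  rw [← period_eq hγ tr hK, ← sum_period_add_mul hγ tr hK] at h
  simpa only [mul_assoc] using h

/-- The union of the `19 ^ s` cyclotomic classes of order `323 * 19 ^ s` with indices
`17 * i + t * 19 ^ s`. -/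
def cyclotomicUnion (γ : Fˣ) (s K t : ℕ) : Finset F :=
  (Finset.range (19 ^ s) ×ˢ Finset.range K).image
    fun ik => ((γ ^ (17 * ik.1 + t * 19 ^ s + 323 * 19 ^ s * ik.2) : Fˣ) : F)

variable {s K : ℕ}

lemma mem_cyclotomicUnion (hγ : orderOf γ = Fintype.card F - 1)
    (hK : 323 * 19 ^ s * K + 1 = Fintype.card F) (t : ℕ) (x : F) : x ∈ cyclotomicUnion γ s K t ↔
      ∃ i < 19 ^ s, ∃ k, x = ((γ ^ (17 * i + t * 19 ^ s + 323 * 19 ^ s * k) : Fˣ) : F) := by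
  have hK0 : 0 < K := by
    rcases Nat.eq_zero_or_pos K with rfl | h
    · have := Fintype.one_lt_card (α := F)
      omega
    · exact h
  constructor
  · intro h
    obtain ⟨⟨i, k⟩, hik, rfl⟩ := Finset.mem_image.1 h
    rw [Finset.mem_product, Finset.mem_range] at hik
    exact ⟨i, hik.1, k, rfl⟩
  · rintro ⟨i, hi, k, rfl⟩
    refine Finset.mem_image.2 ⟨(i, k % K), ?_, ?_⟩
    · rw [Finset.mem_product, Finset.mem_range, Finset.mem_range]
      exact ⟨hi, Nat.mod_lt _ hK0⟩
    · rw [Units.val_inj, pow_eq_pow_iff_modEq, show orderOf γ = 323 * 19 ^ s * K by omega]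
      exact ((Nat.mod_modEq k K).mul_left' _).add_left _

lemma eq_of_seventeen_mul_add_modEq {i i' u u' : ℕ} (hi : i < 19 ^ s) (hi' : i' < 19 ^ s)
    (h : 17 * i + 19 ^ s * u ≡ 17 * i' + 19 ^ s * u' [MOD 19 ^ s]) : i = i' := by
  have h1 : 17 * i ≡ 17 * i' [MOD 19 ^ s] := by
    simpa [Nat.ModEq] using h
  have h2 := Nat.ModEq.cancel_left_of_coprime (Nat.Coprime.pow_left s (by norm_num)) h1
  exact Nat.ModEq.eq_of_lt_of_lt h2 hi hi'

lemma injOn_cyclotomicUnion (hγ : orderOf γ = Fintype.card F - 1)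
    (hK : 323 * 19 ^ s * K + 1 = Fintype.card F) (t : ℕ) :
    Set.InjOn (fun ik : ℕ × ℕ => ((γ ^ (17 * ik.1 + t * 19 ^ s + 323 * 19 ^ s * ik.2) : Fˣ) : F))
      (Finset.range (19 ^ s) ×ˢ Finset.range K : Finset (ℕ × ℕ)) := by
  rintro ⟨i, k⟩ h ⟨i', k'⟩ h' e
  simp only [Finset.coe_product, Finset.coe_range, Set.mem_prod, Set.mem_Iio] at h h'
  have h1 := pow_eq_pow_iff_modEq.1 (Units.ext e)
  rw [show orderOf γ = 323 * 19 ^ s * K by omega] at h1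
  have h2 : i = i' := by
    refine eq_of_seventeen_mul_add_modEq (u := t + 323 * k) (u' := t + 323 * k') h.1 h'.1 ?_
    convert h1.of_dvd (show 19 ^ s ∣ 323 * 19 ^ s * K from ⟨323 * K, by ring⟩) using 1 <;> ring
  subst h2
  have h3 := Nat.ModEq.mul_left_cancel' (by positivity) (Nat.ModEq.add_left_cancel' _ h1)
  exact congrArg (Prod.mk i) (Nat.ModEq.eq_of_lt_of_lt h3 h.2 h'.2)

lemma card_cyclotomicUnion (hγ : orderOf γ = Fintype.card F - 1)
    (hK : 323 * 19 ^ s * K + 1 = Fintype.card F) (t : ℕ) :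
    (cyclotomicUnion γ s K t).card = 19 ^ s * K := by
  rw [cyclotomicUnion, Finset.card_image_of_injOn (injOn_cyclotomicUnion hγ hK t),
    Finset.card_product, Finset.card_range, Finset.card_range]

lemma zero_notMem_cyclotomicUnion {F : Type} [Field F] {γ : Fˣ} (t : ℕ) :
    (0 : F) ∉ cyclotomicUnion γ s K t := by
  intro h
  obtain ⟨ik, -, h⟩ := Finset.mem_image.1 h
  exact Units.ne_zero _ h

lemma neg_mem_cyclotomicUnion (hγ : orderOf γ = Fintype.card F - 1)
    (hK : 323 * 19 ^ s * K + 1 = Fintype.card F) (t : ℕ) (x : F) :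
    -x ∈ cyclotomicUnion γ s K t ↔ x ∈ cyclotomicUnion γ s K t := by
  obtain ⟨n, -, hn⟩ := exists_pow_eq_of_orderOf hγ (-1)
  have h1 : 323 * 19 ^ s * K ∣ n * 2 := by
    rw [show 323 * 19 ^ s * K = orderOf γ by omega]
    exact orderOf_dvd_of_pow_eq_one (by rw [pow_mul, hn, neg_one_sq])
  obtain ⟨c, rfl⟩ : 323 * 19 ^ s ∣ n := by
    refine Nat.Coprime.dvd_of_dvd_mul_right ?_ ((Dvd.intro _ rfl).trans h1)
    exact Nat.Coprime.mul_left (by norm_num) (Nat.Coprime.pow_left s (by norm_num))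
  have key : ∀ x, x ∈ cyclotomicUnion γ s K t → -x ∈ cyclotomicUnion γ s K t := by
    intro x hx
    obtain ⟨i, hi, k, rfl⟩ := (mem_cyclotomicUnion hγ hK t x).1 hx
    refine (mem_cyclotomicUnion hγ hK t _).2 ⟨i, hi, k + c, ?_⟩
    rw [mul_add, ← add_assoc, pow_add _ _ (323 * 19 ^ s * c), hn]
    simp
  exact ⟨fun h => neg_neg x ▸ key _ h, key x⟩

lemma card_inter_cyclotomicUnion (hγ : orderOf γ = Fintype.card F - 1)
    (hK : 323 * 19 ^ s * K + 1 = Fintype.card F) (t : ℕ) :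
    (cyclotomicUnion γ s K 0 ∩ cyclotomicUnion γ s K t).card =
      if 323 ∣ t then 19 ^ s * K else 0 := by
  split_ifs with h
  · obtain ⟨c, rfl⟩ := h
    have h1 : cyclotomicUnion γ s K (323 * c) ⊆ cyclotomicUnion γ s K 0 := by
      intro x hx
      obtain ⟨i, hi, k, rfl⟩ := (mem_cyclotomicUnion hγ hK _ x).1 hx
      refine (mem_cyclotomicUnion hγ hK _ _).2 ⟨i, hi, c + k, ?_⟩
      ring_nf
    rw [Finset.inter_eq_right.2 h1, card_cyclotomicUnion hγ hK]
  · rw [Finset.card_eq_zero, Finset.eq_empty_iff_forall_notMem]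
    intro x hx
    rw [Finset.mem_inter, mem_cyclotomicUnion hγ hK, mem_cyclotomicUnion hγ hK] at hx
    obtain ⟨⟨i, hi, k, rfl⟩, i', hi', k', e⟩ := hx
    have h1 := pow_eq_pow_iff_modEq.1 (Units.ext e)
    rw [show orderOf γ = 323 * 19 ^ s * K by omega] at h1
    have h2 : i = i' := by
      refine eq_of_seventeen_mul_add_modEq (u := 323 * k) (u' := t + 323 * k') hi hi' ?_
      convert h1.of_dvd (show 19 ^ s ∣ 323 * 19 ^ s * K from ⟨323 * K, by ring⟩) using 1 <;> ring
    subst h2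
    have h3 : 17 * i + 19 ^ s * (323 * k) ≡ 17 * i + 19 ^ s * (t + 323 * k')
        [MOD 19 ^ s * 323] := by
      convert h1.of_dvd (show 19 ^ s * 323 ∣ 323 * 19 ^ s * K from ⟨K, by ring⟩) using 1 <;> ring
    have h4 := Nat.ModEq.mul_left_cancel' (by positivity) (Nat.ModEq.add_left_cancel' _ h3)
    apply h
    simpa [Nat.ModEq, Nat.dvd_iff_mod_eq_zero, eq_comm] using h4

lemma hatSum_cyclotomicUnion (hγ : orderOf γ = Fintype.card F - 1) (tr : F →+ ZMod 3)
    (hK : 323 * 19 ^ s * K + 1 = Fintype.card F) (t b : ℕ) :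
    hatSum tr (cyclotomicUnion γ s K t) ((γ ^ b : Fˣ) : F) =
      progSum s (period γ tr (323 * 19 ^ s) K) (b + 19 ^ s * t) := by
  rw [hatSum, cyclotomicUnion, Finset.sum_image (injOn_cyclotomicUnion hγ hK t),
    Finset.sum_product, progSum]
  refine Finset.sum_congr rfl fun i _ => Finset.sum_congr rfl fun k _ => ?_
  rw [← Units.val_mul, ← pow_add]
  ring_nf

lemma sum_progSum_period_mul (hγ : orderOf γ = Fintype.card F - 1) {tr : F →+ ZMod 3}
    (htr : ∃ x, tr x ≠ 0) (hK : 323 * 19 ^ s * K + 1 = Fintype.card F) (t : ℕ) :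
    323 * ∑ b ∈ Finset.range (323 * 19 ^ s), progSum s (period γ tr (323 * 19 ^ s) K) b *
        progSum s (period γ tr (323 * 19 ^ s) K) (b + 19 ^ s * t) =
      19 ^ s * ((if 323 ∣ t then 323 * (Fintype.card F : ℤ) else 0) - (Fintype.card F - 1)) := by
  have h := sum_hatSum_mul_hatSum htr (neg_mem_cyclotomicUnion hγ hK 0)
    (neg_mem_cyclotomicUnion hγ hK t)
  have h0 : ∀ t, hatSum tr (cyclotomicUnion γ s K t) 0 = 19 ^ s * K := by
    intro t
    simp [hatSum, traceWeight, card_cyclotomicUnion hγ hK]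
  have hper : ∀ b c, progSum s (period γ tr (323 * 19 ^ s) K) (b + 323 * 19 ^ s * c) =
      progSum s (period γ tr (323 * 19 ^ s) K) b := by
    intro b c
    induction c with
    | zero => simp
    | succ c ih => rw [Nat.mul_succ, ← add_assoc,
        progSum_add_period (period_add_period hγ tr hK), ih]
  rw [sum_eq_apply_zero_add_sum_units, h0, h0, sum_units_eq_sum_range hγ,
    show Fintype.card F - 1 = 323 * 19 ^ s * K by omega, sum_range_mul_eq,
    card_inter_cyclotomicUnion hγ hK] at h
  simp only [hatSum_cyclotomicUnion hγ tr hK, mul_zero, add_zero] at h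
  have h2 : ∀ k b, 323 * 19 ^ s * k + b + 19 ^ s * t = b + 19 ^ s * t + 323 * 19 ^ s * k := by
    intros
    ring
  simp only [h2, hper] at h
  simp only [add_comm (323 * 19 ^ s * _), hper, Finset.sum_const, Finset.card_range,
    nsmul_eq_mul] at h
  have hK' : (323 * 19 ^ s * K + 1 : ℤ) = Fintype.card F := by exact_mod_cast hK
  have hK0 : (K : ℤ) ≠ 0 := by
    rintro h
    have := Fintype.one_lt_card (α := F)
    rw [h] at hK'
    omega
  apply mul_left_cancel₀ hK0
  split_ifs at h ⊢
  · push_cast at h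
    linear_combination 323 * h - 19 ^ s * K * hK'
  · push_cast at h
    linear_combination 323 * h - 19 ^ s * K * hK'

lemma cyclotomicUnion_isSRGWith [CharP F 3] (hγ : orderOf γ = Fintype.card F - 1)
    {tr : F →+ ZMod 3} (htr : ∀ x, tr (x ^ 3) = tr x) (htr0 : ∃ x, tr x ≠ 0)
    (hF : Fintype.card F = 3 ^ (144 * 19 ^ s)) (hK : 323 * 19 ^ s * K + 1 = Fintype.card F)
    (t : ℕ) :
    SimpleGraph.fromRel (fun x y : F => x - y ∈ cyclotomicUnion γ s K t) ≠ ⊤ ∧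
      SimpleGraph.fromRel (fun x y : F => x - y ∈ cyclotomicUnion γ s K t) ≠ ⊥ ∧
      ∃ l u : ℕ, (SimpleGraph.fromRel
        (fun x y : F => x - y ∈ cyclotomicUnion γ s K t)).IsSRGWith
          (Fintype.card F) (19 ^ s * K) l u := by
  have hs : 1 ≤ 19 ^ s := Nat.one_le_pow _ _ (by norm_num)
  have hK0 : 0 < 19 ^ s * K := by
    have := Fintype.one_lt_card (α := F)
    rw [← hK, mul_assoc] at this
    omega
  have hcard := card_cyclotomicUnion hγ hK t
  set a : ℤ := 3 ^ (72 * 19 ^ s - 2) with ha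
  have ha9 : 9 * a = 3 ^ (72 * 19 ^ s) := by
    rw [ha, show (9 : ℤ) = 3 ^ 2 by norm_num, ← pow_add]
    congr 1
    omega
  have hq : (Fintype.card F : ℤ) = 81 * a ^ 2 := by
    rw [hF, show 144 * 19 ^ s = 72 * 19 ^ s * 2 by ring, pow_mul]
    push_cast
    rw [← ha9]
    ring
  rw [← hcard]
  refine fromRel_isSRGWith htr0 (neg_mem_cyclotomicUnion hγ hK t) (zero_notMem_cyclotomicUnion t)
    (Finset.card_pos.1 (by omega)) ?_ (e₂ := 323 ^ 2) (e₁ := 323 * (2 + a))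
    (e₀ := (1 - 161 * a) * (1 + 162 * a)) (by norm_num) ?_
  · rw [hcard, ← hK, mul_assoc]
    omega
  · intro b hb
    obtain ⟨n, -, hn⟩ := exists_pow_eq_of_orderOf hγ (Units.mk0 b hb)
    have hb' : b = ((γ ^ n : Fˣ) : F) := by rw [hn, Units.val_mk0]
    rw [hb', hatSum_cyclotomicUnion hγ tr hK]
    have h := progSum_two_values (η := period γ tr (323 * 19 ^ s) K) ha9
      (period_add_period hγ tr hK) (period_three_mul hγ htr hK) (sum_period hγ htr0 hK)
      (three_pow_dvd_period hγ htr hF hK)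
      (fun t => by rw [sum_progSum_period_mul hγ htr0 hK, hq]) (n + 19 ^ s * t)
    generalize progSum s (period γ tr (323 * 19 ^ s) K) (n + 19 ^ s * t) = z at h ⊢
    rcases h with h | h
    · linear_combination (323 * z + 1 + 162 * a) * h
    · linear_combination (323 * z + 1 - 161 * a) * h

end CyclotomicPeriods

lemma dvd_three_pow_sub_one (s : ℕ) : 323 * 19 ^ s ∣ 3 ^ (144 * 19 ^ s) - 1 := by
  have h19 : 19 ^ (s + 1) ∣ 3 ^ (144 * 19 ^ s) - 1 := by
    have h := (nineteen_pow_dvd_iff s (19 ^ s)).2 dvd_rfl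
    zify [Nat.one_le_pow (144 * 19 ^ s) 3 (by norm_num)]
    exact h
  have h17 : 17 ∣ 3 ^ (144 * 19 ^ s) - 1 := by
    rw [pow_mul]
    exact (show 17 ∣ 3 ^ 144 - 1 by norm_num).trans (Nat.sub_one_dvd_pow_sub_one _ _)
  rw [show 323 * 19 ^ s = 17 * 19 ^ (s + 1) by ring]
  exact Nat.Coprime.mul_dvd_of_dvd_of_dvd (Nat.Coprime.pow_right _ (by norm_num)) h17 h19

lemma exists_frobenius_invariant_trace (F : Type) [Field F] [Fintype F] [CharP F 3] :
    ∃ tr : F →+ ZMod 3, (∀ x, tr (x ^ 3) = tr x) ∧ ∃ x, tr x ≠ 0 := by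
  let := ZMod.algebra F 3
  refine ⟨(Algebra.trace (ZMod 3) F).toAddMonoidHom, fun x => ?_, ?_⟩
  · exact Algebra.trace_eq_of_algEquiv (FiniteField.frobeniusAlgEquivOfAlgebraic (ZMod 3) F) x
  · by_contra! h
    exact Algebra.trace_ne_zero (ZMod 3) F (LinearMap.ext h)

/-- Each `Cay(F_q, D_k)` is a strongly regular graph of degree `(q-1)/323`,
where `q = 3^{144*19^(m-1)}`, `N = 19^m*17`. -/
theorem cayley_srg_example_13
    (m N q : ℕ) (hm : 1 ≤ m)
    (hN : N = 19 ^ m * 17) (hq : q = 3 ^ (144 * 19 ^ (m - 1)))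
    (F : Type) [Field F] [Fintype F] (hF : Fintype.card F = q)
    (γ : Fˣ) (hγ : orderOf γ = q - 1)
    (D : ℕ → Set F)
    (hD : ∀ k, D k = {x : F | ∃ i < 19 ^ (m - 1), ∃ t : ℕ,
        x = ((γ : F)) ^ (17 * i + k * 19 ^ (m - 1) + N * t)}) :
    ∀ k ≤ 322,
      SimpleGraph.fromRel (fun x y : F => x - y ∈ D k) ≠ ⊤ ∧
      SimpleGraph.fromRel (fun x y : F => x - y ∈ D k) ≠ ⊥ ∧
      ∃ l u : ℕ, (SimpleGraph.fromRel (fun x y : F => x - y ∈ D k)).IsSRGWith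
        q ((q - 1) / 323) l u := by
  intro k _
  obtain ⟨s, rfl⟩ : ∃ s, m = s + 1 := ⟨m - 1, by omega⟩
  rw [Nat.add_sub_cancel] at hq hD
  subst hF
  have hN' : N = 323 * 19 ^ s := by rw [hN]; ring
  have : CharP F 3 := charP_of_card_eq_prime_pow hq
  obtain ⟨K, hK⟩ := dvd_three_pow_sub_one s
  rw [← hq] at hK
  have hK1 : 323 * 19 ^ s * K + 1 = Fintype.card F := by
    have : 0 < Fintype.card F := Fintype.card_pos
    omega
  obtain ⟨tr, htr, htr0⟩ := exists_frobenius_invariant_trace F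
  have hmem : ∀ x, x ∈ D k ↔ x ∈ cyclotomicUnion γ s K k := by
    intro x
    rw [mem_cyclotomicUnion hγ hK1, hD, hN']
    simp only [Set.mem_ofPred_eq, Units.val_pow_eq_pow_val]
  have hdeg : (Fintype.card F - 1) / 323 = 19 ^ s * K := by
    rw [hK, mul_assoc, Nat.mul_div_cancel_left _ (by norm_num)]
  simp only [hmem, hdeg]
  exact cyclotomicUnion_isSRGWith hγ htr htr0 hq hK1 k
end
end
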